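/- arXiv:2401.14301 — 7 statements merged into one kernel-verified Lean document; each statement's English description precedes it below -/
import Mathlib

section
/- Let p > 3 be a prime and let d be an integer with Legendre symbol (d/p) = −1. Let S̄(d,p) denote the determinant of the ((p−1)/2)×((p−1)/2) matrix obtained from the matrix [((j²+dk²)/p)]_{1≤j,k≤(p−1)/2} by replacing every entry of its first row (the row j = 1) by 1. Then (p−1)·S̄(d,p) = 2·T(d,p), and S̄(d,p) = ((p−1)/2)·det[((j²+dk²)/p)]_{2≤j,k≤(p−1)/2}. -/
theorem aux_det1 (m : ℕ) (M : Matrix (Fin (m+1)) (Fin (m+1)) ℤ)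
    (hrow : ∀ i : Fin m, ∑ k, M i.succ k = 0) (h0 : ∀ k, M 0 k = 1) :
    M.det = ((m : ℤ) + 1) * (M.submatrix Fin.succ Fin.succ).det := by
  have h1 : (M.updateCol 0 (fun i => ∑ k, M i k)).det = M.det := by
    have h2 := Matrix.det_updateCol_sum M 0 (fun _ => 1)
    simp only [smul_eq_mul, one_mul] at h2
    rw [← h2]
  rw [← h1, Matrix.det_succ_column_zero, Fin.sum_univ_succ]
  have h3 : (M.updateCol 0 (fun i => ∑ k, M i k)).submatrix (Fin.succAbove 0) Fin.succ
      = M.submatrix Fin.succ Fin.succ := by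
    ext i j
    simp
  rw [h3]
  simp [hrow, h0]

theorem aux_det2 (m : ℕ) (M : Matrix (Fin (m+1)) (Fin (m+1)) ℤ)
    (T : Matrix (Fin (m+2)) (Fin (m+2)) ℤ)
    (R : Matrix (Fin (m+1)) (Fin (m+1)) ℤ)
    (hcol : ∀ k, ∑ i, M i k = 0)
    (hR0 : ∀ k, R 0 k = 1) (hR : ∀ (i : Fin m) k, R i.succ k = M i.succ k)
    (hT00 : T 0 0 = 0) (hT0 : ∀ k : Fin (m+1), T 0 k.succ = -1)
    (hTc : ∀ k : Fin (m+1), T k.succ 0 = 1)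
    (hT : ∀ i k : Fin (m+1), T i.succ k.succ = M i k) :
    T.det = ((m : ℤ) + 1) * R.det := by
  have h1 : (T.updateRow 1 (fun k => ∑ i, T (Fin.succ i) k)).det = T.det := by
    have h2 := Matrix.det_updateRow_sum T 1 (fun i => if i = 0 then 0 else 1)
    simp only [smul_eq_mul] at h2
    rw [if_neg (by simp), one_mul] at h2
    rw [← h2]
    congr 2
    ext k
    rw [Finset.sum_apply, Fin.sum_univ_succ (n := m + 1)]
    simp
  rw [← h1, Matrix.det_succ_row _ 1, Fin.sum_univ_succ]
  have h3 : (T.updateRow 1 (fun k => ∑ i, T (Fin.succ i) k)).submatrix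
      (Fin.succAbove 1) (Fin.succAbove 0) = R.updateRow 0 ((-1 : ℤ) • R 0) := by
    ext i j
    refine Fin.cases ?_ (fun i => ?_) i
    · simp [Matrix.updateRow_apply, hT0, hR0]
    · have e : (Fin.succAbove (1 : Fin (m+2)) i.succ) = i.succ.succ := by
        rw [← Fin.succ_zero_eq_one, Fin.succ_succAbove_succ]; simp
      rw [Matrix.submatrix_apply, e]
      have e2 : i.succ.succ ≠ (1 : Fin (m+2)) := by
        rw [← Fin.succ_zero_eq_one]
        intro h
        exact Fin.succ_ne_zero _ (Fin.succ_injective _ h)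
      simp [Matrix.updateRow_apply, e2, hT, hR]
  rw [h3, Matrix.det_updateRow_smul]
  simp [hTc, hT, hcol]
  ring

theorem aux_sum (p : ℕ) [Fact p.Prime] (n : ℕ) (hn : p = 2 * n + 1) (a b : ZMod p)
    (hab : quadraticChar (ZMod p) (a * b) = -1) :
    ∑ i : Fin n, quadraticChar (ZMod p) (a + b * ((i : ℕ) + 1 : ZMod p) ^ 2) = 0 := by
  classical
  have hab0 : a * b ≠ 0 := by
    intro h
    rw [h] at hab
    simp at hab
  have ha : a ≠ 0 := left_ne_zero_of_mul hab0
  have hb : b ≠ 0 := right_ne_zero_of_mul hab0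
  set g : ZMod p → ℤ := fun x => if x = 0 then 0 else quadraticChar (ZMod p) (a + b * x ^ 2)
    with hg
  have hinv : Function.Involutive (fun x : ZMod p => a / b / x) := by
    intro x
    by_cases hx : x = 0
    · simp [hx]
    · field_simp
  have h1 : ∑ x, g x = ∑ x, - g x := by
    refine Fintype.sum_equiv hinv.toPerm _ _ (fun x => ?_)
    by_cases hx : x = 0
    · simp [hg, hx]
    · have hx' : a / b / x ≠ 0 := by positivity
      simp only [hg, Function.Involutive.coe_toPerm, hx, hx', if_false]
      have e : a + b * (a / b / x) ^ 2 = (a * b) * ((b * x)⁻¹) ^ 2 * (a + b * x ^ 2) := by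
        field_simp
        ring
      rw [e, map_mul, map_mul, hab, quadraticChar_sq_one' (by simp [hb, hx])]
      ring
  have h2 : ∑ x, g x = 0 := by
    rw [Finset.sum_neg_distrib] at h1
    linarith
  have h3 : ∑ x, g x = ∑ i ∈ Finset.range p, g (i : ZMod p) := by
    symm
    refine Finset.sum_bij (fun i _ => (i : ZMod p)) (by simp) ?_ ?_ (by simp)
    · intro i hi j hj h
      rw [ZMod.natCast_eq_natCast_iff] at h
      exact Nat.ModEq.eq_of_lt_of_lt h (Finset.mem_range.1 hi) (Finset.mem_range.1 hj)
    · intro x _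
      exact ⟨x.val, by simpa using ZMod.val_lt x, by simp⟩
  have h4 : ∑ i ∈ Finset.range p, g (i : ZMod p)
      = 2 * ∑ i ∈ Finset.range n, g ((i + 1 : ℕ) : ZMod p) := by
    have hp1 : Finset.range p = Finset.range (n + n + 1) := by rw [hn]; congr 1; ring
    rw [hp1, Finset.sum_range_succ', Finset.sum_range_add, ← Finset.sum_range_reflect
      (fun x => g ((n + x + 1 : ℕ) : ZMod p))]
    have : ∀ i ∈ Finset.range n, g ((n + (n - 1 - i) + 1 : ℕ) : ZMod p)
        = g ((i + 1 : ℕ) : ZMod p) := by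
      intro i hi
      have hi' := Finset.mem_range.1 hi
      have e : ((n + (n - 1 - i) + 1 : ℕ) : ZMod p) = - ((i + 1 : ℕ) : ZMod p) := by
        rw [eq_neg_iff_add_eq_zero, ← Nat.cast_add]
        have : n + (n - 1 - i) + 1 + (i + 1) = p := by omega
        rw [this]; simp
      rw [e]
      simp only [hg, neg_eq_zero, neg_sq]
    rw [Finset.sum_congr rfl this]
    simp [hg]
    ring
  have h5 : ∑ i ∈ Finset.range n, g ((i + 1 : ℕ) : ZMod p) = 0 := by linarith
  rw [Finset.sum_range] at h5
  rw [← h5]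
  refine Finset.sum_congr rfl (fun i _ => ?_)
  have hne : ((i + 1 : ℕ) : ZMod p) ≠ 0 := by
    rw [Ne, ZMod.natCast_eq_zero_iff]
    intro h
    have := Nat.le_of_dvd (by omega) h
    omega
  simp only [hg, hne, if_false]
  push_cast
  rfl

/-- For a prime `p > 3` and `d : ℤ` with `(d/p) = −1`, letting `S̄(d,p)` be the
determinant of the matrix obtained from `[((j²+dk²)/p)]_{1≤j,k≤(p−1)/2}` by replacing all
entries of the first row by `1`, we have `(p−1)·S̄(d,p) = 2·T(d,p)` and
`S̄(d,p) = ((p−1)/2)·det[((j²+dk²)/p)]_{2≤j,k≤(p−1)/2}`. -/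
theorem stmt1 (p : ℕ) [Fact p.Prime] (hp : 3 < p) (d : ℤ)
    (hd : legendreSym p d = -1) :
    ((p : ℤ) - 1) *
      Matrix.det (Matrix.of fun j k : Fin ((p - 1) / 2) =>
        if (j : ℕ) = 0 then (1 : ℤ)
        else legendreSym p ((((j : ℕ) : ℤ) + 1) ^ 2 + d * (((k : ℕ) : ℤ) + 1) ^ 2)) =
      2 * Matrix.det (Matrix.of fun j k : Fin ((p + 1) / 2) =>
        (legendreSym p (((j : ℕ) : ℤ) ^ 2 + d * ((k : ℕ) : ℤ) ^ 2) : ℤ)) ∧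
    Matrix.det (Matrix.of fun j k : Fin ((p - 1) / 2) =>
        if (j : ℕ) = 0 then (1 : ℤ)
        else legendreSym p ((((j : ℕ) : ℤ) + 1) ^ 2 + d * (((k : ℕ) : ℤ) + 1) ^ 2)) =
      (((p - 1) / 2 : ℕ) : ℤ) *
        Matrix.det (Matrix.of fun j k : Fin ((p - 1) / 2 - 1) =>
          (legendreSym p ((((j : ℕ) : ℤ) + 2) ^ 2 + d * (((k : ℕ) : ℤ) + 2) ^ 2) : ℤ)) := by
  classical
  have hpp : p.Prime := Fact.out
  obtain ⟨m, hm⟩ : ∃ m, p = 2 * (m + 1) + 1 := by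
    obtain ⟨k, hk⟩ := hpp.odd_of_ne_two (by omega)
    exact ⟨k - 1, by omega⟩
  have e1 : (p - 1) / 2 = m + 1 := by omega
  have e2 : (p + 1) / 2 = m + 2 := by omega
  have hpm : (p : ℤ) - 1 = 2 * ((m : ℤ) + 1) := by rw [hm]; push_cast; ring
  rw [hpm, e1, e2]
  have hne : ∀ i : Fin (m + 1), ((i : ℕ) + 1 : ZMod p) ≠ 0 := by
    intro i
    have : ((i + 1 : ℕ) : ZMod p) ≠ 0 := by
      rw [Ne, ZMod.natCast_eq_zero_iff]
      intro h
      have := Nat.le_of_dvd (by omega) h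
      omega
    simpa using this
  have hd' : quadraticChar (ZMod p) (d : ZMod p) = -1 := hd
  have hrow : ∀ j : Fin (m + 1), ∑ k : Fin (m + 1),
      legendreSym p ((((j : ℕ) : ℤ) + 1) ^ 2 + d * (((k : ℕ) : ℤ) + 1) ^ 2) = 0 := by
    intro j
    have := aux_sum p (m + 1) hm (((j : ℕ) + 1 : ZMod p) ^ 2) d
      (by rw [map_mul, hd', quadraticChar_sq_one' (hne j)]; ring)
    rw [← this]
    refine Finset.sum_congr rfl (fun i _ => ?_)
    simp [legendreSym]
  have hcol : ∀ k : Fin (m + 1), ∑ j : Fin (m + 1),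
      legendreSym p ((((j : ℕ) : ℤ) + 1) ^ 2 + d * (((k : ℕ) : ℤ) + 1) ^ 2) = 0 := by
    intro k
    have := aux_sum p (m + 1) hm (d * ((k : ℕ) + 1 : ZMod p) ^ 2) 1
      (by rw [mul_one, map_mul, hd', quadraticChar_sq_one' (hne k)]; ring)
    rw [← this]
    refine Finset.sum_congr rfl (fun i _ => ?_)
    simp [legendreSym, add_comm]
  constructor
  · rw [aux_det2 m (Matrix.of fun j k : Fin (m + 1) =>
        legendreSym p ((((j : ℕ) : ℤ) + 1) ^ 2 + d * (((k : ℕ) : ℤ) + 1) ^ 2))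
      (Matrix.of fun j k : Fin (m + 2) =>
        (legendreSym p (((j : ℕ) : ℤ) ^ 2 + d * ((k : ℕ) : ℤ) ^ 2) : ℤ))
      (Matrix.of fun j k : Fin (m + 1) =>
        if (j : ℕ) = 0 then (1 : ℤ)
        else legendreSym p ((((j : ℕ) : ℤ) + 1) ^ 2 + d * (((k : ℕ) : ℤ) + 1) ^ 2))
      hcol (by simp) (by simp) (by simp [legendreSym]) ?_ ?_ (by simp)]
    · ring
    · intro k
      have h := quadraticChar_sq_one' (hne k)
      have h2 : quadraticChar (ZMod p) ((d : ZMod p) * ((k : ℕ) + 1 : ZMod p) ^ 2) = -1 := by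
        rw [map_mul, hd', h]; ring
      simpa [legendreSym, -map_pow, -map_mul] using h2
    · intro k
      have h := quadraticChar_sq_one' (hne k)
      simpa [legendreSym, -map_pow] using h
  · rw [aux_det1 m _ ?_ (by simp)]
    · push_cast
      congr 2
    · intro i
      simpa using hrow i.succ
end

section
/- Let p be an odd prime and let d be an integer with Legendre symbol (−d/p) = −1. Then the Legendre symbol (S_{p−2}(d,p)/p) equals (2/p), where S_{p−2}(d,p) = det[(j²+dk²)^{p−2}]_{1≤j,k≤(p−1)/2}. Moreover, in the field 𝔽_p of p elements, the determinant of the ((p−1)/2)×((p−1)/2) matrix whose (j,k) entry (1 ≤ j,k ≤ (p−1)/2) is the inverse (j²+dk²)^{−1} in 𝔽_p equals d^{(p−1)/4} if p ≡ 1 (mod 4), and equals (−1)^{(p+1)/4} if p ≡ 3 (mod 4). -/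
lemma half_sum (p : ℕ) [Fact p.Prime] (n : ℕ) (hp : p = 2 * n + 1) (e : ℕ) :
    2 * ∑ k ∈ Finset.range n, (((k + 1 : ℕ) : ZMod p) ^ 2) ^ e =
      if n ∣ e then -1 else 0 := by
  have h1 := FiniteField.sum_pow_units (ZMod p) (2 * e)
  have h2 : ∑ x : (ZMod p)ˣ, (x : ZMod p) ^ (2 * e) =
      ∑ k ∈ Finset.range (n + n), ((k + 1 : ℕ) : ZMod p) ^ (2 * e) := by
    refine Finset.sum_nbij (fun x => (x : ZMod p).val - 1) ?_ ?_ ?_ ?_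
    · intro x _
      have := ZMod.val_lt (x : ZMod p)
      have h0 : (x : ZMod p).val ≠ 0 := by simp
      simp only [Finset.mem_range]
      omega
    · intro x _ y _ hxy
      have h0 : (x : ZMod p).val ≠ 0 := by simp
      have h0' : (y : ZMod p).val ≠ 0 := by simp
      apply Units.ext
      apply ZMod.val_injective p
      simp only at hxy
      omega
    · intro k hk
      have hk' : k < n + n := by simpa using hk
      have hv : ((k + 1 : ℕ) : ZMod p).val = k + 1 := ZMod.val_natCast_of_lt (by omega)
      have hne : ((k + 1 : ℕ) : ZMod p) ≠ 0 := by
        intro h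
        rw [h] at hv
        simp at hv
      refine ⟨Units.mk0 _ hne, by simp, ?_⟩
      simp only [Units.val_mk0, hv]
      omega
    · intro x _
      have h0 : (x : ZMod p).val ≠ 0 := by simp
      rw [Nat.sub_add_cancel (by omega), ZMod.natCast_zmod_val]
  rw [h2, ZMod.card, Finset.sum_range_add] at h1
  have h3 : ∑ x ∈ Finset.range n, ((n + x + 1 : ℕ) : ZMod p) ^ (2 * e) =
      ∑ k ∈ Finset.range n, ((k + 1 : ℕ) : ZMod p) ^ (2 * e) := by
    rw [← Finset.sum_range_reflect]
    refine Finset.sum_congr rfl fun k hk => ?_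
    have hk' : k < n := by simpa using hk
    have : ((n + (n - 1 - k) + 1 : ℕ) : ZMod p) = - ((k + 1 : ℕ) : ZMod p) := by
      rw [eq_neg_iff_add_eq_zero, ← Nat.cast_add,
        show n + (n - 1 - k) + 1 + (k + 1) = p by omega, ZMod.natCast_self]
    rw [this, pow_mul, neg_sq, ← pow_mul]
  rw [h3, ← two_mul] at h1
  simp only [← pow_mul]
  rw [h1]
  have : p - 1 ∣ 2 * e ↔ n ∣ e := by
    rw [show p - 1 = 2 * n by omega]
    exact Nat.mul_dvd_mul_iff_left (by norm_num)
  simp only [this]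

lemma key (p : ℕ) [Fact p.Prime] (m : ℕ) (hp : p = 2 * (m + 1) + 1) (a : ZMod p)
    (ha : (-a) ^ (m + 1) = -1) :
    Matrix.det (Matrix.of fun j k : Fin (m + 1) =>
      ((((j : ℕ) + 1 : ℕ) : ZMod p) ^ 2 + a * (((k : ℕ) + 1 : ℕ) : ZMod p) ^ 2)⁻¹) =
    -(-a) ^ (∑ i ∈ Finset.range (m + 1), i) := by
  have h2 : (2 : ZMod p) ≠ 0 := by
    intro h
    have h' : ((2 : ℕ) : ZMod p) = 0 := by exact_mod_cast h
    rw [ZMod.natCast_eq_zero_iff] at h'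
    have := Nat.le_of_dvd (by norm_num) h'
    omega
  have hx : ∀ j : Fin (m + 1), ((((j : ℕ) + 1 : ℕ) : ZMod p) ^ 2) ^ (m + 1) = 1 := by
    intro j
    rw [← pow_mul, show 2 * (m + 1) = p - 1 by omega]
    apply ZMod.pow_card_sub_one_eq_one
    intro h
    rw [ZMod.natCast_eq_zero_iff] at h
    have := Nat.le_of_dvd (by omega) h
    omega
  let x : Fin (m + 1) → ZMod p := fun j => (((j : ℕ) + 1 : ℕ) : ZMod p) ^ 2
  let A : Matrix (Fin (m + 1)) (Fin (m + 1)) (ZMod p) := Matrix.of fun j i => x j ^ (m - i : ℕ)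
  let B : Matrix (Fin (m + 1)) (Fin (m + 1)) (ZMod p) :=
    Matrix.of fun i k => 2⁻¹ * (-a) ^ (i : ℕ) * x k ^ (i : ℕ)
  have hM : (Matrix.of fun j k : Fin (m + 1) =>
      ((((j : ℕ) + 1 : ℕ) : ZMod p) ^ 2 + a * (((k : ℕ) + 1 : ℕ) : ZMod p) ^ 2)⁻¹) = A * B := by
    ext j k
    change (x j + a * x k)⁻¹ = ∑ i : Fin (m + 1), x j ^ (m - i : ℕ) * (2⁻¹ * (-a) ^ (i : ℕ) * x k ^ (i : ℕ))
    have hg := geom_sum₂_mul (-a * x k) (x j) (m + 1)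
    rw [mul_pow, ha, show x j ^ (m + 1) = 1 from hx j, show x k ^ (m + 1) = 1 from hx k] at hg
    rw [Fin.sum_univ_eq_sum_range (fun i => x j ^ (m - i) * (2⁻¹ * (-a) ^ i * x k ^ i))]
    symm
    apply eq_inv_of_mul_eq_one_left
    have : ∑ i ∈ Finset.range (m + 1), x j ^ (m - i) * (2⁻¹ * (-a) ^ i * x k ^ i) =
        2⁻¹ * ∑ i ∈ Finset.range (m + 1), (-a * x k) ^ i * x j ^ (m + 1 - 1 - i) := by
      rw [Finset.mul_sum]
      refine Finset.sum_congr rfl fun i _ => ?_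
      rw [mul_pow, Nat.add_sub_cancel]
      ring
    rw [this, mul_assoc, inv_mul_eq_one₀ h2]
    linear_combination hg
  rw [hM, Matrix.det_mul_comm]
  have hperm := Matrix.det_permute (finRotate (m + 1)) (B * A)
  have hD : (B * A).submatrix (finRotate (m + 1)) id =
      Matrix.diagonal fun l => (2⁻¹ * 2⁻¹) * -1 * (-a) ^ (finRotate (m + 1) l : ℕ) := by
    ext i l
    set r := finRotate (m + 1) i with hr
    have hrv : (r : ℕ) = if i = Fin.last m then 0 else (i : ℕ) + 1 := coe_finRotate i
    have hs := half_sum p (m + 1) hp (r + (m - l))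
    have h1 : (B * A) r l = 2⁻¹ * 2⁻¹ * (-a) ^ (r : ℕ) *
        (2 * ∑ k ∈ Finset.range (m + 1), (((k + 1 : ℕ) : ZMod p) ^ 2) ^ ((r : ℕ) + (m - l))) := by
      rw [← Fin.sum_univ_eq_sum_range (fun k => (((k + 1 : ℕ) : ZMod p) ^ 2) ^ ((r : ℕ) + (m - l))),
        Matrix.mul_apply, Finset.mul_sum, Finset.mul_sum]
      refine Finset.sum_congr rfl fun k _ => ?_
      change 2⁻¹ * (-a) ^ (r : ℕ) * x k ^ (r : ℕ) * x k ^ (m - l : ℕ) =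
        2⁻¹ * 2⁻¹ * (-a) ^ (r : ℕ) * (2 * x k ^ ((r : ℕ) + (m - l)))
      rw [pow_add]
      field_simp
    rw [Matrix.submatrix_apply, id, ← hr, h1, hs, Matrix.diagonal_apply, ← hr]
    have hiff : (m + 1 ∣ (r : ℕ) + (m - l)) ↔ i = l := by
      have hi := i.2
      have hl := l.2
      have hlast : i = Fin.last m ↔ (i : ℕ) = m := by simp [Fin.ext_iff]
      rw [Fin.ext_iff]
      constructor
      · rintro ⟨c, hc⟩
        have hc2 : c < 2 := by
          by_contra h
          have : (m + 1) * 2 ≤ (m + 1) * c := Nat.mul_le_mul_left _ (by omega)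
          have := r.2
          omega
        split_ifs at hrv with h
        · rw [hlast] at h
          interval_cases c <;> omega
        · rw [hlast] at h
          interval_cases c <;> omega
      · intro h
        split_ifs at hrv with h'
        · rw [hlast] at h'
          exact ⟨0, by omega⟩
        · exact ⟨1, by omega⟩
    simp only [hiff]
    split_ifs <;> ring
  rw [hD, Matrix.det_diagonal, sign_finRotate,
    Equiv.prod_comp (finRotate (m + 1)) (fun l => (2⁻¹ * 2⁻¹) * -1 * (-a) ^ (l : ℕ)),
    Finset.prod_mul_distrib, Finset.prod_const, Finset.card_univ, Fintype.card_fin,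
    Finset.prod_pow_eq_pow_sum, Fin.sum_univ_eq_sum_range (fun i => i)] at hperm
  have h4 : ((2 : ZMod p)⁻¹ * 2⁻¹) ^ (m + 1) = 1 := by
    rw [← sq, ← pow_mul, show 2 * (m + 1) = p - 1 by omega]
    exact ZMod.pow_card_sub_one_eq_one (inv_ne_zero h2)
  rw [mul_pow, h4, one_mul, Nat.add_sub_cancel] at hperm
  have h5 : ((-1 : ZMod p) ^ m) * (-1) ^ m = 1 := by
    rw [← mul_pow]; simp
  push_cast at hperm
  rw [pow_succ] at hperm
  linear_combination (-(-1) ^ m) * hperm - ((B * A).det + (-a) ^ (∑ i ∈ Finset.range (m + 1), i)) * h5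

lemma key' (p : ℕ) [Fact p.Prime] (n : ℕ) (hn : n ≠ 0) (hp : p = 2 * n + 1) (a : ZMod p)
    (ha : (-a) ^ n = -1) :
    Matrix.det (Matrix.of fun j k : Fin n =>
      ((((j : ℕ) + 1 : ℕ) : ZMod p) ^ 2 + a * (((k : ℕ) + 1 : ℕ) : ZMod p) ^ 2)⁻¹) =
    -(-a) ^ (∑ i ∈ Finset.range n, i) := by
  obtain ⟨m, rfl⟩ := Nat.exists_eq_succ_of_ne_zero hn
  exact key p m hp a ha

/-- For an odd prime `p` and `d : ℤ` with `(−d/p) = −1`: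
`(S_{p−2}(d,p)/p) = (2/p)` where `S_{p−2}(d,p) = det[(j²+dk²)^{p−2}]_{1≤j,k≤(p−1)/2}`;
moreover, in `𝔽_p`, `det[(j²+dk²)⁻¹]_{1≤j,k≤(p−1)/2}` equals `d^{(p−1)/4}` if
`p ≡ 1 (mod 4)` and `(−1)^{(p+1)/4}` if `p ≡ 3 (mod 4)`. -/
theorem stmt3 (p : ℕ) [Fact p.Prime] (hp2 : p ≠ 2) (d : ℤ)
    (hd : legendreSym p (-d) = -1) :
    legendreSym p (Matrix.det (Matrix.of fun j k : Fin ((p - 1) / 2) =>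
        ((((j : ℕ) : ℤ) + 1) ^ 2 + d * (((k : ℕ) : ℤ) + 1) ^ 2) ^ (p - 2))) =
      legendreSym p 2 ∧
    (p % 4 = 1 →
      Matrix.det (Matrix.of fun j k : Fin ((p - 1) / 2) =>
        ((((j : ℕ) + 1 : ℕ) : ZMod p) ^ 2 + (d : ZMod p) * (((k : ℕ) + 1 : ℕ) : ZMod p) ^ 2)⁻¹) =
      (d : ZMod p) ^ ((p - 1) / 4)) ∧
    (p % 4 = 3 →
      Matrix.det (Matrix.of fun j k : Fin ((p - 1) / 2) =>
        ((((j : ℕ) + 1 : ℕ) : ZMod p) ^ 2 + (d : ZMod p) * (((k : ℕ) + 1 : ℕ) : ZMod p) ^ 2)⁻¹) =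
      (-1 : ZMod p) ^ ((p + 1) / 4)) := by
  have hpp : p.Prime := Fact.out
  have hodd : p % 2 = 1 := hpp.eq_two_or_odd.resolve_left hp2
  have hp3 : 3 ≤ p := by have := hpp.two_le; omega
  have hn0 : (p - 1) / 2 ≠ 0 := by omega
  have hpn : p = 2 * ((p - 1) / 2) + 1 := by omega
  have ha : (-(d : ZMod p)) ^ ((p - 1) / 2) = -1 := by
    have h := legendreSym.eq_pow p (-d)
    rw [hd, show p / 2 = (p - 1) / 2 by omega] at h
    push_cast at h
    exact h.symm
  have hk := key' p ((p - 1) / 2) hn0 hpn (d : ZMod p) ha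
  have hsum := Finset.sum_range_id_mul_two ((p - 1) / 2)
  have hA : p % 4 = 1 →
      Matrix.det (Matrix.of fun j k : Fin ((p - 1) / 2) =>
        ((((j : ℕ) + 1 : ℕ) : ZMod p) ^ 2 + (d : ZMod p) * (((k : ℕ) + 1 : ℕ) : ZMod p) ^ 2)⁻¹) =
      (d : ZMod p) ^ ((p - 1) / 4) := by
    intro h
    rw [hk]
    generalize (∑ i ∈ Finset.range ((p - 1) / 2), i) = s at hsum
    obtain ⟨t, ht⟩ : ∃ t, p = 4 * t + 1 := ⟨p / 4, by omega⟩
    have e1 : (p - 1) / 2 = 2 * t := by omega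
    have e2 : (p - 1) / 4 = t := by omega
    have ht0 : 0 < t := by omega
    rw [e1] at hsum ha
    rw [e2]
    have hs : s + t = 2 * t * t := by
      have : s = t * (2 * t - 1) := by
        have : s * 2 = (t * (2 * t - 1)) * 2 := by rw [hsum]; ring
        omega
      obtain ⟨u, rfl⟩ : ∃ u, t = u + 1 := ⟨t - 1, by omega⟩
      rw [this, show 2 * (u + 1) - 1 = 2 * u + 1 by omega]
      ring
    have h1 : (-(d : ZMod p)) ^ s * (-(d : ZMod p)) ^ t = (-1) ^ t := by
      rw [← pow_add, hs, pow_mul, ha]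
    have h2 : (-(d : ZMod p)) ^ t = (-1) ^ t * (d : ZMod p) ^ t := by rw [← mul_pow]; ring
    have h3 : ((-1 : ZMod p) ^ t) * (-1) ^ t = 1 := by rw [← mul_pow]; simp
    have h4 : (d : ZMod p) ^ t * (d : ZMod p) ^ t = -1 := by
      rw [← pow_add, ← two_mul, ← ha, pow_mul, pow_mul, neg_sq]
    rw [h2] at h1
    linear_combination (-1) ^ t * (d : ZMod p) ^ t * h1 -
      ((-(d : ZMod p)) ^ s * (d : ZMod p) ^ t * (d : ZMod p) ^ t - (d : ZMod p) ^ t) * h3 -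
      (-(d : ZMod p)) ^ s * h4
  have hB : p % 4 = 3 →
      Matrix.det (Matrix.of fun j k : Fin ((p - 1) / 2) =>
        ((((j : ℕ) + 1 : ℕ) : ZMod p) ^ 2 + (d : ZMod p) * (((k : ℕ) + 1 : ℕ) : ZMod p) ^ 2)⁻¹) =
      (-1 : ZMod p) ^ ((p + 1) / 4) := by
    intro h
    rw [hk]
    generalize (∑ i ∈ Finset.range ((p - 1) / 2), i) = s at hsum
    obtain ⟨t, ht⟩ : ∃ t, p = 4 * t + 3 := ⟨p / 4, by omega⟩
    have e1 : (p - 1) / 2 = 2 * t + 1 := by omega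
    have e2 : (p + 1) / 4 = t + 1 := by omega
    rw [e1] at hsum ha
    rw [e2]
    have hs : s = (2 * t + 1) * t := by
      have : s * 2 = ((2 * t + 1) * t) * 2 := by rw [hsum, Nat.add_sub_cancel]; ring
      omega
    rw [hs, pow_mul, ha, pow_succ]
    ring
  refine ⟨?_, hA, hB⟩
  have hcast : ((Matrix.det (Matrix.of fun j k : Fin ((p - 1) / 2) =>
        ((((j : ℕ) : ℤ) + 1) ^ 2 + d * (((k : ℕ) : ℤ) + 1) ^ 2) ^ (p - 2)) : ℤ) : ZMod p) =
      Matrix.det (Matrix.of fun j k : Fin ((p - 1) / 2) =>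
        ((((j : ℕ) + 1 : ℕ) : ZMod p) ^ 2 +
          (d : ZMod p) * (((k : ℕ) + 1 : ℕ) : ZMod p) ^ 2)⁻¹) := by
    rw [Int.cast_det]
    congr 1
    ext j k
    simp only [Matrix.map_apply, Matrix.of_apply]
    push_cast
    generalize (((j : ℕ) : ZMod p) + 1) ^ 2 + (d : ZMod p) * (((k : ℕ) : ZMod p) + 1) ^ 2 = z
    by_cases hz : z = 0
    · rw [hz, inv_zero, zero_pow (by omega)]
    · apply eq_inv_of_mul_eq_one_left
      rw [← pow_succ, show p - 2 + 1 = p - 1 by omega]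
      exact ZMod.pow_card_sub_one_eq_one hz
  rw [legendreSym.at_two hp2, ZMod.χ₈_nat_eq_if_mod_eight, if_neg (by omega), legendreSym, hcast]
  have hneg : legendreSym p (-d) = legendreSym p (-1) * legendreSym p d := by
    rw [← legendreSym.mul]; ring_nf
  rw [hd, legendreSym.at_neg_one hp2] at hneg
  rcases (show p % 4 = 1 ∨ p % 4 = 3 by omega) with h | h
  · rw [hA h, map_pow]
    rw [ZMod.χ₄_nat_one_mod_four h, one_mul, legendreSym] at hneg
    rw [← hneg]
    split_ifs with h8
    · exact Even.neg_one_pow (Nat.even_iff.2 (by omega))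
    · exact Odd.neg_one_pow (Nat.odd_iff.2 (by omega))
  · rw [hB h, map_pow]
    have h1 := legendreSym.at_neg_one hp2
    rw [ZMod.χ₄_nat_three_mod_four h, legendreSym] at h1
    push_cast at h1
    rw [h1]
    split_ifs with h8
    · exact Even.neg_one_pow (Nat.even_iff.2 (by omega))
    · exact Odd.neg_one_pow (Nat.odd_iff.2 (by omega))
end

section
/- Let p be an odd prime and let d be an integer with Legendre symbol (−d/p) = −1. Then the Legendre symbol (S_{p−3}(d,p)/p) equals (1−(−1/p))/2, where S_{p−3}(d,p) = det[(j²+dk²)^{p−3}]_{1≤j,k≤(p−1)/2}; that is, p divides S_{p−3}(d,p) when p ≡ 1 (mod 4), and S_{p−3}(d,p) is a nonzero quadratic residue modulo p when p ≡ 3 (mod 4). Moreover, when p ≡ 3 (mod 4), in the field 𝔽_p the determinant of the ((p−1)/2)×((p−1)/2) matrix whose (j,k) entry (1 ≤ j,k ≤ (p−1)/2) is (j²+dk²)^{−2} equals 4^{−1}·∏_{r=1}^{(p−3)/4}(r + 4^{−1})². -/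
namespace Stmt4Aux

theorem telescoping {F : Type*} [Field F] (z a : F) (N : ℕ) :
    (1 - z) ^ 2 * ∑ m ∈ Finset.range N, ((m : F) + a) * z ^ m =
      a + (1 - a) * z - (N + a) * z ^ N + (N - 1 + a) * z ^ (N + 1) := by
  induction N with
  | zero => simp; ring
  | succ N ih =>
    rw [Finset.sum_range_succ, mul_add, ih]
    push_cast
    ring

/-- diagonal coefficients -/
noncomputable def coe4 {F : Type*} [Field F] (d : F) (m : ℕ) : F :=
  ((-1) ^ m * (d⁻¹) ^ (m + 2)) * ((((m + 1 : ℕ) : F) + 4⁻¹) * 2⁻¹)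

theorem entry {F : Type*} [Field F] (n : ℕ) (h2n : (2 : F) * n = -1) (x d y : F)
    (hx : x ^ n = 1) (hy : y ^ n = 1) (hy0 : y ≠ 0) (hd0 : d ≠ 0) (hd : (-d) ^ n = -1) :
    x + d * y ≠ 0 ∧ ((x + d * y) ^ 2)⁻¹ =
      ∑ m ∈ Finset.range n, x ^ m * coe4 d m * (y⁻¹) ^ (m + 2) := by
  have h2 : (2 : F) ≠ 0 := by
    intro h; rw [h] at h2n; simp at h2n
  have h4 : (4 : F) ≠ 0 := by
    have : (4 : F) = 2 * 2 := by norm_num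
    rw [this]; exact mul_ne_zero h2 h2
  have hn : (n : F) = -2⁻¹ := by field_simp; linear_combination h2n
  have hz : (x / (-d * y)) ^ n = -1 := by
    rw [div_pow, mul_pow, hx, hy, hd]; simp
  have key := telescoping (x / (-d * y)) (1 + 4⁻¹) n
  rw [pow_succ _ n, hz, hn] at key
  set z := x / (-d * y) with hzdef
  have hxz : x = -(d * y * z) := by rw [hzdef]; field_simp
  have key2 : (1 - z) ^ 2 * ∑ m ∈ Finset.range n, ((m : F) + (1 + 4⁻¹)) * z ^ m = 2 := by
    rw [key]
    have : (2⁻¹ : F) = 2 * 4⁻¹ := by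
      field_simp; norm_num
    rw [this]
    ring
  have hz1 : 1 - z ≠ 0 := by
    intro h; rw [h] at key2; simp at key2; exact h2 key2.symm
  have hxy : x + d * y = d * y * (1 - z) := by rw [hxz]; ring
  refine ⟨by rw [hxy]; exact mul_ne_zero (mul_ne_zero hd0 hy0) hz1, ?_⟩
  have hsum : ∑ m ∈ Finset.range n, x ^ m * coe4 d m * (y⁻¹) ^ (m + 2) =
      (2⁻¹ * (d⁻¹ * y⁻¹) ^ 2) * ∑ m ∈ Finset.range n, ((m : F) + (1 + 4⁻¹)) * z ^ m := by
    rw [Finset.mul_sum]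
    refine Finset.sum_congr rfl fun m _ => ?_
    have hzx : z ^ m = x ^ m * ((-1) ^ m * (d⁻¹) ^ m * (y⁻¹) ^ m) := by
      rw [← mul_pow, ← mul_pow, ← mul_pow]
      congr 1
      rw [hzdef]; field_simp
    rw [hzx, coe4]; push_cast; ring
  rw [hsum, hxy]
  symm
  apply eq_inv_of_mul_eq_one_left
  have e : 2⁻¹ * (d⁻¹ * y⁻¹) ^ 2 * (∑ m ∈ Finset.range n, ((m : F) + (1 + 4⁻¹)) * z ^ m) *
      (d * y * (1 - z)) ^ 2 = 2⁻¹ * ((d⁻¹ * d) * (y⁻¹ * y)) ^ 2 *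
      ((1 - z) ^ 2 * (∑ m ∈ Finset.range n, ((m : F) + (1 + 4⁻¹)) * z ^ m)) := by ring
  rw [e, key2, inv_mul_cancel₀ hd0, inv_mul_cancel₀ hy0]
  simp [h2]

theorem det_formula {F : Type*} [Field F] (n : ℕ) (h2n : (2 : F) * n = -1) (d : F)
    (X : Fin n → F) (hX : ∀ j, X j ^ n = 1) (hX0 : ∀ j, X j ≠ 0)
    (hinj : Function.Injective X) (hd0 : d ≠ 0) (hd : (-d) ^ n = -1) :
    Matrix.det (Matrix.of fun j k : Fin n => ((X j + d * X k) ^ 2)⁻¹) =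
      (∏ m ∈ Finset.range n, coe4 d m) * ((n : F) ^ n * ((∏ k, X k)⁻¹) ^ 2) := by
  let A : Matrix (Fin n) (Fin n) F := Matrix.of fun j m => X j ^ (m : ℕ)
  let B : Matrix (Fin n) (Fin n) F := Matrix.of fun m k => (X k)⁻¹ ^ ((m : ℕ) + 2)
  have hM : (Matrix.of fun j k : Fin n => ((X j + d * X k) ^ 2)⁻¹) =
      A * Matrix.diagonal (fun m : Fin n => coe4 d m) * B := by
    ext j k
    rw [Matrix.mul_apply]
    simp only [Matrix.mul_diagonal, A, B, Matrix.of_apply]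
    rw [(entry n h2n (X j) d (X k) (hX j) (hX k) (hX0 k) hd0 hd).2, Finset.sum_range]
  have hAB : A * B = Matrix.diagonal (fun k => (n : F) * (X k)⁻¹ ^ 2) := by
    ext j k
    rw [Matrix.mul_apply]
    simp only [A, B, Matrix.of_apply]
    have : ∀ m : Fin n, X j ^ (m : ℕ) * (X k)⁻¹ ^ ((m : ℕ) + 2) =
        (X k)⁻¹ ^ 2 * (X j / X k) ^ (m : ℕ) := by
      intro m; rw [div_eq_mul_inv, mul_pow]; ring
    simp only [this]
    rw [← Finset.mul_sum, ← Finset.sum_range (fun m => (X j / X k) ^ m)]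
    by_cases hjk : j = k
    · subst hjk
      simp [div_self (hX0 j), mul_comm]
    · rw [Matrix.diagonal_apply_ne _ hjk]
      have h1 : X j / X k ≠ 1 := by
        intro h
        exact hjk (hinj ((div_eq_one_iff_eq (hX0 k)).1 h))
      rw [geom_sum_eq h1, div_pow, hX, hX]; simp
  have hdet : A.det * B.det = (n : F) ^ n * ((∏ k, X k)⁻¹) ^ 2 := by
    rw [← Matrix.det_mul, hAB, Matrix.det_diagonal, Finset.prod_mul_distrib]
    simp [Finset.prod_pow, Finset.prod_inv_distrib]
  rw [hM, Matrix.det_mul, Matrix.det_mul, Matrix.det_diagonal, ← hdet,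
    Finset.prod_range (fun m => coe4 d m)]
  ring

theorem prod_neg_one {F : Type*} [Field F] (s : ℕ) :
    ∏ m ∈ Finset.range (2 * s + 1), (-1 : F) ^ m = (-1) ^ s := by
  induction s with
  | zero => simp
  | succ s ih =>
    rw [show 2 * (s + 1) + 1 = (2 * s + 1) + 1 + 1 by ring, Finset.prod_range_succ,
      Finset.prod_range_succ, ih, pow_succ (-1 : F) (2 * s + 1), pow_succ (-1 : F) (2 * s)]
    simp [pow_succ, pow_mul]

theorem prod_d {F : Type*} [Field F] (d : F) (s : ℕ) :
    ∏ m ∈ Finset.range (2 * s + 1), d ^ (m + 2) = (d ^ (2 * s + 1)) ^ (s + 2) := by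
  have : ∑ m ∈ Finset.range (2 * s + 1), (m + 2) = (2 * s + 1) * (s + 2) := by
    induction s with
    | zero => simp
    | succ s ih =>
      rw [show 2 * (s + 1) + 1 = (2 * s + 1) + 1 + 1 by ring, Finset.sum_range_succ,
        Finset.sum_range_succ, ih]
      ring
  rw [Finset.prod_pow_eq_pow_sum, this, pow_mul]

theorem prod_pair {F : Type*} [Field F] (s : ℕ) (h4 : (4 : F) ≠ 0)
    (h : (2 : F) * (2 * s + 1 : ℕ) = -1) :
    ∏ m ∈ Finset.range (2 * s + 1), (((m + 1 : ℕ) : F) + 4⁻¹) =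
      -4⁻¹ * ((-1) ^ s * ∏ r ∈ Finset.Icc 1 s, ((r : F) + 4⁻¹) ^ 2) := by
  have h44 : (4 : F) * 4⁻¹ = 1 := mul_inv_cancel₀ h4
  have h2 : (2 : F) ≠ 0 := by
    intro h'; rw [h'] at h; simp at h
  have hs : (2 * (s : F) + 1) + 2 * 4⁻¹ = 0 := by
    apply mul_left_cancel₀ h2
    push_cast at h
    linear_combination h + h44
  have hI : ∏ r ∈ Finset.Icc 1 s, ((r : F) + 4⁻¹) ^ 2 =
      ∏ i ∈ Finset.range s, (((i + 1 : ℕ) : F) + 4⁻¹) ^ 2 := by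
    rw [Finset.range_eq_Ico, Finset.prod_Ico_add' (fun r : ℕ => ((r : F) + 4⁻¹) ^ 2) 0 s 1]
    rfl
  rw [Finset.prod_range_succ, two_mul, Finset.prod_range_add,
    ← Finset.prod_range_reflect (fun i => (((s + i + 1 : ℕ) : F) + 4⁻¹)), hI]
  have : ∏ j ∈ Finset.range s, (((s + (s - 1 - j) + 1 : ℕ) : F) + 4⁻¹) =
      ∏ j ∈ Finset.range s, ((-1) * (((j + 1 : ℕ) : F) + 4⁻¹)) := by
    refine Finset.prod_congr rfl fun j hj => ?_
    rw [Finset.mem_range] at hj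
    have e : (((s + (s - 1 - j) + 1 : ℕ) : F)) = 2 * s - j := by
      rw [eq_sub_iff_add_eq]; norm_cast; congr 1; omega
    rw [e]; push_cast; linear_combination hs
  rw [this, Finset.prod_mul_distrib, Finset.prod_pow]
  simp only [Finset.prod_const, Finset.card_range]
  have e2 : (((s + s + 1 : ℕ) : F) + 4⁻¹) = -4⁻¹ := by
    push_cast; linear_combination hs
  rw [e2]; ring

theorem half_fact (p : ℕ) [Fact p.Prime] (n : ℕ) (hn : p = 2 * n + 1) :
    ((∏ i ∈ Finset.range n, ((i + 1 : ℕ) : ZMod p)) ^ 2) ^ 2 = 1 := by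
  have hw := ZMod.wilsons_lemma p
  have hp0 : ((2 * n + 1 : ℕ) : ZMod p) = 0 := by rw [← hn]; simp
  rw [show p - 1 = n + n by omega, ← Finset.prod_range_add_one_eq_factorial, Nat.cast_prod,
    Finset.prod_range_add,
    ← Finset.prod_range_reflect (fun i => (((n + i + 1 : ℕ) : ZMod p)))] at hw
  have : ∏ j ∈ Finset.range n, (((n + (n - 1 - j) + 1 : ℕ) : ZMod p)) =
      ∏ j ∈ Finset.range n, ((-1) * (((j + 1 : ℕ) : ZMod p))) := by
    refine Finset.prod_congr rfl fun j hj => ?_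
    rw [Finset.mem_range] at hj
    have e : (((n + (n - 1 - j) + 1 : ℕ) : ZMod p)) = 2 * n - j := by
      rw [eq_sub_iff_add_eq]; norm_cast; congr 1; omega
    push_cast at hp0
    rw [e]; push_cast; linear_combination hp0
  rw [this, Finset.prod_mul_distrib] at hw
  simp only [Finset.prod_const, Finset.card_range] at hw
  have h1 : ((-1 : ZMod p) ^ n) ^ 2 = 1 := by rw [← pow_mul, mul_comm, pow_mul]; simp
  set P := ∏ i ∈ Finset.range n, ((i + 1 : ℕ) : ZMod p)
  have hw2 : (P * ((-1) ^ n * P)) ^ 2 = 1 := by rw [hw]; simp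
  calc (P ^ 2) ^ 2 = ((-1 : ZMod p) ^ n) ^ 2 * (P ^ 2) ^ 2 := by rw [h1, one_mul]
    _ = (P * ((-1) ^ n * P)) ^ 2 := by ring
    _ = 1 := hw2

theorem setup (p : ℕ) [Fact p.Prime] (d : ℤ) (n : ℕ) (hn : p = 2 * n + 1)
    (hd : legendreSym p (-d) = -1) :
    (d : ZMod p) ≠ 0 ∧ (-(d : ZMod p)) ^ n = -1 := by
  have hd' := legendreSym.eq_pow p (-d)
  rw [hd, show p / 2 = n by omega] at hd'
  push_cast at hd'
  refine ⟨?_, hd'.symm⟩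
  intro h
  have : legendreSym p (-d) = 0 := by
    rw [legendreSym.eq_zero_iff]; push_cast; rw [h, neg_zero]
  omega

theorem main (p : ℕ) [Fact p.Prime] (d : ℤ) (n : ℕ) (hn : p = 2 * n + 1)
    (hd : legendreSym p (-d) = -1) :
    (∀ j k : Fin n, (((((j : ℕ) + 1 : ℕ) : ZMod p) ^ 2
          + (d : ZMod p) * (((k : ℕ) + 1 : ℕ) : ZMod p) ^ 2)) ≠ 0) ∧
    Matrix.det (Matrix.of fun j k : Fin n =>
        (((((j : ℕ) + 1 : ℕ) : ZMod p) ^ 2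
          + (d : ZMod p) * (((k : ℕ) + 1 : ℕ) : ZMod p) ^ 2) ^ 2)⁻¹) =
      (∏ m ∈ Finset.range n, coe4 (d : ZMod p) m) * (n : ZMod p) ^ n ∧
    (2 : ZMod p) * n = -1 := by
  obtain ⟨hd0, hdn⟩ := setup p d n hn hd
  have h2n : (2 : ZMod p) * n = -1 := by
    have : ((2 * n + 1 : ℕ) : ZMod p) = 0 := by rw [← hn]; simp
    push_cast at this
    linear_combination this
  have hne : ∀ m : ℕ, 0 < m → m < p → (m : ZMod p) ≠ 0 := by
    intro m h0 h1 h
    rw [ZMod.natCast_eq_zero_iff] at h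
    exact absurd (Nat.le_of_dvd h0 h) (by omega)
  have hj0 : ∀ j : Fin n, ((((j : ℕ) + 1 : ℕ) : ZMod p)) ≠ 0 := fun j =>
    hne _ (by omega) (by have := j.2; omega)
  let X : Fin n → ZMod p := fun j => (((j : ℕ) + 1 : ℕ) : ZMod p) ^ 2
  have hX0 : ∀ j, X j ≠ 0 := fun j => pow_ne_zero _ (hj0 j)
  have hX : ∀ j, X j ^ n = 1 := by
    intro j
    simp only [X]
    rw [← pow_mul, show 2 * n = p - 1 by omega]
    exact ZMod.pow_card_sub_one_eq_one (hj0 j)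
  have hinj : Function.Injective X := by
    intro j k h
    simp only [X] at h
    have hj := j.2
    have hk := k.2
    rcases sq_eq_sq_iff_eq_or_eq_neg.1 h with h | h
    · rw [ZMod.natCast_eq_natCast_iff'] at h
      rw [Nat.mod_eq_of_lt (by omega), Nat.mod_eq_of_lt (by omega)] at h
      ext; omega
    · exfalso
      apply hne (((j : ℕ) + 1) + ((k : ℕ) + 1)) (by omega) (by omega)
      rw [Nat.cast_add, h]; ring
  refine ⟨fun j k => (entry n h2n (X j) d (X k) (hX j) (hX k) (hX0 k) hd0 hdn).1, ?_, h2n⟩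
  rw [det_formula n h2n (d : ZMod p) X hX hX0 hinj hd0 hdn]
  have hP : (∏ k, X k) ^ 2 = 1 := by
    simp only [X]
    rw [Finset.prod_pow, ← Finset.prod_range (fun k => ((k + 1 : ℕ) : ZMod p))]
    exact half_fact p n hn
  rw [inv_pow, hP]; simp

theorem four_ne {F : Type*} [Field F] (n : ℕ) (h2n : (2 : F) * n = -1) : (4 : F) ≠ 0 := by
  have h2 : (2 : F) ≠ 0 := by
    intro h; rw [h] at h2n; simp at h2n
  have : (4 : F) = 2 * 2 := by norm_num
  rw [this]; exact mul_ne_zero h2 h2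

theorem prod_three (p : ℕ) [Fact p.Prime] (d : ℤ) (s : ℕ) (hs : p = 2 * (2 * s + 1) + 1)
    (hd : legendreSym p (-d) = -1) (h2n : (2 : ZMod p) * (2 * s + 1 : ℕ) = -1) :
    (∏ m ∈ Finset.range (2 * s + 1), coe4 (d : ZMod p) m) *
      ((2 * s + 1 : ℕ) : ZMod p) ^ (2 * s + 1) =
      (4 : ZMod p)⁻¹ * ∏ r ∈ Finset.Icc 1 s, ((r : ZMod p) + (4 : ZMod p)⁻¹) ^ 2 := by
  obtain ⟨hd0, hdn⟩ := setup p d (2 * s + 1) hs hd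
  have h4 := four_ne _ h2n
  have h2 : (2 : ZMod p) ≠ 0 := by
    intro h; rw [h] at h2n; simp at h2n
  have hd1 : (d : ZMod p) ^ (2 * s + 1) = 1 := by
    rw [Odd.neg_pow ⟨s, rfl⟩] at hdn
    exact neg_injective hdn
  simp only [coe4]
  rw [Finset.prod_mul_distrib, Finset.prod_mul_distrib, Finset.prod_mul_distrib, prod_neg_one,
    prod_d, prod_pair s h4 h2n, inv_pow, hd1]
  simp only [Finset.prod_const, Finset.card_range]
  have hc : (2 : ZMod p)⁻¹ ^ (2 * s + 1) * ((2 * s + 1 : ℕ) : ZMod p) ^ (2 * s + 1) = -1 := by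
    have e : (2 : ZMod p)⁻¹ * ((2 * s + 1 : ℕ) : ZMod p) = -(2⁻¹ ^ 2) := by
      rw [show ((2 * s + 1 : ℕ) : ZMod p) = -2⁻¹ by
        apply mul_left_cancel₀ h2; rw [h2n]; simp [h2]]
      ring
    rw [← mul_pow, e, Odd.neg_pow ⟨s, rfl⟩, ← pow_mul,
      show 2 * (2 * s + 1) = p - 1 by omega, ZMod.pow_card_sub_one_eq_one (inv_ne_zero h2)]
  have h1 : ((-1 : ZMod p) ^ s) ^ 2 = 1 := by rw [← pow_mul, mul_comm, pow_mul]; simp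
  set Q := ∏ r ∈ Finset.Icc 1 s, ((r : ZMod p) + (4 : ZMod p)⁻¹) ^ 2
  calc _ = (-4⁻¹ * Q) * ((-1 : ZMod p) ^ s) ^ 2 * ((2 : ZMod p)⁻¹ ^ (2 * s + 1) *
        ((2 * s + 1 : ℕ) : ZMod p) ^ (2 * s + 1)) := by simp only [inv_one, one_pow]; ring
    _ = _ := by rw [h1, hc]; ring

theorem final (p : ℕ) [Fact p.Prime] (d : ℤ) (n : ℕ) (hn : p = 2 * n + 1)
    (hd : legendreSym p (-d) = -1) :
    legendreSym p (Matrix.det (Matrix.of fun j k : Fin n =>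
        ((((j : ℕ) : ℤ) + 1) ^ 2 + d * (((k : ℕ) : ℤ) + 1) ^ 2) ^ (p - 3))) =
      (1 - legendreSym p (-1)) / 2 ∧
    (p % 4 = 3 →
      Matrix.det (Matrix.of fun j k : Fin n =>
        (((((j : ℕ) + 1 : ℕ) : ZMod p) ^ 2
          + (d : ZMod p) * (((k : ℕ) + 1 : ℕ) : ZMod p) ^ 2) ^ 2)⁻¹) =
      (4 : ZMod p)⁻¹ *
        ∏ r ∈ Finset.Icc 1 ((p - 3) / 4), ((r : ZMod p) + (4 : ZMod p)⁻¹) ^ 2) := by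
  obtain ⟨hne, hdet, h2n⟩ := main p d n hn hd
  have hprime : p.Prime := Fact.out
  have hp2 : p ≠ 2 := by omega
  have hp3 : 3 ≤ p := by have := hprime.two_le; omega
  have h4 := four_ne _ h2n
  have hcast : ((Matrix.det (Matrix.of fun j k : Fin n =>
        ((((j : ℕ) : ℤ) + 1) ^ 2 + d * (((k : ℕ) : ℤ) + 1) ^ 2) ^ (p - 3)) : ℤ) : ZMod p) =
      Matrix.det (Matrix.of fun j k : Fin n =>
        (((((j : ℕ) + 1 : ℕ) : ZMod p) ^ 2
          + (d : ZMod p) * (((k : ℕ) + 1 : ℕ) : ZMod p) ^ 2) ^ 2)⁻¹) := by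
    rw [Int.cast_det]
    congr 1
    ext j k
    have h0 := hne j k
    simp only [Matrix.map_apply, Matrix.of_apply]
    apply eq_inv_of_mul_eq_one_left
    have hf := ZMod.pow_card_sub_one_eq_one h0
    rw [show p - 1 = (p - 3) + 2 by omega, pow_add] at hf
    push_cast at hf ⊢
    exact hf
  have hthree : p % 4 = 3 → Matrix.det (Matrix.of fun j k : Fin n =>
        (((((j : ℕ) + 1 : ℕ) : ZMod p) ^ 2
          + (d : ZMod p) * (((k : ℕ) + 1 : ℕ) : ZMod p) ^ 2) ^ 2)⁻¹) =
      (4 : ZMod p)⁻¹ *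
        ∏ r ∈ Finset.Icc 1 ((p - 3) / 4), ((r : ZMod p) + (4 : ZMod p)⁻¹) ^ 2 := by
    intro h3
    rw [hdet]
    obtain ⟨s, rfl⟩ : ∃ s, n = 2 * s + 1 := ⟨n / 2, by omega⟩
    rw [show (p - 3) / 4 = s by omega]
    exact prod_three p d s hn hd h2n
  refine ⟨?_, hthree⟩
  rw [legendreSym.at_neg_one hp2]
  have hmod : p % 4 = 1 ∨ p % 4 = 3 := by omega
  have h44 : (4 : ZMod p) * 4⁻¹ = 1 := mul_inv_cancel₀ h4
  rcases hmod with h1 | h3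
  · rw [ZMod.χ₄_nat_one_mod_four h1]
    norm_num
    rw [legendreSym.eq_zero_iff, hcast, hdet]
    apply mul_eq_zero_of_left
    apply Finset.prod_eq_zero (i := (p - 5) / 4) (Finset.mem_range.2 (by omega))
    have : ((((p - 5) / 4 + 1 : ℕ) : ZMod p) + 4⁻¹) = 0 := by
      apply mul_left_cancel₀ h4
      rw [mul_add, h44, mul_zero]
      norm_cast
      have hp5 : 4 * ((p - 5) / 4 + 1) + 1 = p := by omega
      rw [hp5]; simp
    rw [coe4, this]; simp
  · rw [ZMod.χ₄_nat_three_mod_four h3]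
    norm_num
    set D := Matrix.det (Matrix.of fun j k : Fin n =>
        ((((j : ℕ) : ℤ) + 1) ^ 2 + d * (((k : ℕ) : ℤ) + 1) ^ 2) ^ (p - 3)) with hD
    have hval := hcast.trans (hthree h3)
    have hnz : (D : ZMod p) ≠ 0 := by
      rw [hval]
      refine mul_ne_zero (inv_ne_zero h4) (Finset.prod_ne_zero_iff.2 fun r hr => ?_)
      rw [Finset.mem_Icc] at hr
      apply pow_ne_zero
      intro h
      have h' : ((4 * r + 1 : ℕ) : ZMod p) = 0 := by
        push_cast; linear_combination 4 * h - h44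
      rw [ZMod.natCast_eq_zero_iff] at h'
      have := Nat.le_of_dvd (by omega) h'
      omega
    rw [legendreSym.eq_one_iff p hnz, hval]
    refine IsSquare.mul ⟨2⁻¹, ?_⟩ ?_
    · rw [← mul_inv]; norm_num
    · rw [Finset.prod_pow]; exact IsSquare.sq _

end Stmt4Aux

/-- For an odd prime `p` and `d : ℤ` with `(−d/p) = −1`:
`(S_{p−3}(d,p)/p) = (1−(−1/p))/2` where `S_{p−3}(d,p) = det[(j²+dk²)^{p−3}]_{1≤j,k≤(p−1)/2}`;
moreover, when `p ≡ 3 (mod 4)`, in `𝔽_p` the determinant of the matrix with entries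
`(j²+dk²)^{−2}` equals `4⁻¹·∏_{r=1}^{(p−3)/4}(r + 4⁻¹)²`. -/
theorem stmt4 (p : ℕ) [Fact p.Prime] (hp2 : p ≠ 2) (d : ℤ)
    (hd : legendreSym p (-d) = -1) :
    legendreSym p (Matrix.det (Matrix.of fun j k : Fin ((p - 1) / 2) =>
        ((((j : ℕ) : ℤ) + 1) ^ 2 + d * (((k : ℕ) : ℤ) + 1) ^ 2) ^ (p - 3))) =
      (1 - legendreSym p (-1)) / 2 ∧
    (p % 4 = 3 →
      Matrix.det (Matrix.of fun j k : Fin ((p - 1) / 2) =>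
        (((((j : ℕ) + 1 : ℕ) : ZMod p) ^ 2
          + (d : ZMod p) * (((k : ℕ) + 1 : ℕ) : ZMod p) ^ 2) ^ 2)⁻¹) =
      (4 : ZMod p)⁻¹ * ∏ r ∈ Finset.Icc 1 ((p - 3) / 4), ((r : ZMod p) + (4 : ZMod p)⁻¹) ^ 2) := by
  have hprime : p.Prime := Fact.out
  have hodd := hprime.eq_two_or_odd.resolve_left hp2
  exact Stmt4Aux.final p d ((p - 1) / 2) (by omega) hd
end

section
/- Let p be an odd prime and let k, m be positive integers with km = p−1. For integers s, t not divisible by p, say s ~ t if s·t^{−1} mod p is an m-th power residue modulo p (i.e., s ≡ t·x^m (mod p) for some integer x not divisible by p). Let P = ∏ (t − s), the product taken over all pairs of integers 1 ≤ s < t ≤ p−1 with s ~ t. Then: if p ≡ 1 (mod 2m), P ≡ (−1)^{((p+1)/2)·((p−1)/(2m)) + ⌊(p−3)/4⌋} · ((p−1)/2)! (mod p); and if p ≡ 1+m (mod 2m), P ≡ (−1)^{((p+1)/2)·((p−1−m)/(2m))} (mod p). -/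
open Finset in
theorem fiber_card (p : ℕ) [Fact p.Prime] (Q : ZMod p → Prop) [DecidablePred Q]
    (hQi : ∀ a, Q a → Q a⁻¹) (hQ1 : Q 1) (hQ0 : ∀ a, Q a → a ≠ 0) (d : ℕ) (hd : 1 ≤ d)
    (hd2 : 2 * d < p) :
    #{x ∈ (Icc 1 (p - 1)) ×ˢ (Icc 1 (p - 1)) | (x.1 < x.2 ∧ Q ((x.1 : ZMod p) / x.2)) ∧
      (x.1 + d = x.2 ∨ x.1 + (p - d) = x.2)} = #{h : ZMod p | Q h} - 1 := by
  have hne : ∀ s : ℕ, 1 ≤ s → s < p → (s : ZMod p) ≠ 0 := by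
    intro s h1 h2 h
    rw [ZMod.natCast_eq_zero_iff] at h
    exact absurd (Nat.le_of_dvd (by omega) h) (by omega)
  have hval : ∀ a : ZMod p, a ≠ 0 → 1 ≤ a.val := by
    intro a ha
    have := (ZMod.val_ne_zero a).2 ha
    omega
  have hdz : (d : ZMod p) ≠ 0 := hne d hd (by omega)
  have key : ∀ a b : ZMod p, b - a = d → b.val = a.val + d ∨ b.val + (p - d) = a.val := by
    intro a b hab
    have hb : b = a + (d : ℕ) := by rw [← hab]; ring
    have h1 : b.val = (a.val + d) % p := by
      rw [hb, ZMod.val_add, ZMod.val_natCast, Nat.mod_eq_of_lt (show d < p by omega)]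
    have h2 := ZMod.val_lt a
    by_cases h : a.val + d < p
    · rw [Nat.mod_eq_of_lt h] at h1; exact Or.inl h1
    · rw [Nat.mod_eq_sub_mod (by omega), Nat.mod_eq_of_lt (by omega)] at h1
      right; omega
  rw [← card_erase_of_mem (show (1 : ZMod p) ∈ ({h : ZMod p | Q h} : Finset _) by simpa using hQ1)]
  refine card_bij' (fun x _ => if x.1 + d = x.2 then (x.2 : ZMod p) / x.1 else (x.1 : ZMod p) / x.2)
    (fun h _ => (min ((d : ZMod p) / (h - 1)).val (h * ((d : ZMod p) / (h - 1))).val,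
      max ((d : ZMod p) / (h - 1)).val (h * ((d : ZMod p) / (h - 1))).val)) ?_ ?_ ?_ ?_
  · rintro ⟨s, t⟩ hx
    simp only [mem_filter, mem_product, mem_Icc] at hx
    obtain ⟨⟨⟨hs1, hs2⟩, ht1, ht2⟩, ⟨hlt, hq⟩, hst⟩ := hx
    have hs := hne s hs1 (by omega)
    have ht := hne t ht1 (by omega)
    have hstne : (s : ZMod p) ≠ t := by
      intro h
      rw [ZMod.natCast_eq_natCast_iff'] at h
      rw [Nat.mod_eq_of_lt (by omega), Nat.mod_eq_of_lt (by omega)] at h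
      omega
    simp only [mem_erase, mem_filter, mem_univ, true_and]
    split_ifs
    · refine ⟨fun h => hstne ?_, ?_⟩
      · rw [div_eq_one_iff_eq hs] at h; exact h.symm
      · have := hQi _ hq; rwa [inv_div] at this
    · refine ⟨fun h => hstne ?_, hq⟩
      rwa [div_eq_one_iff_eq ht] at h
  · intro h hh
    simp only [mem_erase, mem_filter, mem_univ, true_and] at hh
    obtain ⟨h1, hq⟩ := hh
    have h1' : h - 1 ≠ 0 := sub_ne_zero.2 h1
    set a := (d : ZMod p) / (h - 1) with ha
    have ha0 : a ≠ 0 := div_ne_zero hdz h1'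
    have hh0 := hQ0 _ hq
    have hb0 : h * a ≠ 0 := mul_ne_zero hh0 ha0
    have hab : h * a - a = d := by rw [ha]; field_simp
    have k1 := hval _ ha0
    have k2 := hval _ hb0
    have k3 := ZMod.val_lt a
    have k4 := ZMod.val_lt (h * a)
    simp only [mem_filter, mem_product, mem_Icc]
    rcases key _ _ hab with hk | hk
    · rw [min_eq_left (by omega), max_eq_right (by omega)]
      refine ⟨by omega, ⟨by omega, ?_⟩, by omega⟩
      rw [ZMod.natCast_zmod_val, ZMod.natCast_zmod_val]
      have := hQi _ hq
      convert this using 1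
      field_simp
    · rw [min_eq_right (by omega), max_eq_left (by omega)]
      refine ⟨by omega, ⟨by omega, ?_⟩, by omega⟩
      rw [ZMod.natCast_zmod_val, ZMod.natCast_zmod_val]
      convert hq using 1
      field_simp
  · rintro ⟨s, t⟩ hx
    simp only [mem_filter, mem_product, mem_Icc] at hx
    obtain ⟨⟨⟨hs1, hs2⟩, ht1, ht2⟩, ⟨hlt, hq⟩, hst⟩ := hx
    have hs := hne s hs1 (by omega)
    have ht := hne t ht1 (by omega)
    have vs : (s : ZMod p).val = s := ZMod.val_natCast_of_lt (by omega)
    have vt : (t : ZMod p).val = t := ZMod.val_natCast_of_lt (by omega)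
    simp only
    split_ifs with hc
    · have e1 : (d : ZMod p) / ((t : ZMod p) / s - 1) = s := by
        have : (t : ZMod p) = s + d := by rw [← hc]; push_cast; ring
        rw [this, add_div, div_self hs, add_sub_cancel_left]
        field_simp
      rw [e1, div_mul_cancel₀ _ hs, vs, vt, min_eq_left hlt.le, max_eq_right hlt.le]
    · have hc' : s + (p - d) = t := by tauto
      have e1 : (d : ZMod p) / ((s : ZMod p) / t - 1) = t := by
        have : (s : ZMod p) = t + d := by
          have h3 : s + p = t + d := by omega
          have := congrArg (Nat.cast : ℕ → ZMod p) h3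
          push_cast at this
          simpa using this
        rw [this, add_div, div_self ht, add_sub_cancel_left]
        field_simp
      rw [e1, div_mul_cancel₀ _ ht, vs, vt, min_eq_right hlt.le, max_eq_left hlt.le]
  · intro h hh
    simp only [mem_erase, mem_filter, mem_univ, true_and] at hh
    obtain ⟨h1, hq⟩ := hh
    have h1' : h - 1 ≠ 0 := sub_ne_zero.2 h1
    simp only
    set a := (d : ZMod p) / (h - 1) with ha
    have ha0 : a ≠ 0 := div_ne_zero hdz h1'
    have hab : h * a - a = d := by rw [ha]; field_simp
    rcases key _ _ hab with hk | hk
    · rw [min_eq_left (by omega), max_eq_right (by omega), if_pos (by omega),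
        ZMod.natCast_zmod_val, ZMod.natCast_zmod_val]
      field_simp
    · rw [min_eq_right (by omega), max_eq_left (by omega), if_neg (by omega),
        ZMod.natCast_zmod_val, ZMod.natCast_zmod_val]
      field_simp

open Finset in
theorem half_fact_sq (p : ℕ) [Fact p.Prime] (n : ℕ) (hn : p = 2 * n + 1) :
    ((n.factorial : ℕ) : ZMod p) ^ 2 = (-1) ^ (n + 1) := by
  have h := ZMod.prod_Ico_one_prime p
  rw [← prod_Ico_consecutive _ (show 1 ≤ n + 1 by omega) (show n + 1 ≤ p by omega)] at h
  have h2 : ∏ x ∈ Ico (n + 1) p, (x : ZMod p) = ∏ x ∈ Ico 1 (n + 1), (-1) * (x : ZMod p) := by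
    refine prod_bij' (fun x _ => p - x) (fun x _ => p - x) ?_ ?_ ?_ ?_ ?_
    · intro x hx; simp only [mem_Ico] at *; omega
    · intro x hx; simp only [mem_Ico] at *; omega
    · intro x hx; simp only [mem_Ico] at *; omega
    · intro x hx; simp only [mem_Ico] at *; omega
    · intro x hx
      simp only [mem_Ico] at hx
      rw [Nat.cast_sub (by omega)]; simp
  rw [h2, prod_mul_distrib, prod_const, ← Nat.cast_prod, prod_Ico_id_eq_factorial] at h
  simp only [Nat.card_Ico, Nat.add_sub_cancel] at h
  have h3 : ((-1 : ZMod p) ^ n) * (-1) ^ n = 1 := by rw [← mul_pow]; simp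
  calc ((n.factorial : ℕ) : ZMod p) ^ 2
      = ((-1) ^ n * (-1) ^ n) * ((n.factorial : ℕ) : ZMod p) ^ 2 := by rw [h3, one_mul]
    _ = (-1) ^ n * ((n.factorial : ZMod p) * ((-1) ^ n * (n.factorial : ZMod p))) := by ring
    _ = _ := by rw [h, pow_succ]

open Finset in
theorem card_Q (p k m : ℕ) [Fact p.Prime] (hkm : k * m = p - 1) (hk : 0 < k) (hm : 0 < m)
    [DecidablePred fun h : ZMod p => ∃ x, x ≠ 0 ∧ h = x ^ m] :
    #{h : ZMod p | ∃ x, x ≠ 0 ∧ h = x ^ m} = k := by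
  have hc := IsCyclic.card_powMonoidHom_range (G := (ZMod p)ˣ) m
  have hu : Nat.card (ZMod p)ˣ = k * m := by
    rw [Nat.card_eq_fintype_card, ZMod.card_units p, hkm]
  rw [hu, Nat.gcd_eq_right (Dvd.intro_left _ rfl), Nat.mul_div_cancel _ hm] at hc
  have h2 : (Set.image Units.val ((powMonoidHom m : (ZMod p)ˣ →* (ZMod p)ˣ).range : Set (ZMod p)ˣ)).ncard
      = k := by
    rw [Set.ncard_image_of_injective _ Units.val_injective]
    exact hc
  rw [← h2, ← Set.ncard_coe_finset]
  congr 1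
  ext h
  simp only [coe_filter, mem_univ, true_and, Set.mem_ofPred_eq, Set.mem_image, SetLike.mem_coe,
    MonoidHom.mem_range, powMonoidHom_apply]
  constructor
  · rintro ⟨x, hx, rfl⟩
    exact ⟨(Units.mk0 x hx) ^ m, ⟨_, rfl⟩, by simp⟩
  · rintro ⟨u, ⟨v, rfl⟩, rfl⟩
    exact ⟨v, v.ne_zero, by simp⟩

theorem Q_neg_one (p k m : ℕ) [Fact p.Prime] (hp2 : p ≠ 2) (hkm : k * m = p - 1) (hk : 0 < k) (hm : 0 < m) :
    (∃ x : ZMod p, x ≠ 0 ∧ -1 = x ^ m) ↔ Even k := by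
  constructor
  · rintro ⟨x, hx, h⟩
    by_contra ho
    rw [Nat.not_even_iff_odd] at ho
    have h1 := ZMod.pow_card_sub_one_eq_one hx
    rw [← hkm, mul_comm, pow_mul, ← h, ho.neg_one_pow] at h1
    have : Fact (2 < p) := ⟨by have := (Fact.out : p.Prime).two_le; omega⟩
    exact ZMod.neg_one_ne_one h1
  · rintro ⟨r, hr⟩
    obtain ⟨g, hg⟩ := IsCyclic.exists_generator (α := (ZMod p)ˣ)
    have ho : orderOf g = k * m := by
      rw [orderOf_eq_card_of_forall_mem_zpowers hg, Nat.card_eq_fintype_card, ZMod.card_units p, hkm]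
    refine ⟨(g : ZMod p) ^ r, by simp, ?_⟩
    have h1 : ((g : ZMod p) ^ r) ^ m ≠ 1 := by
      rw [← pow_mul, ← Units.val_pow_eq_pow_val]
      intro h
      have h : g ^ (r * m) = 1 := Units.ext h
      have := orderOf_dvd_of_pow_eq_one h
      rw [ho] at this
      have hrm : 0 < r * m := Nat.mul_pos (by omega) hm
      have := Nat.le_of_dvd hrm this
      rw [hr, add_mul] at this
      omega
    have h2 : (((g : ZMod p) ^ r) ^ m) ^ 2 = 1 := by
      have : (g : ZMod p) ^ (k * m) = 1 := by
        rw [← ho, ← Units.val_pow_eq_pow_val, pow_orderOf_eq_one]; rfl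
      rw [← this, hr]; ring
    rcases mul_self_eq_one_iff.1 ((sq _).symm.trans h2) with h | h
    · exact absurd h h1
    · exact h.symm

open Finset in
theorem parity (p : ℕ) [Fact p.Prime] (Q : ZMod p → Prop) [DecidablePred Q]
    (hQi : ∀ a, Q a → Q a⁻¹) (n : ℕ) (hn : p = 2 * n + 1) :
    (∏ x ∈ (Icc 1 (p - 1)) ×ˢ (Icc 1 (p - 1)) with (x.1 < x.2 ∧ Q ((x.1 : ZMod p) / x.2)),
      (if x.1 + n < x.2 then (-1 : ZMod p) else 1)) = if Q (-1) then (-1) ^ (n / 2) else 1 := by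
  have hne : ∀ s : ℕ, 1 ≤ s → s < p → (s : ZMod p) ≠ 0 := by
    intro s h1 h2 h
    rw [ZMod.natCast_eq_zero_iff] at h
    exact absurd (Nat.le_of_dvd (by omega) h) (by omega)
  rw [← prod_filter_mul_prod_filter_not _ (fun x : ℕ × ℕ => x.1 + x.2 = p)]
  have h2 : (∏ x ∈ {x ∈ {x ∈ (Icc 1 (p - 1)) ×ˢ (Icc 1 (p - 1)) |
      (x.1 < x.2 ∧ Q ((x.1 : ZMod p) / x.2))} | ¬ (x.1 + x.2 = p)},
      (if x.1 + n < x.2 then (-1 : ZMod p) else 1)) = 1 := by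
    refine prod_involution (fun x _ => (p - x.2, p - x.1)) ?_ ?_ ?_ ?_
    · rintro ⟨s, t⟩ hx
      simp only [mem_filter, mem_product, mem_Icc] at hx ⊢
      have : (p - t + n < p - s) ↔ s + n < t := by omega
      simp only [this]
      split_ifs <;> simp
    · rintro ⟨s, t⟩ hx _ h
      simp only [mem_filter, mem_product, mem_Icc, Prod.mk.injEq] at hx h
      omega
    · rintro ⟨s, t⟩ hx
      simp only [mem_filter, mem_product, mem_Icc] at hx ⊢
      obtain ⟨⟨hb, hlt, hq⟩, hs⟩ := hx
      refine ⟨⟨by omega, by omega, ?_⟩, by omega⟩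
      rw [Nat.cast_sub (by omega), Nat.cast_sub (by omega)]
      have := hQi _ hq
      rw [inv_div] at this
      simpa [neg_div_neg_eq] using this
    · rintro ⟨s, t⟩ hx
      simp only [mem_filter, mem_product, mem_Icc, Prod.mk.injEq] at hx ⊢
      omega
  rw [h2, mul_one, prod_ite, prod_const, prod_const_one, mul_one, filter_filter, filter_filter]
  split_ifs with hq
  · congr 1
    rw [← Nat.card_Icc 1 (n / 2) |>.trans (by omega : n / 2 + 1 - 1 = n / 2)]
    refine card_bij' (fun x _ => x.1) (fun s _ => (s, p - s)) ?_ ?_ ?_ ?_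
    · rintro ⟨s, t⟩ hx
      simp only [mem_filter, mem_product, mem_Icc] at hx ⊢
      omega
    · intro s hx
      simp only [mem_filter, mem_product, mem_Icc] at hx ⊢
      refine ⟨by omega, ⟨by omega, ?_⟩, by omega⟩
      have := hne s (by omega) (by omega)
      rw [Nat.cast_sub (by omega)]
      simpa [div_neg, div_self this] using hq
    · rintro ⟨s, t⟩ hx
      simp only [mem_filter, mem_product, mem_Icc, Prod.mk.injEq] at hx ⊢
      exact ⟨trivial, by omega⟩
    · intro s hx
      rfl
  · rw [card_eq_zero.2, pow_zero]
    rw [filter_eq_empty_iff]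
    rintro ⟨s, t⟩ hx ⟨⟨hlt, hqq⟩, hst, -⟩
    simp only [mem_product, mem_Icc] at hx hlt hqq hst
    apply hq
    have h1 : (t : ZMod p) = - s := by
      have := congrArg (Nat.cast : ℕ → ZMod p) hst
      push_cast at this
      rw [ZMod.natCast_self] at this
      linear_combination this
    have := hne s (by omega) (by omega)
    rw [h1, div_neg, div_self this] at hqq
    exact hqq

open Finset in
theorem main_prod (p : ℕ) [Fact p.Prime] (Q : ZMod p → Prop) [DecidablePred Q]
    (hQi : ∀ a, Q a → Q a⁻¹) (hQ1 : Q 1) (hQ0 : ∀ a, Q a → a ≠ 0) (n : ℕ) (hn : p = 2 * n + 1) :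
    (∏ x ∈ (Icc 1 (p - 1)) ×ˢ (Icc 1 (p - 1)) with (x.1 < x.2 ∧ Q ((x.1 : ZMod p) / x.2)),
      ((x.2 : ZMod p) - x.1)) = (n.factorial : ZMod p) ^ (#{h : ZMod p | Q h} - 1) *
        if Q (-1) then (-1) ^ (n / 2) else 1 := by
  rw [← parity p Q hQi n hn]
  have h1 : ∀ x ∈ {x ∈ (Icc 1 (p - 1)) ×ˢ (Icc 1 (p - 1)) |
      (x.1 < x.2 ∧ Q ((x.1 : ZMod p) / x.2))}, ((x.2 : ZMod p) - x.1) =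
      ((if x.1 + n < x.2 then p - (x.2 - x.1) else x.2 - x.1 : ℕ) : ZMod p) *
      (if x.1 + n < x.2 then (-1 : ZMod p) else 1) := by
    rintro ⟨s, t⟩ hx
    simp only [mem_filter, mem_product, mem_Icc] at hx ⊢
    split_ifs
    · rw [Nat.cast_sub (by omega), Nat.cast_sub (by omega)]; simp
    · rw [Nat.cast_sub (by omega)]; simp
  rw [prod_congr rfl h1, prod_mul_distrib]
  congr 1
  rw [← prod_fiberwise_of_maps_to (t := Ico 1 (n + 1))
    (g := fun x : ℕ × ℕ => if x.1 + n < x.2 then p - (x.2 - x.1) else x.2 - x.1)]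
  · rw [← prod_Ico_id_eq_factorial, Nat.cast_prod, ← prod_pow]
    refine prod_congr rfl fun d hd => ?_
    rw [mem_Ico] at hd
    rw [← fiber_card p Q hQi hQ1 hQ0 d hd.1 (by omega)]
    rw [prod_congr rfl (g := fun _ => (d : ZMod p))]
    · rw [prod_const, filter_filter]
      congr 2
      ext ⟨s, t⟩
      simp only [mem_filter, mem_product, mem_Icc]
      refine and_congr_right fun hb => and_congr_right fun hl => ?_
      split_ifs <;> omega
    · intro x hx
      rw [mem_filter] at hx
      rw [hx.2]
  · rintro ⟨s, t⟩ hx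
    simp only [mem_filter, mem_product, mem_Icc, mem_Ico] at hx ⊢
    split_ifs <;> omega

open Finset in
open scoped Classical in
theorem cast_prod_eq (p : ℕ) [Fact p.Prime] (m : ℕ) :
    (((∏ t ∈ Finset.Icc 1 (p - 1), ∏ s ∈ Finset.Ico 1 t,
        if ∃ x : ℤ, ¬ (p : ℤ) ∣ x ∧ (s : ℤ) ≡ (t : ℤ) * x ^ m [ZMOD p]
        then (t : ℤ) - (s : ℤ) else 1 : ℤ)) : ZMod p) =
    (∏ x ∈ (Icc 1 (p - 1)) ×ˢ (Icc 1 (p - 1)) with (x.1 < x.2 ∧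
      ∃ y : ZMod p, y ≠ 0 ∧ ((x.1 : ZMod p) / x.2) = y ^ m), ((x.2 : ZMod p) - x.1)) := by
  rw [prod_filter, prod_product_right, Int.cast_prod]
  refine prod_congr rfl fun t ht => ?_
  rw [mem_Icc] at ht
  have hI : Ico 1 t = {s ∈ Icc 1 (p - 1) | s < t} := by
    ext s; simp only [mem_Ico, mem_filter, mem_Icc]; omega
  rw [hI, prod_filter, Int.cast_prod]
  refine prod_congr rfl fun s hs => ?_
  have ht0 : (t : ZMod p) ≠ 0 := by
    intro h
    rw [ZMod.natCast_eq_zero_iff] at h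
    exact absurd (Nat.le_of_dvd (by omega) h) (by omega)
  have he : (∃ x : ℤ, ¬ (p : ℤ) ∣ x ∧ (s : ℤ) ≡ (t : ℤ) * x ^ m [ZMOD p]) ↔
      ∃ y : ZMod p, y ≠ 0 ∧ ((s : ZMod p) / t) = y ^ m := by
    constructor
    · rintro ⟨x, hx, h⟩
      refine ⟨x, by rwa [Ne, ZMod.intCast_zmod_eq_zero_iff_dvd], ?_⟩
      rw [← ZMod.intCast_eq_intCast_iff] at h
      push_cast at h
      rw [h, mul_div_cancel_left₀ _ ht0]
    · rintro ⟨y, hy, h⟩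
      obtain ⟨x, rfl⟩ := ZMod.intCast_surjective y
      refine ⟨x, by rwa [Ne, ZMod.intCast_zmod_eq_zero_iff_dvd] at hy, ?_⟩
      rw [← ZMod.intCast_eq_intCast_iff]
      push_cast
      rw [div_eq_iff ht0] at h
      rw [h, mul_comm]
  simp only [he]
  by_cases h1 : s < t <;> by_cases h2 : ∃ y : ZMod p, y ≠ 0 ∧ ((s : ZMod p) / t) = y ^ m <;>
    simp [h1, h2]


open scoped Classical in
/-- Let `p` be an odd prime and `k, m` positive integers with `km = p−1`.
Let `P` be the product of `t − s` over all pairs `1 ≤ s < t ≤ p−1` such that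
`s ≡ t·x^m (mod p)` for some integer `x` not divisible by `p`. Then
`P ≡ (−1)^{((p+1)/2)·((p−1)/(2m)) + ⌊(p−3)/4⌋}·((p−1)/2)! (mod p)` if `p ≡ 1 (mod 2m)`,
and `P ≡ (−1)^{((p+1)/2)·((p−1−m)/(2m))} (mod p)` if `p ≡ 1+m (mod 2m)`. -/
theorem stmt6 (p : ℕ) [Fact p.Prime] (hp2 : p ≠ 2) (k m : ℕ)
    (hk : 0 < k) (hm : 0 < m) (hkm : k * m = p - 1) :
    (p % (2 * m) = 1 →
      (∏ t ∈ Finset.Icc 1 (p - 1), ∏ s ∈ Finset.Ico 1 t,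
        if ∃ x : ℤ, ¬ (p : ℤ) ∣ x ∧ (s : ℤ) ≡ (t : ℤ) * x ^ m [ZMOD p]
        then (t : ℤ) - (s : ℤ) else 1) ≡
      (-1) ^ (((p + 1) / 2) * ((p - 1) / (2 * m)) + (p - 3) / 4) *
        (Nat.factorial ((p - 1) / 2) : ℤ) [ZMOD p]) ∧
    (p ≡ 1 + m [MOD 2 * m] →
      (∏ t ∈ Finset.Icc 1 (p - 1), ∏ s ∈ Finset.Ico 1 t,
        if ∃ x : ℤ, ¬ (p : ℤ) ∣ x ∧ (s : ℤ) ≡ (t : ℤ) * x ^ m [ZMOD p]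
        then (t : ℤ) - (s : ℤ) else 1) ≡
      (-1) ^ (((p + 1) / 2) * ((p - 1 - m) / (2 * m))) [ZMOD p]) := by
  obtain ⟨n, hn⟩ : ∃ n, p = 2 * n + 1 := (Fact.out : p.Prime).odd_of_ne_two hp2
  have hn1 : 1 ≤ n := by
    have := (Fact.out : p.Prime).two_le
    omega
  have hP := (cast_prod_eq p m).trans (main_prod p (fun h => ∃ y : ZMod p, y ≠ 0 ∧ h = y ^ m)
    (by
      rintro a ⟨y, hy, rfl⟩
      exact ⟨y⁻¹, inv_ne_zero hy, by rw [inv_pow]⟩)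
    ⟨1, one_ne_zero, by simp⟩
    (by
      rintro a ⟨y, hy, rfl⟩
      exact pow_ne_zero _ hy) n hn)
  rw [card_Q p k m hkm hk hm] at hP
  simp only [Q_neg_one p k m hp2 hkm hk hm] at hP
  have hsq := half_fact_sq p n hn
  have hpn : (p - 1) / 2 = n := by omega
  have hpn2 : (p + 1) / 2 = n + 1 := by omega
  have hkm2 : k * m + 1 = p := by omega
  constructor
  · intro h
    rw [← ZMod.intCast_eq_intCast_iff, hP]
    have hev : ∃ r, k = 2 * r := by
      have h1 : 2 * m ∣ k * m := by
        rw [← hkm2, ← Nat.mod_add_div (k * m + 1) (2 * m)] at hkm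
        rw [hkm2, h] at hkm
        exact ⟨p / (2 * m), by omega⟩
      obtain ⟨r, hr⟩ := h1
      exact ⟨r, Nat.eq_of_mul_eq_mul_right hm (by rw [hr]; ring)⟩
    obtain ⟨r, rfl⟩ := hev
    have hr : (p - 1) / (2 * m) = r := by
      rw [← hkm, mul_comm 2 r, mul_assoc, Nat.mul_div_cancel _ (by omega)]
    obtain ⟨q, rfl⟩ : ∃ q, r = q + 1 := ⟨r - 1, by omega⟩
    rw [if_pos (by simp), hr, hpn, hpn2]
    have e : 2 * (q + 1) - 1 = 2 * q + 1 := by omega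
    rw [e, pow_succ, pow_mul, hsq]
    push_cast
    have e2 : (-1 : ZMod p) ^ ((n + 1) * (q + 1) + (p - 3) / 4) =
        ((-1) ^ (n + 1)) ^ q * (-1) ^ (n / 2) := by
      rw [← pow_mul, ← pow_add, neg_one_pow_eq_pow_mod_two,
        neg_one_pow_eq_pow_mod_two (n := (n + 1) * q + n / 2)]
      congr 1
      rw [mul_add, mul_one]
      generalize (n + 1) * q = w
      omega
    rw [e2]
    ring
  · intro h
    rw [← ZMod.intCast_eq_intCast_iff, hP]
    have hod : ∃ r, k = 2 * r + 1 := by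
      rcases Nat.even_or_odd' k with ⟨r, hr | hr⟩
      · exfalso
        have h1 : 1 + k * m ≡ 1 + m [MOD 2 * m] := by rwa [add_comm, hkm2]
        have h2 := Nat.ModEq.add_left_cancel' 1 h1
        have h3 : k * m ≡ 0 [MOD 2 * m] := by
          rw [Nat.modEq_zero_iff_dvd]; exact ⟨r, by rw [hr]; ring⟩
        have h4 := h2.symm.trans h3
        rw [Nat.modEq_zero_iff_dvd] at h4
        have := Nat.le_of_dvd hm h4
        omega
      · exact ⟨r, hr⟩
    obtain ⟨r, rfl⟩ := hod
    have hr : (p - 1 - m) / (2 * m) = r := by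
      have : p - 1 - m = r * (2 * m) := by
        rw [← hkm, add_mul, one_mul, Nat.add_sub_cancel]; ring
      rw [this, Nat.mul_div_cancel _ (by omega)]
    rw [if_neg (by simp), hr, hpn2, Nat.add_sub_cancel, pow_mul, hsq]
    push_cast
    rw [pow_mul, mul_one]
end

section
/- Let p = 2n+1 be an odd prime. Write {1,…,p−1} = {a_1,…,a_n} ∪ {b_1,…,b_n} with a_1 < … < a_n and b_1 < … < b_n, where a_1,…,a_n are the quadratic residues modulo p in {1,…,p−1} and b_1,…,b_n are the quadratic nonresidues modulo p in {1,…,p−1}. Then ∏_{1≤j<k≤n}(a_k−a_j)(b_k−b_j) ≡ −n! (mod p) if p ≡ 1 (mod 4), and ∏_{1≤j<k≤n}(a_k−a_j)(b_k−b_j) ≡ 1 (mod p) if p ≡ 3 (mod 4). -/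
open Finset Polynomial

lemma aux_sign (R : Type*) [CommRing R] (m : ℕ) :
    ∏ k ∈ range (2 * m), (-1 : R) ^ k = (-1) ^ m ∧
    ∏ k ∈ range (2 * m + 1), (-1 : R) ^ k = (-1) ^ m := by
  induction m with
  | zero => simp
  | succ m ih =>
    have h1 : ∏ k ∈ range (2 * (m + 1)), (-1 : R) ^ k = (-1) ^ (m + 1) := by
      rw [show 2 * (m + 1) = 2 * m + 1 + 1 by ring, prod_range_succ, ih.2]
      rw [pow_succ (-1 : R) (2 * m), pow_mul]; simp [pow_succ]
    refine ⟨h1, ?_⟩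
    rw [prod_range_succ, h1, pow_mul]; simp

lemma aux_nodal {K : Type*} [Field K] (n : ℕ) (hn : 0 < n) (f : Fin n → K)
    (hf : Function.Injective f) (c : K) (h : ∀ i, f i ^ n = c) :
    ∏ i, (X - C (f i)) = X ^ n - C c := by
  classical
  have hm : (∏ i, (X - C (f i))).Monic := monic_prod_of_monic _ _ (fun i _ => monic_X_sub_C _)
  have hd : (∏ i, (X - C (f i))).degree = (n : WithBot ℕ) := by
    rw [degree_prod]; simp
  have hd2 : (X ^ n - C c : K[X]).degree = n := degree_X_pow_sub_C hn c
  apply eq_of_degree_sub_lt_of_eval_finset_eq (univ.image f)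
  · rw [card_image_of_injective _ hf, card_univ, Fintype.card_fin]
    have := degree_sub_lt_left (hd.trans hd2.symm) hm.ne_zero
      (by rw [hm.leadingCoeff, (monic_X_pow_sub_C c hn.ne').leadingCoeff])
    rwa [hd] at this
  · intro x hx
    obtain ⟨i, -, rfl⟩ := mem_image.1 hx
    rw [eval_prod, prod_eq_zero (mem_univ i) (by simp)]
    simp [h]

lemma aux_fact (p n : ℕ) [Fact p.Prime] (hpn : p = 2 * n + 1) (k l : ℕ) (hk : k + l = 2 * n) :
    ((k.factorial : ZMod p) * l.factorial) = (-1) ^ (k + 1) := by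
  induction k generalizing l with
  | zero =>
    have := ZMod.wilsons_lemma p
    have hl : l = p - 1 := by omega
    subst hl
    simp [this]
  | succ k ih =>
    have h := ih (l + 1) (by omega)
    have hF : ((k + 1 + l + 1 : ℕ) : ZMod p) = 0 := by
      rw [hk, ← hpn]; simp
    have hne : ((l + 1 : ℕ) : ZMod p) ≠ 0 := by
      intro h0
      rw [ZMod.natCast_eq_zero_iff] at h0
      have := Nat.le_of_dvd (by omega) h0
      omega
    have h2 : ((k + 1 : ℕ) : ZMod p) = - ((l + 1 : ℕ) : ZMod p) := by
      push_cast at hF ⊢; linear_combination hF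
    apply mul_left_cancel₀ hne
    rw [Nat.factorial_succ] at h ⊢
    rw [Nat.cast_mul, h2, pow_succ, ← h, Nat.cast_mul]
    ring

lemma aux_super (p n : ℕ) [Fact p.Prime] (hpn : p = 2 * n + 1) :
    (∏ k ∈ range (2 * n), (k.factorial : ZMod p)) * n.factorial = ∏ k ∈ range n, (-1) ^ k := by
  rw [two_mul, prod_range_add, ← prod_range_reflect (fun x => ((n + x).factorial : ZMod p))]
  have h1 : (∏ k ∈ range n, (k.factorial : ZMod p)) * n.factorial
      = ∏ k ∈ range n, ((k + 1).factorial : ZMod p) := by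
    rw [← prod_range_succ (fun k => (k.factorial : ZMod p)), prod_range_succ']; simp
  rw [mul_right_comm, h1, ← prod_mul_distrib]
  apply prod_congr rfl
  intro k hk
  rw [mem_range] at hk
  rw [aux_fact p n hpn _ _ (by omega)]
  ring

lemma aux_two (p n : ℕ) [Fact p.Prime] (hpn : p = 2 * n + 1) (hn : 0 < n) :
    (2 : ZMod p) ^ n = if p % 8 = 1 ∨ p % 8 = 7 then 1 else -1 := by
  have h := legendreSym.eq_pow p 2
  rw [legendreSym.at_two (by omega), ZMod.χ₈_nat_eq_if_mod_eight] at h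
  have h2 : p / 2 = n := by omega
  rw [h2, if_neg (by omega)] at h
  push_cast at h
  rw [← h]

lemma aux_inner (y n : ℕ) (R : Type*) [CommRing R] (hy : y ∈ Icc 1 n) :
    ∏ x ∈ Icc 1 n, (if x < y then (y : R) - x else 1) = ((y - 1).factorial : R) := by
  rw [← prod_filter]
  rw [mem_Icc] at hy
  have : (Icc 1 n).filter (· < y) = (range (y - 1)).image (fun i => y - 1 - i) := by
    ext x; simp only [mem_filter, mem_Icc, mem_image, mem_range]
    constructor
    · intro h; exact ⟨y - 1 - x, by omega, by omega⟩
    · rintro ⟨i, hi, rfl⟩; omega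
  rw [this, prod_image (by intro i hi j hj; simp at hi hj ⊢; omega), ← prod_range_add_one_eq_factorial]
  push_cast
  apply prod_congr rfl
  intro i hi
  rw [mem_range] at hi
  have : ((y - 1 - i : ℕ) : R) = (y : R) - 1 - i := by
    rw [Nat.cast_sub (by omega), Nat.cast_sub (by omega)]; simp
  rw [this]; ring

/-- conversion of ordered products -/
lemma aux_conv {n : ℕ} (R : Type*) [CommRing R] (a : Fin n → ℕ) (ha : StrictMono a) :
    ∏ k : Fin n, ∏ j ∈ Iio k, ((a k : R) - a j) =
    ∏ y ∈ univ.image a, ∏ x ∈ univ.image a, (if x < y then (y : R) - x else 1) := by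
  rw [prod_image ha.injective.injOn]
  apply prod_congr rfl
  intro k _
  rw [prod_image ha.injective.injOn]
  simp only [ha.lt_iff_lt]
  rw [← prod_filter]
  congr 1
  ext; simp

lemma aux_set (p n : ℕ) [Fact p.Prime] (hpn : p = 2 * n + 1) (hn : 0 < n)
    (a b : Fin n → ℕ) (ha : StrictMono a) (hb : StrictMono b)
    (haI : ∀ i, a i ∈ Icc 1 (2 * n)) (hbI : ∀ i, b i ∈ Icc 1 (2 * n))
    (haR : ∀ i, (a i : ZMod p) ^ n = 1)
    (hbR : ∀ i, (b i : ZMod p) ^ n = -1) :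
    Disjoint (univ.image a) (univ.image b) ∧ univ.image a ∪ univ.image b = Icc 1 (2 * n) ∧
    (∀ x ∈ Icc 1 (2 * n), (x : ZMod p) ^ n = 1 → x ∈ univ.image a) ∧
    (∀ x ∈ Icc 1 (2 * n), (x : ZMod p) ^ n = -1 → x ∈ univ.image b) := by
  have hne : (1 : ZMod p) ≠ -1 := by
    haveI : Fact (2 < p) := ⟨by omega⟩
    exact (ZMod.neg_one_ne_one).symm
  have hd : Disjoint (univ.image a) (univ.image b) := by
    rw [disjoint_left]
    intro x h1 h2
    obtain ⟨i, -, rfl⟩ := mem_image.1 h1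
    obtain ⟨j, -, h⟩ := mem_image.1 h2
    have := hbR j
    rw [h, haR i] at this
    exact hne this
  have hu : univ.image a ∪ univ.image b = Icc 1 (2 * n) := by
    apply eq_of_subset_of_card_le
    · intro x hx
      rcases mem_union.1 hx with h | h
      · obtain ⟨i, -, rfl⟩ := mem_image.1 h; exact haI i
      · obtain ⟨i, -, rfl⟩ := mem_image.1 h; exact hbI i
    · rw [card_union_of_disjoint hd, card_image_of_injective _ ha.injective,
        card_image_of_injective _ hb.injective]; simp; omega
  refine ⟨hd, hu, ?_, ?_⟩
  · intro x hx h
    rw [← hu] at hx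
    rcases mem_union.1 hx with h' | h'
    · exact h'
    · obtain ⟨i, -, rfl⟩ := mem_image.1 h'
      rw [hbR i] at h; exact absurd h.symm hne
  · intro x hx h
    rw [← hu] at hx
    rcases mem_union.1 hx with h' | h'
    · obtain ⟨i, -, rfl⟩ := mem_image.1 h'
      rw [haR i] at h; exact absurd h hne
    · exact h'

lemma aux_inj (p n : ℕ) [Fact p.Prime] (hpn : p = 2 * n + 1) 
    (a : Fin n → ℕ) (ha : StrictMono a) (haI : ∀ i, a i ∈ Icc 1 (2 * n)) :
    Function.Injective (fun i => (a i : ZMod p)) := by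
  intro i j h
  have h' : (a i : ZMod p) = a j := h
  rw [ZMod.natCast_eq_natCast_iff'] at h'
  have h1 := mem_Icc.1 (haI i)
  have h2 := mem_Icc.1 (haI j)
  rw [Nat.mod_eq_of_lt (by omega), Nat.mod_eq_of_lt (by omega)] at h'
  exact ha.injective h'

lemma aux_cross (R N : Finset ℕ) (p : ℕ) (K : Type*) [CommRing K]
    (hd : Disjoint R N) (hR : ∀ x ∈ R, x ≤ p ∧ p - x ∈ R) (hN : ∀ x ∈ N, x ≤ p ∧ p - x ∈ N)
    (he : 4 ∣ R.card * N.card) :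
    (∏ y ∈ R, ∏ x ∈ N, (if x < y then (y : K) - x else 1)) *
    (∏ y ∈ N, ∏ x ∈ R, (if x < y then (y : K) - x else 1)) =
    ∏ x ∈ R, ∏ y ∈ N, ((x : K) - y) := by
  have hc : ((R ×ˢ N).filter (fun z => z.1 < z.2)).card =
      ((R ×ˢ N).filter (fun z => ¬ z.1 < z.2)).card := by
    apply card_bij' (fun z _ => (p - z.1, p - z.2)) (fun z _ => (p - z.1, p - z.2))
    · rintro ⟨x, y⟩ h
      simp only [mem_filter, mem_product] at h ⊢
      have h1 := hR x h.1.1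
      have h2 := hN y h.1.2
      exact ⟨⟨h1.2, h2.2⟩, by omega⟩
    · rintro ⟨x, y⟩ h
      simp only [mem_filter, mem_product] at h ⊢
      have h1 := hR x h.1.1
      have h2 := hN y h.1.2
      have : x ≠ y := fun e => disjoint_left.1 hd h.1.1 (e ▸ h.1.2)
      exact ⟨⟨h1.2, h2.2⟩, by omega⟩
    · rintro ⟨x, y⟩ h
      simp only [mem_filter, mem_product] at h
      have h1 := hR x h.1.1
      have h2 := hN y h.1.2
      simp only [Prod.mk.injEq]; omega
    · rintro ⟨x, y⟩ h
      simp only [mem_filter, mem_product] at h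
      have h1 := hR x h.1.1
      have h2 := hN y h.1.2
      simp only [Prod.mk.injEq]; omega
  have hs := card_filter_add_card_filter_not (s := R ×ˢ N) (fun z => z.1 < z.2)
  rw [card_product] at hs
  have hev : Even ((R ×ˢ N).filter (fun z => z.1 < z.2)).card := by
    rw [Nat.even_iff]; omega
  have hsign : ∏ x ∈ R, ∏ y ∈ N, (if x < y then (-1 : K) else 1) = 1 := by
    rw [← prod_product (s := R) (t := N) (f := fun z => if z.1 < z.2 then (-1 : K) else 1),
      ← prod_filter, prod_const, hev.neg_one_pow]
  rw [prod_comm (s := N), ← prod_mul_distrib]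
  have hP : ∏ x ∈ R, ∏ y ∈ N, ((x : K) - y) = (∏ x ∈ R, ∏ y ∈ N, ((x : K) - y)) *
      ∏ x ∈ R, ∏ y ∈ N, (if x < y then (-1 : K) else 1) := by rw [hsign, mul_one]
  rw [hP, ← prod_mul_distrib]
  apply prod_congr rfl
  intro x hx
  rw [← prod_mul_distrib, ← prod_mul_distrib]
  apply prod_congr rfl
  intro y hy
  have : x ≠ y := fun e => disjoint_left.1 hd hx (e ▸ hy)
  rcases lt_or_gt_of_ne this with h | h
  · rw [if_neg (by omega), if_pos h, if_pos h]; ring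
  · rw [if_pos h, if_neg (by omega), if_neg (by omega)]

lemma aux_case1 (p n : ℕ) [Fact p.Prime] (hpn : p = 2 * n + 1) (hn : 0 < n)
    (a b : Fin n → ℕ) (ha : StrictMono a) (hb : StrictMono b)
    (haI : ∀ i, a i ∈ Icc 1 (2 * n)) (hbI : ∀ i, b i ∈ Icc 1 (2 * n))
    (haR : ∀ i, (a i : ZMod p) ^ n = 1)
    (hbR : ∀ i, (b i : ZMod p) ^ n = -1) (h4 : p % 4 = 1) :
    (∏ k : Fin n, ∏ j ∈ Iio k, ((a k : ZMod p) - a j)) *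
    (∏ k : Fin n, ∏ j ∈ Iio k, ((b k : ZMod p) - b j)) = - (n.factorial : ZMod p) := by
  obtain ⟨hd, hu, hA, hB⟩ := aux_set p n hpn hn a b ha hb haI hbI haR hbR
  obtain ⟨m, rfl⟩ : ∃ m, n = 2 * m := ⟨n / 2, by omega⟩
  have hT := aux_super p _ hpn
  have hT2 : ∏ y ∈ Icc 1 (2 * (2 * m)), ∏ x ∈ Icc 1 (2 * (2 * m)),
      (if x < y then (y : ZMod p) - x else 1) = ∏ k ∈ range (2 * (2 * m)), (k.factorial : ZMod p) := by
    rw [prod_congr rfl (fun y hy => aux_inner y _ (ZMod p) hy)]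
    rw [range_eq_Ico, prod_Ico_eq_prod_range, ← Ico_add_one_right_eq_Icc, prod_Ico_eq_prod_range]
    apply prod_congr (by simp)
    intro k _
    simp
  have hneg : ∀ x ∈ Icc 1 (2 * (2 * m)), x ≤ p ∧ p - x ∈ Icc 1 (2 * (2 * m)) ∧
      ((p - x : ℕ) : ZMod p) ^ (2 * m) = (x : ZMod p) ^ (2 * m) := by
    intro x hx
    rw [mem_Icc] at hx
    refine ⟨by omega, mem_Icc.2 (by omega), ?_⟩
    rw [Nat.cast_sub (by omega), CharP.cast_eq_zero, zero_sub, (even_two_mul m).neg_pow]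
  have hcross := aux_cross (univ.image a) (univ.image b) p (ZMod p) hd ?_ ?_ ?_
  rotate_left
  · intro x hx
    obtain ⟨i, -, rfl⟩ := mem_image.1 hx
    obtain ⟨h1, h2, h3⟩ := hneg _ (haI i)
    exact ⟨h1, hA _ h2 (h3.trans (haR i))⟩
  · intro x hx
    obtain ⟨i, -, rfl⟩ := mem_image.1 hx
    obtain ⟨h1, h2, h3⟩ := hneg _ (hbI i)
    exact ⟨h1, hB _ h2 (h3.trans (hbR i))⟩
  · rw [card_image_of_injective _ ha.injective, card_image_of_injective _ hb.injective]
    simp only [card_univ, Fintype.card_fin]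
    exact ⟨m * m, by ring⟩
  have hval : ∏ x ∈ univ.image a, ∏ y ∈ univ.image b, ((x : ZMod p) - y) = 2 ^ (2 * m) := by
    rw [prod_image ha.injective.injOn]
    have : ∀ i, ∏ y ∈ univ.image b, ((a i : ZMod p) - y) = 2 := by
      intro i
      rw [prod_image hb.injective.injOn]
      have h := congrArg (eval (a i : ZMod p))
        (aux_nodal _ hn _ (aux_inj p _ hpn b hb hbI) (-1) hbR)
      rw [eval_prod] at h
      simp only [eval_sub, eval_X, eval_C, eval_pow, haR] at h
      rw [h]; norm_num
    rw [prod_congr rfl (fun i _ => this i)]; simp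
  rw [hval] at hcross
  rw [← hu, prod_union hd] at hT2
  simp only [prod_union hd, prod_mul_distrib] at hT2
  rw [← aux_conv _ a ha, ← aux_conv _ b hb] at hT2
  rw [(aux_sign (ZMod p) m).1, ← hT2] at hT
  have hw := aux_fact p _ hpn (2 * m) (2 * m) (by ring)
  rw [pow_succ, (even_two_mul m).neg_one_pow] at hw
  have h2 : (2 : ZMod p) ^ (2 * m) = (-1) ^ m := by
    rw [aux_two p _ hpn hn]
    rcases Nat.even_or_odd m with h | h
    · rw [h.neg_one_pow, if_pos]; rw [Nat.even_iff] at h; omega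
    · rw [h.neg_one_pow, if_neg]; rw [Nat.odd_iff] at h; omega
  rw [h2] at hcross
  have hs : ((-1 : ZMod p) ^ m) * (-1) ^ m = 1 := by rw [← mul_pow]; simp
  generalize (∏ k : Fin (2 * m), ∏ j ∈ Iio k, ((a k : ZMod p) - a j)) = A at *
  generalize (∏ k : Fin (2 * m), ∏ j ∈ Iio k, ((b k : ZMod p) - b j)) = B at *
  generalize (-1 : ZMod p) ^ m = s at *
  generalize ((2 * m).factorial : ZMod p) = f at *
  have h1 : A * B * s * f = s := by
    linear_combination hT - A * B * f * hcross
  have h5 : A * B * f = 1 := by linear_combination s * h1 + (1 - A * B * f) * hs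
  linear_combination (-f) * h5 + (A * B) * hw

lemma aux_case3 (p n : ℕ) [Fact p.Prime] (hpn : p = 2 * n + 1) (hn : 0 < n)
    (a b : Fin n → ℕ) (ha : StrictMono a) (hb : StrictMono b)
    (haI : ∀ i, a i ∈ Icc 1 (2 * n)) (hbI : ∀ i, b i ∈ Icc 1 (2 * n))
    (haR : ∀ i, (a i : ZMod p) ^ n = 1)
    (hbR : ∀ i, (b i : ZMod p) ^ n = -1) (h4 : p % 4 = 3) :
    (∏ k : Fin n, ∏ j ∈ Iio k, ((a k : ZMod p) - a j)) *
    (∏ k : Fin n, ∏ j ∈ Iio k, ((b k : ZMod p) - b j)) = 1 := by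
  obtain ⟨hd, hu, hA, hB⟩ := aux_set p n hpn hn a b ha hb haI hbI haR hbR
  have hodd : Odd n := by rw [Nat.odd_iff]; omega
  -- the nonresidues are the reflected residues
  have hc : StrictMono (fun i : Fin n => p - a (Fin.rev i)) := by
    intro i j hij
    have h1 : a (Fin.rev j) < a (Fin.rev i) := ha (Fin.rev_lt_rev.2 hij)
    have h2 := mem_Icc.1 (haI (Fin.rev i))
    show p - a (Fin.rev i) < p - a (Fin.rev j)
    omega
  have hbc : b = fun i : Fin n => p - a (Fin.rev i) := by
    have hcard : (univ.image b).card = n := by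
      rw [card_image_of_injective _ hb.injective]; simp
    refine (orderEmbOfFin_unique hcard (fun i => mem_image_of_mem _ (mem_univ i)) hb).trans ?_
    symm
    apply orderEmbOfFin_unique hcard _ hc
    intro i
    have h2 := mem_Icc.1 (haI (Fin.rev i))
    apply hB _ (mem_Icc.2 (by omega))
    rw [Nat.cast_sub (by omega), CharP.cast_eq_zero, zero_sub, hodd.neg_pow, haR]
  have hBF : ∀ i, (b i : ZMod p) = - (a (Fin.rev i) : ZMod p) := by
    intro i
    have h2 := mem_Icc.1 (haI (Fin.rev i))
    rw [hbc]
    show ((p - a (Fin.rev i) : ℕ) : ZMod p) = _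
    rw [Nat.cast_sub (by omega), CharP.cast_eq_zero, zero_sub]
  have hBA : (∏ k : Fin n, ∏ j ∈ Iio k, ((b k : ZMod p) - b j)) =
      (∏ k ∈ range n, (-1) ^ k) * ∏ k : Fin n, ∏ j ∈ Ioi k, ((a k : ZMod p) - a j) := by
    have h1 : ∏ k ∈ range n, (-1 : ZMod p) ^ k = ∏ k : Fin n, ∏ j ∈ Iio k, (-1 : ZMod p) := by
      rw [prod_range]; simp
    have h2 : ∏ k : Fin n, ∏ j ∈ Ioi k, ((a k : ZMod p) - a j) =
        ∏ k : Fin n, ∏ j ∈ Iio k, ((a (Fin.rev k) : ZMod p) - a (Fin.rev j)) := by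
      rw [← Equiv.prod_comp Fin.revPerm]
      apply prod_congr rfl
      intro k _
      apply prod_bij' (fun j _ => Fin.rev j) (fun j _ => Fin.rev j)
      · intro j hj; simp at hj ⊢; rw [← Fin.rev_lt_rev]; simpa using hj
      · intro j hj; simp at hj ⊢; exact hj
      · simp
      · simp
      · simp
    rw [h1, h2, ← prod_mul_distrib]
    apply prod_congr rfl
    intro k _
    rw [← prod_mul_distrib]
    apply prod_congr rfl
    intro j _
    rw [hBF, hBF]; ring
  have hnod := aux_nodal _ hn _ (aux_inj p _ hpn a ha haI) 1 haR
  have hder : ∀ k, (∏ j ∈ Iio k, ((a k : ZMod p) - a j)) * ∏ j ∈ Ioi k, ((a k : ZMod p) - a j)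
      = n * (a k : ZMod p) ^ (n - 1) := by
    intro k
    have h := congrArg (fun q => eval (a k : ZMod p) (derivative q)) hnod
    simp only [derivative_prod_finset, eval_finsetSum] at h
    rw [sum_eq_single k] at h
    · simp [eval_prod, derivative_X_pow] at h
      rw [← h, ← prod_union]
      · apply prod_congr
        · ext j; simp
        · simp
      · rw [disjoint_left]; intro x; simp; intro h; exact h.le
    · intro i _ hik
      rw [eval_mul, eval_prod, prod_eq_zero (i := k), zero_mul]
      · simp [hik.symm]
      · simp
    · simp
  have hprod : ∏ k, (a k : ZMod p) = 1 := by
    have h := congrArg (eval 0) hnod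
    rw [eval_prod] at h
    simp [hn.ne', prod_neg, hodd.neg_one_pow] at h
    exact h
  have hmain : (∏ k : Fin n, ∏ j ∈ Iio k, ((a k : ZMod p) - a j)) *
      (∏ k : Fin n, ∏ j ∈ Ioi k, ((a k : ZMod p) - a j)) = (n : ZMod p) ^ n := by
    rw [← prod_mul_distrib, prod_congr rfl (fun k _ => hder k), prod_mul_distrib, prod_pow, hprod]
    simp
  rw [hBA, mul_left_comm, hmain]
  have h2n : (2 : ZMod p) ^ n * (n : ZMod p) ^ n = -1 := by
    rw [← mul_pow]
    have : ((2 * n + 1 : ℕ) : ZMod p) = 0 := by rw [← hpn]; simp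
    push_cast at this
    rw [eq_neg_of_add_eq_zero_left this, hodd.neg_one_pow]
  obtain ⟨m, rfl⟩ := hodd
  rw [(aux_sign (ZMod p) m).2]
  have h2 : (2 : ZMod p) ^ (2 * m + 1) = - (-1) ^ m := by
    rw [aux_two p _ hpn hn]
    rcases Nat.even_or_odd m with h | h
    · rw [h.neg_one_pow, if_neg]; rw [Nat.even_iff] at h; omega
    · rw [h.neg_one_pow, if_pos]; · simp
      rw [Nat.odd_iff] at h; omega
  rw [h2] at h2n
  linear_combination -h2n

/-- Let `p = 2n+1` be an odd prime, and let `a_1 < … < a_n` be the quadratic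
residues and `b_1 < … < b_n` the quadratic nonresidues modulo `p` in `{1,…,p−1}`. Then
`∏_{1≤j<k≤n}(a_k−a_j)(b_k−b_j) ≡ −n! (mod p)` if `p ≡ 1 (mod 4)`, and `≡ 1 (mod p)` if
`p ≡ 3 (mod 4)`. -/
theorem stmt7 (p n : ℕ) [Fact p.Prime] (hpn : p = 2 * n + 1) (hn : 0 < n)
    (a b : Fin n → ℕ) (ha : StrictMono a) (hb : StrictMono b)
    (haR : ∀ i, a i ∈ Finset.Icc 1 (p - 1) ∧ legendreSym p (a i) = 1)
    (hbR : ∀ i, b i ∈ Finset.Icc 1 (p - 1) ∧ legendreSym p (b i) = -1) :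
    (p % 4 = 1 →
      (∏ k : Fin n, ∏ j ∈ Finset.Iio k,
        (((a k : ℤ) - (a j : ℤ)) * ((b k : ℤ) - (b j : ℤ)))) ≡
      -(Nat.factorial n : ℤ) [ZMOD p]) ∧
    (p % 4 = 3 →
      (∏ k : Fin n, ∏ j ∈ Finset.Iio k,
        (((a k : ℤ) - (a j : ℤ)) * ((b k : ℤ) - (b j : ℤ)))) ≡ 1 [ZMOD p]) := by
  have hIa : ∀ i, a i ∈ Finset.Icc 1 (2 * n) := fun i => by
    have := (haR i).1; rwa [show p - 1 = 2 * n by omega] at this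
  have hIb : ∀ i, b i ∈ Finset.Icc 1 (2 * n) := fun i => by
    have := (hbR i).1; rwa [show p - 1 = 2 * n by omega] at this
  have hpa : ∀ i, (a i : ZMod p) ^ n = 1 := fun i => by
    have h := legendreSym.eq_pow p (a i)
    rw [(haR i).2, show p / 2 = n by omega] at h
    push_cast at h; exact h.symm
  have hpb : ∀ i, (b i : ZMod p) ^ n = -1 := fun i => by
    have h := legendreSym.eq_pow p (b i)
    rw [(hbR i).2, show p / 2 = n by omega] at h
    push_cast at h; exact h.symm
  constructor
  · intro h4
    have := aux_case1 p n hpn hn a b ha hb hIa hIb hpa hpb h4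
    rw [← ZMod.intCast_eq_intCast_iff]
    push_cast
    simp only [Finset.prod_mul_distrib]
    exact this
  · intro h4
    have := aux_case3 p n hpn hn a b ha hb hIa hIb hpa hpb h4
    rw [← ZMod.intCast_eq_intCast_iff]
    push_cast
    simp only [Finset.prod_mul_distrib]
    exact this
end

section
/- Let p be an odd prime and let a, b be integers with Legendre symbols (a/p) = 1 and (b/p) = −1. Then s_p(a)·s_p(b) = (−1)^{(p+3)/4}·δ(ab,p) if p ≡ 1 (mod 4), and s_p(a)·s_p(b) = (−1)^{(p−3)/4} if p ≡ 3 (mod 4). -/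
/-- `sgnProd p a = s_p(a) = (−1)^N`, where `N` is the number of pairs `(j,k)` with
`1 ≤ j < k ≤ (p−1)/2` and `{aj²}_p > {ak²}_p` (least nonnegative residues mod `p`). -/
def sgnProd (p : ℕ) (a : ℤ) : ℤ :=
  (-1) ^ Finset.card (Finset.filter
    (fun jk : ℕ × ℕ => jk.1 < jk.2 ∧
      (a * (jk.2 : ℤ) ^ 2) % (p : ℤ) < (a * (jk.1 : ℤ) ^ 2) % (p : ℤ))
    (Finset.Icc 1 ((p - 1) / 2) ×ˢ Finset.Icc 1 ((p - 1) / 2)))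

/-- `deltaP p c = δ(c,p)`, defined for `p ≡ 1 (mod 4)` and `p ∤ c` to be `1` if
`c^{(p−1)/4} ≡ ((p−1)/2)! (mod p)` and `−1` otherwise. -/
def deltaP (p : ℕ) (c : ℤ) : ℤ :=
  if (c : ZMod p) ^ ((p - 1) / 4) = (Nat.factorial ((p - 1) / 2) : ZMod p) then 1 else -1

namespace Aux8

open Finset

/-- ordered pairs -/
def LP {α : Type*} [LinearOrder α] (S : Finset α) : Finset (α × α) :=
  (S ×ˢ S).filter (fun x => x.1 < x.2)

lemma prod_offDiag {α M : Type*} [LinearOrder α] [CommMonoid M] (S : Finset α) (g : α → α → M) :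
    ∏ x ∈ S.offDiag, g x.1 x.2 = (∏ x ∈ LP S, g x.1 x.2) * ∏ x ∈ LP S, g x.2 x.1 := by
  rw [← Finset.prod_filter_mul_prod_filter_not S.offDiag (fun x => x.1 < x.2)]
  congr 1
  · apply Finset.prod_congr _ (fun _ _ => rfl)
    ext ⟨x, y⟩
    simp only [LP, mem_filter, mem_offDiag, mem_product]
    constructor
    · tauto
    · rintro ⟨h, h'⟩
      exact ⟨⟨h.1, h.2, h'.ne⟩, h'⟩
  · refine Finset.prod_bij' (fun x _ => (x.2, x.1)) (fun x _ => (x.2, x.1)) ?_ ?_ ?_ ?_ ?_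
    · rintro ⟨x, y⟩ h
      simp only [LP, mem_filter, mem_offDiag, mem_product] at h ⊢
      exact ⟨⟨h.1.2.1, h.1.1⟩, lt_of_le_of_ne (not_lt.1 h.2) h.1.2.2.symm⟩
    · rintro ⟨x, y⟩ h
      simp only [LP, mem_filter, mem_offDiag, mem_product] at h ⊢
      exact ⟨⟨h.1.2, h.1.1, h.2.ne'⟩, not_lt.2 h.2.le⟩
    all_goals simp

lemma card_LP {α : Type*} [LinearOrder α] (S : Finset α) :
    2 * (LP S).card + S.card = S.card * S.card := by
  have h := prod_offDiag S (fun _ _ => (2 : ℕ))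
  simp only [prod_const, offDiag_card, ← pow_add] at h
  have h2 := Nat.pow_right_injective (le_refl 2) h
  have h3 : #S ≤ #S * #S := Nat.le_mul_self _
  omega

/-- absolute Vandermonde -/
def VV (T : Finset ℤ) : ℤ := ∏ x ∈ LP T, (x.2 - x.1)

lemma VV_nonneg (T : Finset ℤ) : 0 ≤ VV T := by
  apply Finset.prod_nonneg
  intro x hx
  simp only [LP, mem_filter] at hx
  linarith [hx.2]

lemma VV_sq (T : Finset ℤ) : VV T * VV T = ∏ x ∈ T.offDiag, |x.2 - x.1| := by
  rw [prod_offDiag T (fun x y => |y - x|)]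
  have : ∀ x ∈ LP T, x.1 < x.2 := by
    intro x hx; simp only [LP, mem_filter] at hx; exact hx.2
  unfold VV
  congr 1 <;> apply Finset.prod_congr rfl <;> intro x hx
  · rw [abs_of_pos]; linarith [this x hx]
  · rw [abs_of_neg] <;> linarith [this x hx]

lemma VV_image {α : Type*} [LinearOrder α] (S : Finset α) (f : α → ℤ) (hf : Set.InjOn f S) :
    VV (S.image f) = ∏ x ∈ LP S, |f x.2 - f x.1| := by
  have h0 : 0 ≤ ∏ x ∈ LP S, |f x.2 - f x.1| := Finset.prod_nonneg (fun _ _ => abs_nonneg _)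
  have h1 : VV (S.image f) * VV (S.image f) =
      (∏ x ∈ LP S, |f x.2 - f x.1|) * ∏ x ∈ LP S, |f x.2 - f x.1| := by
    rw [VV_sq]
    have := prod_offDiag S (fun x y => |f y - f x|)
    have e : ∏ x ∈ LP S, |f x.1 - f x.2| = ∏ x ∈ LP S, |f x.2 - f x.1| :=
      Finset.prod_congr rfl (fun x _ => abs_sub_comm _ _)
    rw [e] at this
    rw [← this]
    symm
    apply Finset.prod_bij (fun x _ => (f x.1, f x.2))
    · rintro ⟨x, y⟩ h
      simp only [mem_offDiag] at h ⊢
      exact ⟨mem_image_of_mem _ h.1, mem_image_of_mem _ h.2.1, fun e => h.2.2 (hf h.1 h.2.1 e)⟩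
    · rintro ⟨x, y⟩ h ⟨x', y'⟩ h' e
      simp only [mem_offDiag, Prod.mk.injEq] at h h' e ⊢
      exact ⟨hf h.1 h'.1 e.1, hf h.2.1 h'.2.1 e.2⟩
    · rintro ⟨x, y⟩ h
      simp only [mem_offDiag, mem_image] at h
      obtain ⟨⟨u, hu, rfl⟩, ⟨v, hv, rfl⟩, hne⟩ := h
      exact ⟨(u, v), by simp only [mem_offDiag]; exact ⟨hu, hv, fun e => hne (by rw [e])⟩, rfl⟩
    · intros; rfl
  exact (mul_self_inj (VV_nonneg _) h0).1 h1

lemma VV_sign {α : Type*} [LinearOrder α] (S : Finset α) (f : α → ℤ) (hf : Set.InjOn f S) :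
    VV (S.image f) * (-1) ^ ((LP S).filter (fun x => f x.2 < f x.1)).card
      = ∏ x ∈ LP S, (f x.2 - f x.1) := by
  rw [VV_image S f hf, ← Finset.prod_const, Finset.prod_filter, ← Finset.prod_mul_distrib]
  apply Finset.prod_congr rfl
  intro x _
  split_ifs with h
  · rw [abs_of_neg] <;> linarith
  · rw [abs_of_nonneg] <;> linarith

lemma VV_union (R N : Finset ℤ) (h : Disjoint R N) :
    VV (R ∪ N) = VV R * VV N * ∏ x ∈ R ×ˢ N, |x.2 - x.1| := by
  have h0 : 0 ≤ ∏ x ∈ R ×ˢ N, |x.2 - x.1| := Finset.prod_nonneg (fun _ _ => abs_nonneg _)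
  have h1 : ∏ x ∈ N ×ˢ R, |x.2 - x.1| = ∏ x ∈ R ×ˢ N, |x.2 - x.1| := by
    rw [Finset.prod_product, Finset.prod_product_right]
    simp only [abs_sub_comm]
  apply (mul_self_inj (VV_nonneg _) (mul_nonneg (mul_nonneg (VV_nonneg _) (VV_nonneg _)) h0)).1
  have hd : ∀ x, x ∈ R → x ∉ N := fun x h1 h2 => Finset.disjoint_left.1 h h1 h2
  rw [VV_sq, Finset.offDiag_union h, Finset.prod_union, Finset.prod_union, Finset.prod_union, h1,
    ← VV_sq, ← VV_sq]
  · ring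
  all_goals
    rw [Finset.disjoint_left]
    rintro ⟨x, y⟩
    simp only [mem_offDiag, mem_union, mem_product]
    have := hd x
    have := hd y
    tauto

lemma VV_Icc (m : ℕ) : VV (Finset.Icc 1 (m : ℤ)) = ∏ k ∈ range m, (k.factorial : ℤ) := by
  have him : Finset.Icc 1 (m : ℤ) = (range m).image (fun i : ℕ => (i : ℤ) + 1) := by
    ext x
    simp only [mem_Icc, mem_image, mem_range]
    constructor
    · intro h; exact ⟨(x - 1).toNat, by omega, by omega⟩
    · rintro ⟨i, hi, rfl⟩; omega
  rw [him, VV_image _ _ (by intro x _ y _ h; simpa using h)]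
  unfold LP
  rw [Finset.prod_filter, Finset.prod_product_right]
  apply Finset.prod_congr rfl
  intro k hk
  rw [← Finset.prod_filter]
  have : (range m).filter (fun a => a < k) = range k := by
    ext x; simp only [mem_filter, mem_range] at *; omega
  simp only
  rw [this, ← Finset.prod_range_reflect, ← Finset.prod_range_add_one_eq_factorial]
  push_cast
  apply Finset.prod_congr rfl
  intro x hx
  rw [mem_range] at hx
  have e : ((k - 1 - x : ℕ) : ℤ) = k - 1 - x := by omega
  rw [e, abs_of_nonneg] <;> omega

/-- residues -/
def ff (p : ℕ) (a : ℤ) (j : ℕ) : ℤ := (a * (j : ℤ) ^ 2) % (p : ℤ)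

lemma ff_cast (p : ℕ) (a : ℤ) (j : ℕ) : ((ff p a j : ℤ) : ZMod p) = a * (j : ZMod p) ^ 2 := by
  unfold ff
  rw [ZMod.intCast_mod]
  push_cast
  rfl

/-- fibre of the quadratic character -/
noncomputable def FS (p n : ℕ) (e : ZMod p) : Finset ℤ :=
  (Finset.Icc 1 ((2 * n : ℕ) : ℤ)).filter (fun x : ℤ => (x : ZMod p) ^ n = e)

lemma mem_FS (p n : ℕ) (e : ZMod p) (x : ℤ) :
    x ∈ FS p n e ↔ (1 ≤ x ∧ x ≤ 2 * n) ∧ (x : ZMod p) ^ n = e := by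
  simp [FS]

lemma VV_refl (T : Finset ℤ) (c : ℤ) : VV (T.image (fun x => c - x)) = VV T := by
  rw [VV_image T _ (by intro x _ y _ h; simpa using h)]
  conv_rhs => rw [← Finset.image_id (s := T), VV_image T id (by intro x _ y _ h; simpa using h)]
  apply Finset.prod_congr rfl
  intro x _
  simp only [id]
  rw [abs_sub_comm]
  congr 1; ring

lemma nat_ne_zero (p n : ℕ) [hp : Fact p.Prime] (hpn : p = 2 * n + 1) (j : ℕ) (h1 : 1 ≤ j) (h2 : j ≤ 2 * n) : (j : ZMod p) ≠ 0 := by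
  intro h
  rw [ZMod.natCast_eq_zero_iff] at h
  have := Nat.le_of_dvd (by omega) h
  omega

lemma sq_inj (p n : ℕ) [hp : Fact p.Prime] (hpn : p = 2 * n + 1) (j k : ℕ) (h1 : 1 ≤ j) (h2 : j ≤ n) (h1' : 1 ≤ k) (h2' : k ≤ n)
    (h : (j : ZMod p) ^ 2 = (k : ZMod p) ^ 2) : j = k := by
  rcases sq_eq_sq_iff_eq_or_eq_neg.1 h with h | h
  · rw [ZMod.natCast_eq_natCast_iff'] at h
    rw [Nat.mod_eq_of_lt (by omega), Nat.mod_eq_of_lt (by omega)] at h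
    exact h
  · exfalso
    apply nat_ne_zero p n hpn (j + k) (by omega) (by omega)
    push_cast
    rw [h]; ring

lemma ff_inj (p n : ℕ) [hp : Fact p.Prime] (hpn : p = 2 * n + 1)
    (a : ℤ) (ha : (a : ZMod p) ≠ 0) : Set.InjOn (ff p a) (Finset.Icc 1 n) := by
  intro j hj k hk h
  simp only [coe_Icc, Set.mem_Icc] at hj hk
  apply sq_inj p n hpn j k hj.1 hj.2 hk.1 hk.2
  have := congrArg (fun z : ℤ => (z : ZMod p)) h
  simp only [ff_cast] at this
  exact mul_left_cancel₀ ha this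

lemma pow_2n (p n : ℕ) [hp : Fact p.Prime] (hpn : p = 2 * n + 1) (j : ZMod p) (hj : j ≠ 0) : j ^ (2 * n) = 1 := by
  have := ZMod.pow_card_sub_one_eq_one hj
  rwa [show p - 1 = 2 * n by omega] at this

lemma int_ne_zero (p n : ℕ) [hp : Fact p.Prime] (hpn : p = 2 * n + 1)
    (a : ℤ) (h1 : 1 ≤ a) (h2 : a ≤ 2 * n) : (a : ZMod p) ≠ 0 := by
  lift a to ℕ using by omega
  rw [Int.cast_natCast]
  exact nat_ne_zero p n hpn a (by omega) (by omega)

lemma img_sub (p n : ℕ) [hp : Fact p.Prime] (hpn : p = 2 * n + 1)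
    (a : ℤ) (ha : (a : ZMod p) ≠ 0) :
    (Finset.Icc 1 n).image (ff p a) ⊆ FS p n ((a : ZMod p) ^ n) := by
  intro x hx
  rw [mem_image] at hx
  obtain ⟨j, hj, rfl⟩ := hx
  rw [mem_Icc] at hj
  have hj0 := nat_ne_zero p n hpn j hj.1 (by omega)
  have h0 : (ff p a j : ZMod p) ≠ 0 := by
    rw [ff_cast]; exact mul_ne_zero ha (pow_ne_zero _ hj0)
  have h1 : 0 ≤ ff p a j := Int.emod_nonneg _ (by omega)
  have h2 : ff p a j < p := Int.emod_lt_of_pos _ (by omega)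
  have h3 : ff p a j ≠ 0 := by intro h; rw [h] at h0; simp at h0
  rw [mem_FS, ff_cast]
  refine ⟨by omega, ?_⟩
  rw [mul_pow, ← pow_mul, pow_2n p n hpn _ hj0, mul_one]

lemma one_ne_neg (p n : ℕ) [hp : Fact p.Prime] (hpn : p = 2 * n + 1)
    (hn : 1 ≤ n) : (1 : ZMod p) ≠ -1 := by
  intro h
  apply nat_ne_zero p n hpn 2 (by omega) (by omega)
  push_cast
  linear_combination h

lemma FS_disj (p n : ℕ) [hp : Fact p.Prime] (hpn : p = 2 * n + 1)
    (hn : 1 ≤ n) : Disjoint (FS p n 1) (FS p n (-1)) := by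
  rw [Finset.disjoint_left]
  intro x h1 h2
  rw [mem_FS] at h1 h2
  exact one_ne_neg p n hpn hn (h1.2.symm.trans h2.2)

lemma FS_union (p n : ℕ) [hp : Fact p.Prime] (hpn : p = 2 * n + 1) : FS p n 1 ∪ FS p n (-1) = Finset.Icc 1 ((2 * n : ℕ) : ℤ) := by
  ext x
  rw [mem_union, mem_FS, mem_FS, mem_Icc]
  push_cast
  constructor
  · tauto
  · intro h
    have := pow_2n p n hpn x (int_ne_zero p n hpn x h.1 h.2)
    rw [mul_comm, pow_mul] at this
    have := eq_or_eq_neg_of_sq_eq_sq ((x : ZMod p) ^ n) 1 (by rw [this, one_pow])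
    tauto

lemma img_eq (p n : ℕ) [hp : Fact p.Prime] (hpn : p = 2 * n + 1)
    (hn : 1 ≤ n) (a b : ℤ) (ha : (a : ZMod p) ^ n = 1) (hb : (b : ZMod p) ^ n = -1) :
    (Finset.Icc 1 n).image (ff p a) = FS p n 1 ∧ (Finset.Icc 1 n).image (ff p b) = FS p n (-1) := by
  have ha0 : (a : ZMod p) ≠ 0 := by
    intro h; rw [h, zero_pow (by omega)] at ha; simp at ha
  have hb0 : (b : ZMod p) ≠ 0 := by
    intro h; rw [h, zero_pow (by omega)] at hb; simp at hb
  have h1 := img_sub p n hpn a ha0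
  have h2 := img_sub p n hpn b hb0
  rw [ha] at h1
  rw [hb] at h2
  have c1 := card_image_of_injOn (ff_inj p n hpn a ha0)
  have c2 := card_image_of_injOn (ff_inj p n hpn b hb0)
  have c3 := card_union_of_disjoint (FS_disj p n hpn hn)
  rw [FS_union p n hpn] at c3
  simp only [Nat.card_Icc, Int.card_Icc] at c1 c2 c3
  have c4 := card_le_card h1
  have c5 := card_le_card h2
  exact ⟨eq_of_subset_of_card_le h1 (by omega), eq_of_subset_of_card_le h2 (by omega)⟩

lemma FS_card (p n : ℕ) [hp : Fact p.Prime] (hpn : p = 2 * n + 1)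
    (hn : 1 ≤ n) (a b : ℤ) (ha : (a : ZMod p) ^ n = 1) (hb : (b : ZMod p) ^ n = -1) :
    (FS p n 1).card = n ∧ (FS p n (-1)).card = n := by
  have ha0 : (a : ZMod p) ≠ 0 := by
    intro h; rw [h, zero_pow (by omega)] at ha; simp at ha
  have hb0 : (b : ZMod p) ≠ 0 := by
    intro h; rw [h, zero_pow (by omega)] at hb; simp at hb
  obtain ⟨h1, h2⟩ := img_eq p n hpn hn a b ha hb
  rw [← h1, ← h2, card_image_of_injOn (ff_inj p n hpn a ha0),
    card_image_of_injOn (ff_inj p n hpn b hb0)]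
  simp

lemma key (p n : ℕ) [hp : Fact p.Prime] (hpn : p = 2 * n + 1)
    (a : ℤ) (ha : (a : ZMod p) ≠ 0) :
    ((VV ((Finset.Icc 1 n).image (ff p a)) : ℤ) : ZMod p) * (sgnProd p a : ZMod p) =
      (a : ZMod p) ^ (LP (Finset.Icc 1 n)).card *
        ∏ x ∈ LP (Finset.Icc 1 n), ((x.2 : ZMod p) ^ 2 - (x.1 : ZMod p) ^ 2) := by
  have h := VV_sign (Finset.Icc 1 n) (ff p a) (ff_inj p n hpn a ha)
  have e : sgnProd p a = (-1) ^ ((LP (Finset.Icc 1 n)).filter (fun x => ff p a x.2 < ff p a x.1)).card := by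
    unfold sgnProd LP ff
    have : (p - 1) / 2 = n := by omega
    rw [this, Finset.filter_filter]
  rw [e]
  have h' := congrArg (fun z : ℤ => (z : ZMod p)) h
  simp only [Int.cast_mul, Int.cast_prod, Int.cast_sub, ff_cast] at h'
  rw [h', ← Finset.prod_const, ← Finset.prod_mul_distrib]
  apply Finset.prod_congr rfl
  intro x _
  ring

lemma refl_image (p n : ℕ) [hp : Fact p.Prime] (hpn : p = 2 * n + 1) (e e' : ZMod p) (he : e' = (-1) ^ n * e) :
    (FS p n e).image (fun x => (p : ℤ) - x) = FS p n e' := by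
  have hs : ((-1 : ZMod p) ^ n) * (-1) ^ n = 1 := by
    rw [← mul_pow]; simp
  have hh : ∀ x : ℤ, (((p : ℤ) - x : ℤ) : ZMod p) ^ n = (-1) ^ n * (x : ZMod p) ^ n := by
    intro x
    rw [← mul_pow]; congr 1; push_cast; simp
  ext x
  rw [mem_image, mem_FS]
  constructor
  · rintro ⟨y, hy, rfl⟩
    rw [mem_FS] at hy
    rw [hh, hy.2, he]
    exact ⟨by omega, rfl⟩
  · rintro ⟨h1, h2⟩
    refine ⟨p - x, ?_, by ring⟩
    rw [mem_FS, hh, h2, he, ← mul_assoc, hs, one_mul]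
    exact ⟨by omega, rfl⟩

lemma fact_mul (p n : ℕ) [hp : Fact p.Prime] (hpn : p = 2 * n + 1) (m : ℕ) (hm : m ≤ 2 * n) :
    (m.factorial : ZMod p) * ((2 * n - m).factorial : ZMod p) = (-1) ^ (m + 1) := by
  induction m with
  | zero =>
    have := ZMod.wilsons_lemma p
    rw [show p - 1 = 2 * n by omega] at this
    simp [this]
  | succ m ih =>
    have ih := ih (by omega)
    have h1 : 2 * n - m = (2 * n - (m + 1)) + 1 := by omega
    rw [h1, Nat.factorial_succ] at ih
    have h2 : (((2 * n - (m + 1)) + 1 : ℕ) : ZMod p) = - (m + 1 : ZMod p) := by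
      have : ((p : ℕ) : ZMod p) = 0 := by simp
      have h3 : p = ((2 * n - (m + 1)) + 1) + (m + 1) := by omega
      have h4 : (((((2 * n - (m + 1)) + 1) + (m + 1)) : ℕ) : ZMod p) = 0 := by
        rw [← h3]; exact this
      rw [Nat.cast_add] at h4
      push_cast at h4 ⊢
      linear_combination h4
    rw [Nat.cast_mul, h2] at ih
    rw [Nat.factorial_succ, pow_succ, ← ih]
    push_cast
    ring

lemma super (p n : ℕ) [hp : Fact p.Prime] (hpn : p = 2 * n + 1) : (∏ k ∈ range (2 * n), (k.factorial : ZMod p)) * (-1)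
    = n.factorial * (-1) ^ (∑ m ∈ range n, (m + 1)) := by
  rw [← Finset.prod_pow_eq_pow_sum]
  have hq : ∏ m ∈ range n, (-1 : ZMod p) ^ (m + 1) =
      ∏ m ∈ range n, ((m.factorial : ZMod p) * ((2 * n - m).factorial : ZMod p)) := by
    apply Finset.prod_congr rfl
    intro m hm
    rw [mem_range] at hm
    rw [fact_mul p n hpn m (by omega)]
  rw [hq]
  have h0 : ((2 * n).factorial : ZMod p) = -1 := by
    simpa using fact_mul p n hpn 0 (by omega)
  rw [← h0, ← Finset.prod_range_succ (fun k => (k.factorial : ZMod p)),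
    show 2 * n + 1 = n + (n + 1) by ring, Finset.prod_range_add, Finset.prod_range_succ',
    ← Finset.prod_range_reflect (fun k => ((n + (k + 1)).factorial : ZMod p)), ← mul_assoc,
    ← Finset.prod_mul_distrib, mul_comm]
  congr 1
  apply Finset.prod_congr rfl
  intro m hm
  rw [mem_range] at hm
  congr 3
  omega

open Polynomial in
lemma nodal_eq (p n : ℕ) [hp : Fact p.Prime] (hpn : p = 2 * n + 1)
    (hn : 1 ≤ n) (a : ℤ) (ha : (a : ZMod p) ^ n = 1) :
    Lagrange.nodal (Finset.Icc 1 n) (fun j : ℕ => (a : ZMod p) * (j : ZMod p) ^ 2) = X ^ n - 1 := by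
  have ha0 : (a : ZMod p) ≠ 0 := by
    intro h; rw [h, zero_pow (by omega)] at ha; simp at ha
  apply Polynomial.eq_of_degree_le_of_eval_index_eq (s := Finset.Icc 1 n)
    (v := fun j : ℕ => (a : ZMod p) * (j : ZMod p) ^ 2)
  · intro j hj k hk h
    simp only [coe_Icc, Set.mem_Icc] at hj hk
    exact sq_inj p n hpn j k hj.1 hj.2 hk.1 hk.2 (mul_left_cancel₀ ha0 h)
  · rw [Lagrange.degree_nodal]
  · rw [Lagrange.degree_nodal, ← C_1, degree_X_pow_sub_C (by omega)]; simp
  · rw [Lagrange.nodal_monic.leadingCoeff, ← C_1, leadingCoeff_X_pow_sub_C (by omega)]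
  · intro j hj
    rw [Lagrange.eval_nodal_at_node (v := fun j : ℕ => (a : ZMod p) * (j : ZMod p) ^ 2) hj]
    rw [mem_Icc] at hj
    have hj0 := nat_ne_zero p n hpn j hj.1 (by omega)
    simp [mul_pow, ha, ← pow_mul, pow_2n p n hpn _ hj0]

open Polynomial in
lemma disc (p n : ℕ) [hp : Fact p.Prime] (hpn : p = 2 * n + 1)
    (hn : 1 ≤ n) :
    (∏ x ∈ LP (Finset.Icc 1 n), ((x.2 : ZMod p) ^ 2 - (x.1 : ZMod p) ^ 2)) ^ 2 *
      (-1) ^ (LP (Finset.Icc 1 n)).card = (n : ZMod p) ^ n * ((n.factorial : ZMod p) ^ 2) ^ (n - 1) := by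
  have h := prod_offDiag (Finset.Icc 1 n) (fun x y : ℕ => ((x : ZMod p) ^ 2 - (y : ZMod p) ^ 2))
  have e1 : ∏ x ∈ LP (Finset.Icc 1 n), ((x.1 : ZMod p) ^ 2 - (x.2 : ZMod p) ^ 2) =
      (∏ x ∈ LP (Finset.Icc 1 n), ((x.2 : ZMod p) ^ 2 - (x.1 : ZMod p) ^ 2)) *
      (-1) ^ (LP (Finset.Icc 1 n)).card := by
    rw [← Finset.prod_const, ← Finset.prod_mul_distrib]
    apply Finset.prod_congr rfl
    intros; ring
  rw [e1] at h
  have e2 : ∏ x ∈ (Finset.Icc 1 n).offDiag, ((x.1 : ZMod p) ^ 2 - (x.2 : ZMod p) ^ 2)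
      = ∏ x ∈ Finset.Icc 1 n, ∏ y ∈ (Finset.Icc 1 n).erase x, ((x : ZMod p) ^ 2 - (y : ZMod p) ^ 2) := by
    rw [Finset.prod_sigma']
    refine Finset.prod_bij' (fun x _ => ⟨x.1, x.2⟩) (fun x _ => (x.1, x.2)) ?_ ?_ ?_ ?_ ?_
    · rintro ⟨x, y⟩ h
      simp only [mem_offDiag, mem_sigma, mem_erase] at h ⊢
      exact ⟨h.1, h.2.2.symm, h.2.1⟩
    · rintro ⟨x, y⟩ h
      simp only [mem_offDiag, mem_sigma, mem_erase] at h ⊢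
      exact ⟨h.1, h.2.2, h.2.1.symm⟩
    all_goals simp
  have e3 : ∀ x ∈ Finset.Icc 1 n, ∏ y ∈ (Finset.Icc 1 n).erase x, ((x : ZMod p) ^ 2 - (y : ZMod p) ^ 2)
      = n * ((x : ZMod p) ^ 2) ^ (n - 1) := by
    intro x hx
    have := Lagrange.eval_nodal_derivative_eval_node_eq
      (v := fun j : ℕ => ((1 : ℤ) : ZMod p) * (j : ZMod p) ^ 2) hx
    rw [nodal_eq p n hpn hn 1 (by simp), Lagrange.eval_nodal] at this
    simp [derivative_X_pow] at this
    exact this.symm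
  rw [e2, Finset.prod_congr rfl e3, Finset.prod_mul_distrib, Finset.prod_const, Finset.prod_pow,
    Finset.prod_pow] at h
  have e4 : ∏ x ∈ Finset.Icc 1 n, (x : ZMod p) = n.factorial := by
    rw [← Nat.cast_prod]; congr 1; exact Finset.prod_Ico_id_eq_factorial n
  rw [e4] at h
  simp only [Nat.card_Icc, Nat.add_sub_cancel] at h
  rw [h]; ring

lemma cross (p n : ℕ) [hp : Fact p.Prime] (hpn : p = 2 * n + 1)
    (hn : 1 ≤ n) (a b : ℤ) (ha : (a : ZMod p) ^ n = 1) (hb : (b : ZMod p) ^ n = -1) :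
    ∏ x ∈ FS p n 1 ×ˢ FS p n (-1), (((x.2 - x.1 : ℤ)) : ZMod p) = (-2) ^ n := by
  have ha0 : (a : ZMod p) ≠ 0 := by
    intro h; rw [h, zero_pow (by omega)] at ha; simp at ha
  have hc := (FS_card p n hpn hn a b ha hb).2
  rw [Finset.prod_product_right]
  rw [Finset.prod_congr rfl (g := fun _ => (-2 : ZMod p)), Finset.prod_const, hc]
  intro s hs
  rw [mem_FS] at hs
  simp only
  rw [← (img_eq p n hpn hn a b ha hb).1, Finset.prod_image (ff_inj p n hpn a ha0)]
  have := congrArg (Polynomial.eval (s : ZMod p)) (nodal_eq p n hpn hn a ha)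
  rw [Lagrange.eval_nodal] at this
  simp only [Int.cast_sub, ff_cast]
  rw [this]
  simp [hs.2]
  norm_num

lemma cross_abs (p n : ℕ) [hp : Fact p.Prime] (hpn : p = 2 * n + 1)
    (hn : 1 ≤ n) (m : ℕ) (hm : n = 2 * m) (a b : ℤ)
    (ha : (a : ZMod p) ^ n = 1) (hb : (b : ZMod p) ^ n = -1) :
    (((∏ x ∈ FS p n 1 ×ˢ FS p n (-1), |x.2 - x.1| : ℤ)) : ZMod p) = (-2) ^ n := by
  rw [← cross p n hpn hn a b ha hb, ← Int.cast_prod]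
  congr 1
  set T := FS p n 1 ×ˢ FS p n (-1) with hT
  have h1 : ∏ x ∈ T, |x.2 - x.1| = (∏ x ∈ T, (x.2 - x.1)) * (-1) ^ (T.filter (fun x => x.2 < x.1)).card := by
    rw [← Finset.prod_const, Finset.prod_filter, ← Finset.prod_mul_distrib]
    apply Finset.prod_congr rfl
    intro x _
    split_ifs with h
    · rw [abs_of_neg] <;> linarith
    · rw [abs_of_nonneg] <;> linarith
  have hneg : (-1 : ZMod p) ^ n = 1 := by rw [hm, pow_mul]; simp
  have r1 : ∀ x ∈ FS p n 1, (p : ℤ) - x ∈ FS p n 1 := by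
    intro x hx
    rw [← refl_image p n hpn 1 1 (by rw [hneg, one_mul])]
    exact mem_image_of_mem _ hx
  have r2 : ∀ x ∈ FS p n (-1), (p : ℤ) - x ∈ FS p n (-1) := by
    intro x hx
    rw [← refl_image p n hpn (-1) (-1) (by rw [hneg, one_mul])]
    exact mem_image_of_mem _ hx
  have h2 : (T.filter (fun x => x.2 < x.1)).card = (T.filter (fun x => ¬ x.2 < x.1)).card := by
    refine Finset.card_bij' (fun x _ => ((p : ℤ) - x.1, (p : ℤ) - x.2))
      (fun x _ => ((p : ℤ) - x.1, (p : ℤ) - x.2)) ?_ ?_ ?_ ?_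
    · rintro ⟨x, y⟩ h
      simp only [hT, mem_filter, mem_product] at h ⊢
      exact ⟨⟨r1 x h.1.1, r2 y h.1.2⟩, by omega⟩
    · rintro ⟨x, y⟩ h
      simp only [hT, mem_filter, mem_product] at h ⊢
      refine ⟨⟨r1 x h.1.1, r2 y h.1.2⟩, ?_⟩
      have : x ≠ y := by
        rintro rfl
        exact Finset.disjoint_left.1 (FS_disj p n hpn hn) h.1.1 h.1.2
      omega
    · simp
    · simp
  have h3 := Finset.card_filter_add_card_filter_not (s := T) (fun x => x.2 < x.1)
  rw [← h2, hT, card_product, (FS_card p n hpn hn a b ha hb).1, (FS_card p n hpn hn a b ha hb).2,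
    ← hT] at h3
  have h4 : (T.filter (fun x => x.2 < x.1)).card = 2 * (m * m) := by
    rw [hm] at h3
    nlinarith
  rw [h1, h4, pow_mul]
  simp

lemma sgn_cases (p : ℕ) (a : ℤ) : sgnProd p a = 1 ∨ sgnProd p a = -1 := by
  unfold sgnProd
  exact neg_one_pow_eq_or _ _

end Aux8

namespace Aux8

open Finset

lemma int_eq (p n : ℕ) [hp : Fact p.Prime] (hpn : p = 2 * n + 1) (hn : 1 ≤ n) (s t : ℤ)
    (hs : s = 1 ∨ s = -1) (ht : t = 1 ∨ t = -1) (h : (s : ZMod p) = t) : s = t := by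
  have h1 := one_ne_neg p n hpn hn
  rcases hs with rfl | rfl <;> rcases ht with rfl | rfl
  · rfl
  · push_cast at h; exact absurd h h1
  · push_cast at h; exact absurd h.symm h1
  · rfl

lemma sgn_sq (p : ℕ) (a : ℤ) : (sgnProd p a : ZMod p) * (sgnProd p a : ZMod p) = 1 := by
  rcases sgn_cases p a with h | h <;> rw [h] <;> simp

lemma case3 (p n m : ℕ) [hp : Fact p.Prime] (hpn : p = 2 * n + 1) (hm : n = 2 * m + 1) (a b : ℤ)
    (ha : (a : ZMod p) ^ n = 1) (hb : (b : ZMod p) ^ n = -1) :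
    sgnProd p a * sgnProd p b = (-1) ^ m := by
  have hn : 1 ≤ n := by omega
  have ha0 : (a : ZMod p) ≠ 0 := by
    intro h; rw [h, zero_pow (by omega)] at ha; simp at ha
  have hb0 : (b : ZMod p) ≠ 0 := by
    intro h; rw [h, zero_pow (by omega)] at hb; simp at hb
  have k1 := key p n hpn a ha0
  have k2 := key p n hpn b hb0
  obtain ⟨i1, i2⟩ := img_eq p n hpn hn a b ha hb
  have hneg : (-1 : ZMod p) ^ n = -1 := by rw [hm, pow_succ, pow_mul]; simp
  have hr := refl_image p n hpn 1 (-1) (by rw [hneg, mul_one])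
  rw [i1] at k1
  rw [i2, ← hr, VV_refl] at k2
  have hq : (LP (Finset.Icc 1 n)).card = n * m := by
    have := card_LP (Finset.Icc 1 n)
    simp only [Nat.card_Icc, Nat.add_sub_cancel] at this
    subst hm
    nlinarith
  rw [hq, pow_mul, ha, one_pow, one_mul] at k1
  rw [hq, pow_mul, hb] at k2
  set P := ∏ x ∈ LP (Finset.Icc 1 n), ((x.2 : ZMod p) ^ 2 - (x.1 : ZMod p) ^ 2) with hP
  have hP0 : P ≠ 0 := by
    rw [hP, Finset.prod_ne_zero_iff]
    rintro ⟨j, k⟩ hx h0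
    simp only [LP, mem_filter, mem_product, mem_Icc] at hx h0
    have := sq_inj p n hpn k j hx.1.2.1 hx.1.2.2 hx.1.1.1 hx.1.1.2 (sub_eq_zero.1 h0)
    omega
  apply int_eq p n hpn hn
  · rcases sgn_cases p a with h | h <;> rcases sgn_cases p b with h' | h' <;> rw [h, h'] <;> simp
  · exact neg_one_pow_eq_or _ _
  push_cast
  apply mul_right_cancel₀ hP0
  rw [← k2, ← k1]
  linear_combination (VV (FS p n 1) : ZMod p) * (sgnProd p b : ZMod p) * sgn_sq p a

lemma case1 (p n m : ℕ) [hp : Fact p.Prime] (hpn : p = 2 * n + 1) (hm : n = 2 * m) (a b : ℤ)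
    (ha : (a : ZMod p) ^ n = 1) (hb : (b : ZMod p) ^ n = -1) :
    sgnProd p a * sgnProd p b = (-1) ^ (m + 1) * deltaP p (a * b) := by
  have hn : 1 ≤ n := by have := hp.out.two_le; omega
  have ha0 : (a : ZMod p) ≠ 0 := by
    intro h; rw [h, zero_pow (by omega)] at ha; simp at ha
  have hb0 : (b : ZMod p) ≠ 0 := by
    intro h; rw [h, zero_pow (by omega)] at hb; simp at hb
  have k1 := key p n hpn a ha0
  have k2 := key p n hpn b hb0
  obtain ⟨i1, i2⟩ := img_eq p n hpn hn a b ha hb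
  rw [i1] at k1
  rw [i2] at k2
  have hneg : (-1 : ZMod p) ^ n = 1 := by rw [hm, pow_mul]; simp
  have d := disc p n hpn hn
  have c := cross_abs p n hpn hn m hm a b ha hb
  have u := VV_union _ _ (FS_disj p n hpn hn)
  rw [FS_union p n hpn, VV_Icc] at u
  have u' := congrArg (fun z : ℤ => (z : ZMod p)) u
  simp only [Int.cast_mul] at u'
  rw [c] at u'
  have sf := super p n hpn
  have ff2 : (n.factorial : ZMod p) ^ 2 = -1 := by
    have := fact_mul p n hpn n (by omega)
    rw [show 2 * n - n = n by omega, pow_succ, hneg] at this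
    rw [sq, this]; ring
  have hq2 := card_LP (Finset.Icc 1 n)
  simp only [Nat.card_Icc, Nat.add_sub_cancel] at hq2
  set q := (LP (Finset.Icc 1 n)).card with hq
  set P := ∏ x ∈ LP (Finset.Icc 1 n), ((x.2 : ZMod p) ^ 2 - (x.1 : ZMod p) ^ 2) with hP
  have hqm : q + m = n * m := by subst hm; nlinarith
  -- sign evaluations
  have hs1 : (-1 : ZMod p) ^ (n - 1) = -1 := by
    have : (-1 : ZMod p) ^ (n - 1) * (-1) = 1 := by
      rw [← pow_succ, Nat.sub_add_cancel hn, hneg]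
    linear_combination -this
  have hsum : ∑ k ∈ range n, (k + 1) = q + n := by
    have h1 := Finset.sum_range_id_mul_two n
    rw [Finset.sum_add_distrib]
    simp only [sum_const, card_range, smul_eq_mul, mul_one]
    have : n * (n - 1) + n = n * n := by
      obtain ⟨k, rfl⟩ : ∃ k, n = k + 1 := ⟨n - 1, by omega⟩
      simp; ring
    omega
  have hsq : (-1 : ZMod p) ^ q * (-1) ^ q = 1 := by rw [← mul_pow]; simp
  have h2n : (-2 : ZMod p) ^ n * (n : ZMod p) ^ n = 1 := by
    rw [← mul_pow]
    have h0 : ((p : ℕ) : ZMod p) = 0 := by simp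
    have h1 : ((2 * n + 1 : ℕ) : ZMod p) = 0 := by rw [← hpn]; exact h0
    push_cast at h1
    rw [show (-2 : ZMod p) * n = 1 by linear_combination -h1, one_pow]
  rw [ff2, hs1] at d
  rw [hsum, pow_add, hneg, mul_one] at sf
  push_cast at u'
  rw [u'] at sf
  set t : ZMod p := (sgnProd p a : ZMod p) * (sgnProd p b : ZMod p) with ht
  have main : t * (n.factorial : ZMod p) = ((a : ZMod p) * b) ^ q := by
    have e1 : t * (n.factorial : ZMod p) * (-1) ^ q =
        - ((a : ZMod p) ^ q * P) * ((b : ZMod p) ^ q * P) * (-2) ^ n := by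
      rw [← k1, ← k2, mul_assoc, ← sf, ht]; ring
    have e2 : t * (n.factorial : ZMod p) * ((-1) ^ q * (-1) ^ q) =
        - ((a : ZMod p) * b) ^ q * (-2) ^ n * (P ^ 2 * (-1) ^ q) := by
      rw [← mul_assoc, e1, mul_pow]; ring
    rw [hsq, d, mul_one] at e2
    rw [e2]
    linear_combination ((a : ZMod p) * b) ^ q * h2n
  set C : ZMod p := (a : ZMod p) * b with hC
  have hCn : C ^ n = -1 := by rw [hC, mul_pow, ha, hb]; ring
  have hCm : C ^ m * C ^ m = -1 := by rw [← pow_add, ← two_mul, ← hm, hCn]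
  have hCq : C ^ q * C ^ m = (-1) ^ m := by rw [← pow_add, hqm, pow_mul, hCn]
  have main2 : t * (n.factorial : ZMod p) = (-1) ^ (m + 1) * C ^ m := by
    rw [main, pow_succ, ← hCq]
    linear_combination C ^ q * hCm
  have hf0 : (n.factorial : ZMod p) ≠ 0 := by
    intro h; rw [h] at ff2; simp at ff2
  have hdel : C ^ m = (deltaP p (a * b) : ZMod p) * (n.factorial : ZMod p) := by
    unfold deltaP
    rw [show (p - 1) / 4 = m by omega, show (p - 1) / 2 = n by omega]
    have hcast : ((a * b : ℤ) : ZMod p) = C := by rw [hC]; push_cast; rfl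
    rw [hcast]
    split_ifs with h
    · rw [h]; simp
    · rcases sq_eq_sq_iff_eq_or_eq_neg.1 (show (C ^ m) ^ 2 = (n.factorial : ZMod p) ^ 2 by
        rw [ff2, sq, hCm]) with h' | h'
      · exact absurd h' h
      · rw [h']; simp
  have hd : deltaP p (a * b) = 1 ∨ deltaP p (a * b) = -1 := by
    unfold deltaP; split_ifs <;> simp
  apply int_eq p n hpn hn
  · rcases sgn_cases p a with h | h <;> rcases sgn_cases p b with h' | h' <;> rw [h, h'] <;> simp
  · rcases neg_one_pow_eq_or ℤ (m + 1) with h | h <;> rcases hd with h' | h' <;> rw [h, h'] <;> simp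
  push_cast
  apply mul_right_cancel₀ hf0
  rw [← ht, main2, hdel]
  ring

end Aux8

/-- For an odd prime `p` and integers `a, b` with `(a/p) = 1` and `(b/p) = −1`:
`s_p(a)·s_p(b) = (−1)^{(p+3)/4}·δ(ab,p)` if `p ≡ 1 (mod 4)`, and
`s_p(a)·s_p(b) = (−1)^{(p−3)/4}` if `p ≡ 3 (mod 4)`. -/
theorem stmt8 (p : ℕ) [Fact p.Prime] (hp2 : p ≠ 2) (a b : ℤ)
    (ha : legendreSym p a = 1) (hb : legendreSym p b = -1) :
    (p % 4 = 1 → sgnProd p a * sgnProd p b = (-1) ^ ((p + 3) / 4) * deltaP p (a * b)) ∧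
    (p % 4 = 3 → sgnProd p a * sgnProd p b = (-1) ^ ((p - 3) / 4)) := by
  have hodd : p % 2 = 1 := (Nat.Prime.eq_two_or_odd (Fact.out : p.Prime)).resolve_left hp2
  have ha' : (a : ZMod p) ^ (p / 2) = 1 := by rw [← legendreSym.eq_pow, ha]; simp
  have hb' : (b : ZMod p) ^ (p / 2) = -1 := by rw [← legendreSym.eq_pow, hb]; simp
  constructor
  · intro h
    have := Aux8.case1 p (p / 2) (p / 4) (by omega) (by omega) a b ha' hb'
    rwa [show (p + 3) / 4 = p / 4 + 1 by omega]
  · intro h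
    have := Aux8.case3 p (p / 2) (p / 4) (by omega) (by omega) a b ha' hb'
    rwa [show (p - 3) / 4 = p / 4 by omega]
end

section
/- Let p > 3 be a prime with p ≡ 3 (mod 4), and let a, b be integers with p ∤ ab. Then for every real number x: T_p^{(1)}(a,b,x) = −2^{(p−1)/2}·p^{(p−3)/4}·x if (ab/p) = 1, and T_p^{(1)}(a,b,x) = p^{(p−3)/4}·x if (ab/p) = −1. -/
open Matrix Finset in
lemma cauchy_det {K : Type*} [Field K] : ∀ (n : ℕ) (x y : Fin n → K), (∀ i j, x i + y j ≠ 0) →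
    Matrix.det (Matrix.of fun i j => (x i + y j)⁻¹) =
      (vandermonde x).det * (vandermonde y).det * ∏ i, ∏ j, (x i + y j)⁻¹ := by
  intro n
  induction n with
  | zero => intro x y h; simp
  | succ n ih =>
    intro x y h
    have step : Matrix.det (Matrix.of fun i j => (x i + y j)⁻¹) =
      Matrix.det (Matrix.of fun i j : Fin (n+1) => if j = 0 then (x i + y 0)⁻¹ else
        (x i - x 0) * (y j - y 0) * ((x i + y j)⁻¹ * (x i + y 0)⁻¹ * (x 0 + y j)⁻¹)) := by
      rw [← det_transpose, ← det_transpose (Matrix.of _)]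
      apply det_eq_of_forall_row_eq_smul_add_const
        (fun j => if j = 0 then 0 else (x 0 + y 0) * (x 0 + y j)⁻¹) 0 (by simp)
      intro j i
      simp only [transpose_apply, of_apply]
      by_cases hj : j = 0
      · subst hj; simp
      · simp only [hj, if_false, if_true]
        have h1 := h i j
        have h2 := h i 0
        have h3 := h 0 j
        field_simp
        ring
    rw [step, det_succ_row_zero, Fin.sum_univ_succ, Finset.sum_eq_zero, add_zero]
    swap
    · intro j _; simp
    have hm : (Matrix.of fun i j : Fin (n+1) => if j = 0 then (x i + y 0)⁻¹ else
        (x i - x 0) * (y j - y 0) * ((x i + y j)⁻¹ * (x i + y 0)⁻¹ * (x 0 + y j)⁻¹)).submatrix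
          Fin.succ (Fin.succAbove 0) =
        Matrix.of fun i j : Fin n => ((x i.succ - x 0) * (x i.succ + y 0)⁻¹) *
          (Matrix.of fun i j : Fin n => ((y j.succ - y 0) * (x 0 + y j.succ)⁻¹) *
            (Matrix.of fun i j : Fin n => (x i.succ + y j.succ)⁻¹) i j) i j := by
      ext i j
      simp [Fin.succ_ne_zero]
      ring
    rw [hm, det_mul_column, det_mul_row, ih _ _ (fun i j => h _ _)]
    simp only [det_vandermonde, Fin.prod_univ_succ, Fin.prod_Ioi_zero, Fin.prod_Ioi_succ,
      prod_mul_distrib]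
    simp
    ring

namespace TanDet

/-- The subgroup of nonzero squares modulo `p`. -/
def G (p : ℕ) : Subgroup (ZMod p)ˣ := (powMonoidHom 2 : (ZMod p)ˣ →* (ZMod p)ˣ).range

noncomputable instance (p : ℕ) [Fact p.Prime] : Fintype (G p) := Fintype.ofFinite _

/-- The residue class of an element of `G p`. -/
def v {p : ℕ} (g : G p) : ZMod p := ((g : (ZMod p)ˣ) : ZMod p)

section
variable {p : ℕ} [Fact p.Prime]

lemma v_mul (g h : G p) : v (g * h) = v g * v h := by simp [v]
lemma v_one : v (1 : G p) = 1 := by simp [v]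
lemma v_ne (g : G p) : v g ≠ 0 := by simp [v]
lemma v_inj {p : ℕ} {g h : G p} (H : v g = v h) : g = h := by
  apply Subtype.ext; apply Units.ext; exact H

lemma mem_G (u : (ZMod p)ˣ) : u ∈ G p ↔ u ^ (p / 2) = 1 := by
  rw [← ZMod.euler_criterion_units]
  simp [G, MonoidHom.mem_range]

lemma neg_mem_G (hp4 : p % 4 = 3) (u : (ZMod p)ˣ) : -u ∈ G p ↔ u ∉ G p := by
  have hodd : Odd (p / 2) := ⟨p / 4, by omega⟩
  rw [mem_G, mem_G, hodd.neg_pow]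
  have h := ZMod.pow_div_two_eq_neg_one_or_one p u.ne_zero
  have hne : (-1 : ZMod p) ≠ 1 := by
    have : Fact (2 < p) := ⟨by have := (Fact.out : p.Prime).two_le; omega⟩
    exact ZMod.neg_one_ne_one
  simp only [Units.ext_iff, Units.val_neg, Units.val_pow_eq_pow_val, Units.val_one]
  rcases h with h | h <;> rw [h]
  · simp [hne]
  · simp
    exact hne

lemma exists_v (hp4 : p % 4 = 3) {c : ZMod p} (hc : c ≠ 0) :
    (∃ g : G p, c = v g) ∨ (∃ g : G p, c = - v g) := by
  by_cases h : Units.mk0 c hc ∈ G p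
  · left; exact ⟨⟨_, h⟩, rfl⟩
  · right
    rw [← neg_mem_G hp4] at h
    exact ⟨⟨_, h⟩, by simp [v]⟩

lemma v_ne_neg (hp4 : p % 4 = 3) (g h : G p) : v g ≠ - v h := by
  intro H
  have : (g : (ZMod p)ˣ) = - (h : (ZMod p)ˣ) := by
    apply Units.ext; simpa [v] using H
  have h1 : -(h : (ZMod p)ˣ) ∈ G p := this ▸ g.2
  exact (neg_mem_G hp4 _).1 h1 h.2

lemma prod_shift (f : ZMod p → ℂ) (c : ZMod p) (g : G p) :
    ∏ r : G p, f (c * v g * v r) = ∏ r : G p, f (c * v r) :=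
  Fintype.prod_equiv (Equiv.mulLeft g) _ _ (fun r => by simp [v_mul, mul_assoc])

lemma prod_double (f : ZMod p → ℂ) (a b : ZMod p) :
    ∏ r : G p, ∏ s : G p, f (a * v r + b * v s) = ∏ t : G p, ∏ r : G p, f ((a + b * v t) * v r) := by
  conv_rhs => rw [Finset.prod_comm]
  refine Finset.prod_congr rfl fun r _ => ?_
  symm
  exact Fintype.prod_equiv (Equiv.mulLeft r) _ _ (fun t => by simp [v_mul]; congr 1; ring)

lemma prod_units (hp4 : p % 4 = 3) (f : (ZMod p)ˣ → ℂ) :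
    ∏ u, f u = (∏ g : G p, f g) * ∏ g : G p, f (-g) := by
  classical
  rw [← Fintype.prod_subtype_mul_prod_subtype (fun u => u ∈ G p) f]
  congr 1
  · congr!
  · refine Fintype.prod_equiv
      ⟨fun u => ⟨-u.1, (neg_mem_G hp4 _).2 u.2⟩, fun g => ⟨-g.1, fun h => 
        (neg_mem_G hp4 _).1 h g.2⟩, fun u => by simp, fun u => by simp⟩ _ _ (fun u => by simp)

/-- The enumeration of squares. -/
lemma exists_enum (hp4 : p % 4 = 3) : ∃ e : Fin ((p - 1) / 2) ≃ G p,
    ∀ j, v (e j) = (((j : ℕ) : ZMod p) + 1) ^ 2 := by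
  have hne : ∀ j : Fin ((p - 1) / 2), ((((j : ℕ) + 1 : ℕ)) : ZMod p) ≠ 0 := by
    intro j h
    rw [ZMod.natCast_eq_zero_iff] at h
    have := Nat.le_of_dvd (by omega) h
    have := j.2
    omega
  let f : Fin ((p - 1) / 2) → G p := fun j => ⟨(Units.mk0 _ (hne j)) ^ 2, ⟨Units.mk0 _ (hne j), rfl⟩⟩
  have hf : ∀ j, v (f j) = (((j : ℕ) : ZMod p) + 1) ^ 2 := by
    intro j; simp [v, f]
  have hb : Function.Bijective f := by
    constructor
    · intro j k h
      have h1 := congrArg v h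
      rw [hf, hf, sq_eq_sq_iff_eq_or_eq_neg] at h1
      have := j.2
      have := k.2
      rcases h1 with h1 | h1
      · have h2 : (((j : ℕ) : ZMod p)) = ((k : ℕ) : ZMod p) := by linear_combination h1
        rw [ZMod.natCast_eq_natCast_iff', Nat.mod_eq_of_lt (by omega), Nat.mod_eq_of_lt (by omega)] at h2
        exact Fin.ext h2
      · have h2 : (((j : ℕ) + k + 2 : ℕ) : ZMod p) = 0 := by push_cast; linear_combination h1
        rw [ZMod.natCast_eq_zero_iff] at h2
        have := Nat.le_of_dvd (by omega) h2
        omega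
    · intro g
      obtain ⟨u, y, hy⟩ := g
      have hy0 : (y : ZMod p).valMinAbs ≠ 0 := by
        rw [Ne, ZMod.valMinAbs_eq_zero]; exact y.ne_zero
      have hle := ZMod.natAbs_valMinAbs_le (y : ZMod p)
      have hpos : 0 < (y : ZMod p).valMinAbs.natAbs := Int.natAbs_pos.2 hy0
      refine ⟨⟨(y : ZMod p).valMinAbs.natAbs - 1, by omega⟩, ?_⟩
      apply v_inj
      rw [hf]
      have h1 : (((y : ZMod p).valMinAbs.natAbs - 1 : ℕ) : ZMod p) + 1 = ((y : ZMod p).valMinAbs.natAbs : ZMod p) := by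
        rw [Nat.cast_sub (by omega)]; simp
      simp only [h1]
      have h2 : (((y : ZMod p).valMinAbs.natAbs : ZMod p)) ^ 2 = (((y : ZMod p).valMinAbs : ℤ) : ZMod p) ^ 2 := by
        have : (((y : ZMod p).valMinAbs.natAbs : ℤ)) ^ 2 = ((y : ZMod p).valMinAbs) ^ 2 := Int.natAbs_sq _
        have := congrArg (Int.cast : ℤ → ZMod p) this
        push_cast at this
        simpa using this
      rw [h2, ZMod.coe_valMinAbs]
      have := congrArg (Units.val) hy
      simpa [v] using this
  exact ⟨Equiv.ofBijective f hb, hf⟩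

lemma card_G (hp4 : p % 4 = 3) : Fintype.card (G p) = (p - 1) / 2 := by
  obtain ⟨e, -⟩ := exists_enum (p := p) hp4
  rw [← Fintype.card_congr e]; simp

lemma sum_v (hp : 3 < p) : ∑ g : G p, v g = 0 := by
  have h2 : (2 : ZMod p) ≠ 0 := by
    intro h
    have : ((2 : ℕ) : ZMod p) = 0 := by exact_mod_cast h
    rw [ZMod.natCast_eq_zero_iff] at this
    have := Nat.le_of_dvd (by omega) this
    omega
  have h3 : (3 : ZMod p) ≠ 0 := by
    intro h
    have : ((3 : ℕ) : ZMod p) = 0 := by exact_mod_cast h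
    rw [ZMod.natCast_eq_zero_iff] at this
    have := Nat.le_of_dvd (by omega) this
    omega
  let g : G p := ⟨(Units.mk0 _ h2) ^ 2, ⟨Units.mk0 _ h2, rfl⟩⟩
  have hg : v g = 4 := by simp [v, g]; norm_num
  have : ∑ r : G p, v g * v r = ∑ r : G p, v r :=
    Fintype.sum_equiv (Equiv.mulLeft g) _ _ (fun r => by simp [v_mul])
  rw [← Finset.mul_sum, hg] at this
  have h : 3 * ∑ r : G p, v r = 0 := by linear_combination this
  exact (mul_eq_zero.1 h).resolve_left h3

end

section
variable {p : ℕ} [Fact p.Prime]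

/-- The standard additive character. -/
noncomputable def ψ (x : ZMod p) : ℂ := ZMod.stdAddChar x

lemma ψ_add (x y : ZMod p) : ψ (x + y) = ψ x * ψ y := AddChar.map_add_eq_mul _ _ _
lemma ψ_zero : ψ (0 : ZMod p) = 1 := AddChar.map_zero_eq_one _
lemma ψ_neg_mul (x : ZMod p) : ψ (-x) * ψ x = 1 := by rw [← ψ_add]; simp [ψ_zero]
lemma ψ_ne (x : ZMod p) : ψ x ≠ 0 := right_ne_zero_of_mul_eq_one (ψ_neg_mul x)
lemma ψ_neg (x : ZMod p) : ψ (-x) = (ψ x)⁻¹ := eq_inv_of_mul_eq_one_left (ψ_neg_mul x)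
lemma ψ_conj (x : ZMod p) : ψ (-x) = (starRingEnd ℂ) (ψ x) := AddChar.map_neg_eq_conj _ _
lemma ψ_inj {x y : ZMod p} (h : ψ x = ψ y) : x = y := ZMod.injective_stdAddChar h
lemma ψ_nsmul (k : ℕ) (x : ZMod p) : ψ ((k : ZMod p) * x) = ψ x ^ k := by
  rw [← nsmul_eq_mul]; exact AddChar.map_nsmul_eq_pow _ _ _
lemma ψ_pow (x : ZMod p) : ψ x ^ p = 1 := by
  rw [← ψ_nsmul]; simp [ψ_zero]
lemma ψ_sum {ι : Type*} (s : Finset ι) (f : ι → ZMod p) : ψ (∑ i ∈ s, f i) = ∏ i ∈ s, ψ (f i) := by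
  classical
  induction s using Finset.induction_on with
  | empty => simp [ψ_zero]
  | insert i s hi ih => rw [Finset.sum_insert hi, Finset.prod_insert hi, ψ_add, ih]

lemma one_add_ψ_ne (hp4 : p % 4 = 3) (x : ZMod p) : 1 + ψ x ≠ 0 := by
  intro h
  have h1 : ψ x = -1 := by linear_combination h
  have h2 := ψ_pow x
  rw [h1, Odd.neg_one_pow ⟨p / 2, by omega⟩] at h2
  norm_num at h2

lemma prod_ψ (hp : 3 < p) (c : ZMod p) : ∏ r : G p, ψ (c * v r) = 1 := by
  rw [← ψ_sum, ← Finset.mul_sum, sum_v hp, mul_zero, ψ_zero]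

noncomputable def P (c : ZMod p) : ℂ := ∏ r : G p, (1 - ψ (c * v r))
noncomputable def U (c : ZMod p) : ℂ := ∏ r : G p, (1 + ψ (c * v r))

lemma P_shift (c : ZMod p) (g : G p) : P (c * v g) = P c := prod_shift (fun x => 1 - ψ x) c g

lemma oddn {p : ℕ} (hp4 : p % 4 = 3) : Odd ((p - 1) / 2) := ⟨p / 4, by omega⟩

lemma P_neg (hp : 3 < p) (hp4 : p % 4 = 3) (c : ZMod p) : P (-c) = - P c := by
  have : ∀ r : G p, 1 - ψ (-c * v r) = (-1) * (ψ (-c * v r) * (1 - ψ (c * v r))) := by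
    intro r
    have := ψ_neg_mul (c * v r)
    rw [neg_mul]
    linear_combination -this
  simp only [P, this, Finset.prod_mul_distrib, prod_ψ hp]
  rw [Finset.prod_const, Finset.card_univ, card_G hp4, (oddn hp4).neg_one_pow]
  ring

lemma prod_units_one_sub : ∏ u : (ZMod p)ˣ, (1 - ψ (u : ZMod p)) = p := by
  have hp1 := (Fact.out : p.Prime).two_le
  have hprim : IsPrimitiveRoot (ψ (1 : ZMod p)) (p - 1 + 1) := by
    rw [Nat.sub_add_cancel (by omega)]
    refine IsPrimitiveRoot.mk_of_lt _ (by omega) (ψ_pow _) ?_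
    intro l hl hlp h
    rw [← ψ_nsmul, ← ψ_zero (p := p)] at h
    have := ψ_inj h
    rw [mul_one, ZMod.natCast_eq_zero_iff] at this
    have := Nat.le_of_dvd hl this
    omega
  have h := hprim.prod_one_sub_pow_eq_order
  rw [← Nat.cast_add_one, Nat.sub_add_cancel (by omega)] at h
  rw [← h]
  have hpos : ∀ u : (ZMod p)ˣ, 0 < (u : ZMod p).val := by
    intro u
    rw [Nat.pos_iff_ne_zero, Ne, ZMod.val_eq_zero]
    exact u.ne_zero
  refine Finset.prod_nbij (fun u : (ZMod p)ˣ => (u : ZMod p).val - 1) ?_ ?_ ?_ ?_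
  · intro u _
    have := hpos u
    have := ZMod.val_lt (u : ZMod p)
    simp; omega
  · intro u _ w _ huw
    have h1 := hpos u
    have h2 := hpos w
    apply Units.ext
    apply ZMod.val_injective
    simp only at huw
    omega
  · intro k hk
    simp at hk
    have hne : ((k + 1 : ℕ) : ZMod p) ≠ 0 := by
      rw [Ne, ZMod.natCast_eq_zero_iff]
      intro hd
      have := Nat.le_of_dvd (by omega) hd
      omega
    refine ⟨Units.mk0 _ hne, by simp, ?_⟩
    simp only [Units.val_mk0]
    rw [ZMod.val_natCast, Nat.mod_eq_of_lt (by omega)]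
    simp
  · intro u _
    have h1 := hpos u
    rw [Nat.sub_add_cancel h1, ← ψ_nsmul]
    simp

lemma P_mul (hp4 : p % 4 = 3) {c : ZMod p} (hc : c ≠ 0) : P c * P (-c) = p := by
  rw [← prod_units_one_sub (p := p)]
  have : ∏ u : (ZMod p)ˣ, (1 - ψ (u : ZMod p)) = ∏ u : (ZMod p)ˣ, (1 - ψ (c * (u : ZMod p))) := by
    symm
    exact Fintype.prod_equiv (Equiv.mulLeft (Units.mk0 c hc)) _ _ (fun u => by simp)
  rw [this, prod_units hp4]
  simp [P, v]

lemma P_ne (hp4 : p % 4 = 3) {c : ZMod p} (hc : c ≠ 0) : P c ≠ 0 := by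
  have h := P_mul hp4 hc
  have : (p : ℂ) ≠ 0 := by exact_mod_cast (Fact.out : p.Prime).ne_zero
  rw [← h] at this
  exact left_ne_zero_of_mul this

lemma two_ne (hp4 : p % 4 = 3) : (2 : ZMod p) ≠ 0 := by
  intro h
  have : ((2 : ℕ) : ZMod p) = 0 := by exact_mod_cast h
  rw [ZMod.natCast_eq_zero_iff] at this
  have := Nat.le_of_dvd (by omega) this
  interval_cases p <;> omega

lemma isSquare_v (g : G p) : IsSquare (v g) := by
  obtain ⟨u, y, hy⟩ := g
  refine ⟨y, ?_⟩
  have := congrArg Units.val hy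
  simp [v, ← this, sq]

lemma isSquare_exists {c : ZMod p} (hc : c ≠ 0) (h : IsSquare c) : ∃ g : G p, c = v g := by
  obtain ⟨y, hy⟩ := h
  have hy0 : y ≠ 0 := by rintro rfl; simp at hy; exact hc hy
  exact ⟨⟨(Units.mk0 y hy0) ^ 2, ⟨Units.mk0 y hy0, rfl⟩⟩, by simp [v, hy, sq]⟩

lemma U_val (hp : 3 < p) (hp4 : p % 4 = 3) {c : ZMod p} (hc : c ≠ 0) :
    U c = if p % 8 = 7 then 1 else -1 := by
  have h1 : U c * P c = P (c * 2) := by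
    simp only [U, P, ← Finset.prod_mul_distrib]
    refine Finset.prod_congr rfl fun r _ => ?_
    rw [show c * 2 * v r = c * v r + c * v r by ring, ψ_add]
    ring
  have hP := P_ne hp4 hc
  have hsq := ZMod.exists_sq_eq_two_iff (p := p) (by omega)
  apply mul_right_cancel₀ hP
  rw [h1]
  rcases exists_v hp4 (two_ne hp4) with ⟨g, hg⟩ | ⟨g, hg⟩
  · have : IsSquare (2 : ZMod p) := hg ▸ isSquare_v g
    rw [hsq] at this
    rw [if_pos (by omega), hg, P_shift, one_mul]
  · have : ¬ IsSquare (2 : ZMod p) := by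
      intro h
      obtain ⟨k, hk⟩ := isSquare_exists (two_ne hp4) h
      exact v_ne_neg hp4 k g (hk ▸ hg)
    rw [hsq] at this
    rw [if_neg (by omega), hg, mul_neg, P_neg hp hp4, P_shift]
    ring

lemma U_zero (hp4 : p % 4 = 3) : U (0 : ZMod p) = 2 ^ ((p - 1) / 2) := by
  simp [U, ψ_zero, card_G hp4]; norm_num

end

section
variable {p : ℕ} [Fact p.Prime]
open Matrix Finset

/-- Vandermonde determinants of the powers of the root of unity. -/
noncomputable def V (e : Fin ((p - 1) / 2) ≃ G p) (c : ZMod p) : ℂ :=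
  (vandermonde fun i => ψ (c * v (e i))).det

lemma V_sign (e : Fin ((p - 1) / 2) ≃ G p) (c : ZMod p) (g : G p) :
    V e (c * v g) = (Equiv.Perm.sign ((e.trans (Equiv.mulLeft g)).trans e.symm) : ℤ) * V e c := by
  unfold V
  rw [← det_permute]
  congr 1
  ext i j
  simp [vandermonde_apply, v_mul, mul_assoc]

lemma V_shift (hp4 : p % 4 = 3) (e : Fin ((p - 1) / 2) ≃ G p) (c : ZMod p) (g : G p) :
    V e (c * v g) = V e c := by
  have hg : g ^ ((p - 1) / 2) = 1 := by rw [← card_G hp4]; exact pow_card_eq_one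
  obtain ⟨m, hm⟩ := oddn hp4
  have : g = g ^ (m + 1) * g ^ (m + 1) := by
    rw [← pow_add, show m + 1 + (m + 1) = (2 * m + 1) + 1 by ring, ← hm, pow_succ, hg, one_mul]
  rw [this, v_mul, ← mul_assoc, V_sign, V_sign, ← mul_assoc, ← Int.cast_mul, ← Units.val_mul,
    Int.units_mul_self]
  simp

lemma V_neg (hp : 3 < p) (hp4 : p % 4 = 3) (e : Fin ((p - 1) / 2) ≃ G p) (c : ZMod p) :
    V e (-c) = (-1) ^ (p / 4) * V e c := by
  have key : ∀ i j, ψ (-c * v (e j)) - ψ (-c * v (e i)) =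
      (-1) * (ψ (-c * v (e j)) * ψ (-c * v (e i))) * (ψ (c * v (e j)) - ψ (c * v (e i))) := by
    intro i j
    simp only [neg_mul, ψ_neg]
    have h1 := ψ_ne (c * v (e j))
    have h2 := ψ_ne (c * v (e i))
    field_simp
    ring
  have hw : ∏ i, ψ (-c * v (e i)) = 1 := by
    rw [← prod_ψ hp (-c)]
    exact Fintype.prod_equiv e _ _ (fun _ => rfl)
  have h2 : ∏ i, ∏ j ∈ Ioi i, ψ (-c * v (e j)) * ψ (-c * v (e i)) = 1 := by
    rw [prod_prod_Ioi_mul_eq_prod_prod_off_diag (fun j _ => ψ (-c * v (e j)))]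
    have : ∀ i, ∏ j ∈ {i}ᶜ, ψ (-c * v (e j)) = (ψ (-c * v (e i)))⁻¹ := by
      intro i
      have := Fintype.prod_eq_mul_prod_compl i (fun j => ψ (-c * v (e j)))
      rw [hw] at this
      exact eq_inv_of_mul_eq_one_right this.symm
    simp only [this, prod_inv_distrib, hw, inv_one]
  have h3 : ∏ i : Fin ((p - 1) / 2), ∏ j ∈ Ioi i, (-1 : ℂ) = (-1) ^ (p / 4) := by
    simp only [prod_const, Fin.card_Ioi]
    rw [Fin.prod_univ_eq_prod_range (fun i => (-1 : ℂ) ^ ((p - 1) / 2 - 1 - i)),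
      prod_range_reflect (fun i => (-1 : ℂ) ^ i), prod_pow_eq_pow_sum, sum_range_id]
    have : (p - 1) / 2 * ((p - 1) / 2 - 1) / 2 = (p - 1) / 2 * (p / 4) := by
      rw [show (p - 1) / 2 - 1 = (p / 4) * 2 by omega, ← mul_assoc, Nat.mul_div_cancel _ (by norm_num)]
    rw [this, pow_mul, (oddn hp4).neg_one_pow]
  unfold V
  rw [det_vandermonde, det_vandermonde]
  simp only [key, prod_mul_distrib] at *
  rw [h2, h3]
  ring

lemma V_conj (e : Fin ((p - 1) / 2) ≃ G p) (c : ZMod p) :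
    V e c * V e (-c) = (Complex.normSq (V e c) : ℝ) := by
  rw [← Complex.mul_conj]
  congr 1
  unfold V
  rw [RingHom.map_det]
  congr 1
  ext i j
  simp [vandermonde_apply, ψ_conj]

lemma V_sq (hp4 : p % 4 = 3) (e : Fin ((p - 1) / 2) ≃ G p) {c : ZMod p} (hc : c ≠ 0) :
    (V e c * V e (-c)) ^ 2 = (p : ℂ) ^ ((p - 1) / 2 - 1) := by
  classical
  let F : ZMod p → ℂ := fun x => if x = 0 then 1 else 1 - ψ x
  have h1 : V e c * V e (-c) = ∏ i, ∏ j ∈ ({i}ᶜ : Finset _), (1 - ψ (c * v (e j) + -c * v (e i))) := by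
    rw [← prod_prod_Ioi_mul_eq_prod_prod_off_diag (fun j i => (1 - ψ (c * v (e j) + -c * v (e i))))]
    unfold V
    rw [det_vandermonde, det_vandermonde, ← prod_mul_distrib]
    refine prod_congr rfl fun i _ => ?_
    rw [← prod_mul_distrib]
    refine prod_congr rfl fun j _ => ?_
    simp only [neg_mul, ψ_neg, ψ_add]
    have h1 := ψ_ne (c * v (e j))
    have h2 := ψ_ne (c * v (e i))
    field_simp
  have h2 : V e c * V e (-c) = ∏ r : G p, ∏ s : G p, F (c * v r + -c * v s) := by
    rw [h1, prod_comm]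
    symm
    refine Fintype.prod_equiv e.symm _ _ fun s => ?_
    rw [Fintype.prod_equiv e.symm _ (fun j => F (c * v (e j) + -c * v s)) (fun r => by simp)]
    rw [Fintype.prod_eq_mul_prod_compl (e.symm s)]
    rw [show F (c * v (e (e.symm s)) + -c * v s) = 1 by simp [F], one_mul]
    refine prod_congr rfl fun j hj => ?_
    simp only [mem_compl, mem_singleton] at hj
    have : c * v (e j) + -c * v s ≠ 0 := by
      intro h
      have h' : c * (v (e j) - v s) = 0 := by linear_combination h
      have := (mul_eq_zero.1 h').resolve_left hc
      have := v_inj (sub_eq_zero.1 this)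
      apply hj
      rw [← this]; simp
    rw [e.apply_symm_apply]
    exact if_neg this
  have hF : ∀ {d : ZMod p}, d ≠ 0 → ∏ r : G p, F (d * v r) = P d := by
    intro d hd
    refine prod_congr rfl fun r _ => ?_
    simp [F, hd, v_ne]
  have h3 : V e c * V e (-c) = ∏ t : G p, ∏ r : G p, F ((c + -c * v t) * v r) := by
    rw [h2, prod_double]
  have h4 : V e c * V e (-c) = ∏ t : G p, ∏ r : G p, F ((c + -c * v t⁻¹) * v r) := by
    rw [h3]
    exact Fintype.prod_equiv (Equiv.inv _) _ _ (fun t => by simp)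
  rw [sq]
  nth_rw 1 [h3]
  rw [h4, ← prod_mul_distrib]
  have h5 : ∀ t : G p, (∏ r : G p, F ((c + -c * v t) * v r)) * (∏ r : G p, F ((c + -c * v t⁻¹) * v r))
      = if t = 1 then 1 else (p : ℂ) := by
    intro t
    split_ifs with ht
    · subst ht; simp [v_one, F]
    · have hn : c + -c * v t ≠ 0 := by
        intro h
        apply ht
        have h' : c * (1 - v t) = 0 := by linear_combination h
        have := (mul_eq_zero.1 h').resolve_left hc
        apply v_inj
        rw [v_one]; linear_combination -this
      have htt : v t * v t⁻¹ = 1 := by rw [← v_mul]; simp [v_one]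
      have hn' : c + -c * v t⁻¹ = -(c + -c * v t) * v t⁻¹ := by linear_combination -c * htt
      rw [hn', prod_shift, hF hn, hF (neg_ne_zero.2 hn), P_mul hp4 hn]
  rw [prod_congr rfl (fun t _ => h5 t), Fintype.prod_eq_mul_prod_compl 1]
  rw [prod_congr rfl (g := fun _ => (p : ℂ))]
  · rw [prod_const, card_compl, card_G hp4]; simp
  · intro t ht
    simp at ht
    simp [ht]

lemma V_val (hp4 : p % 4 = 3) (e : Fin ((p - 1) / 2) ≃ G p) {c : ZMod p} (hc : c ≠ 0) :
    V e c * V e (-c) = (p : ℂ) ^ ((p - 3) / 4) := by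
  have h1 := V_sq hp4 e hc
  rw [V_conj] at h1 ⊢
  have h2 : (Complex.normSq (V e c)) ^ 2 = ((p : ℝ) ^ ((p - 3) / 4)) ^ 2 := by
    rw [← pow_mul, show (p - 3) / 4 * 2 = (p - 1) / 2 - 1 by omega]
    exact_mod_cast h1
  rw [sq_eq_sq₀ (Complex.normSq_nonneg _) (by positivity)] at h2
  rw [h2]; push_cast; rfl

lemma det_cauchy (hp : 3 < p) (hp4 : p % 4 = 3) (e : Fin ((p - 1) / 2) ≃ G p) (a b : ZMod p) :
    Matrix.det (Matrix.of fun i j => (1 + ψ (a * v (e i) + b * v (e j)))⁻¹) =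
      V e (-a) * V e b * (∏ t : G p, U (a + b * v t))⁻¹ := by
  have hw : ∏ i, ψ (-a * v (e i)) = 1 := by
    rw [← prod_ψ hp (-a)]
    exact Fintype.prod_equiv e _ _ (fun _ => rfl)
  have hxy : ∀ i j, ψ (-a * v (e i)) + ψ (b * v (e j)) =
      ψ (-a * v (e i)) * (1 + ψ (a * v (e i) + b * v (e j))) := by
    intro i j
    have := ψ_neg_mul (a * v (e i))
    rw [neg_mul, ψ_add]
    linear_combination - ψ (b * v (e j)) * this
  have hne : ∀ i j, ψ (-a * v (e i)) + ψ (b * v (e j)) ≠ 0 := by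
    intro i j; rw [hxy]; exact mul_ne_zero (ψ_ne _) (one_add_ψ_ne hp4 _)
  have h1 := cauchy_det _ (fun i => ψ (-a * v (e i))) (fun j => ψ (b * v (e j))) hne
  have h2 : Matrix.det (Matrix.of fun i j => (1 + ψ (a * v (e i) + b * v (e j)))⁻¹) =
     Matrix.det (Matrix.of fun i j => ψ (-a * v (e i)) * 
      (Matrix.of fun i j => (ψ (-a * v (e i)) + ψ (b * v (e j)))⁻¹) i j) := by
    congr 1
    ext i j
    simp only [of_apply, hxy]
    rw [mul_inv, mul_inv_cancel_left₀ (ψ_ne (-a * v (e i)))]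
  rw [h2, det_mul_column, hw, one_mul, h1]
  unfold V
  congr 1
  simp only [hxy, mul_inv, prod_mul_distrib, prod_inv_distrib, prod_const]
  rw [prod_pow, hw, one_pow, inv_one, one_mul]
  congr 1
  have := prod_double (fun x => 1 + ψ x) a b
  simp only [U]
  rw [← this]
  refine Fintype.prod_equiv e _ _ fun i => ?_
  exact Fintype.prod_equiv e _ _ fun j => rfl

lemma IU {p : ℕ} (hp4 : p % 4 = 3) : Complex.I ^ ((p - 1) / 2) * (if p % 8 = 7 then 1 else -1) = - Complex.I := by
  split_ifs with h
  · rw [show (p - 1) / 2 = 4 * (p / 8) + 3 by omega, pow_add, pow_mul, Complex.I_pow_four]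
    simp
  · rw [show (p - 1) / 2 = 4 * (p / 8) + 1 by omega, pow_add, pow_mul, Complex.I_pow_four]
    simp

/-- The Cauchy determinant when `ab` is a square. -/
lemma D_pos (hp : 3 < p) (hp4 : p % 4 = 3) (e : Fin ((p - 1) / 2) ≃ G p) {a b : ZMod p}
    (hb : b ≠ 0) (g : G p) (ha : a = b * v g) :
    (2 * Complex.I) ^ ((p - 1) / 2) *
      Matrix.det (Matrix.of fun i j => (1 + ψ (a * v (e i) + b * v (e j)))⁻¹) =
      (-(2 : ℂ) ^ ((p - 1) / 2) * (p : ℂ) ^ ((p - 3) / 4)) * Complex.I := by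
  rw [det_cauchy hp hp4]
  have h1 : V e (-a) * V e b = (p : ℂ) ^ ((p - 3) / 4) := by
    rw [ha, ← neg_mul, V_shift hp4, mul_comm, V_val hp4 e hb]
  have h2 : ∀ t : G p, U (a + b * v t) = if p % 8 = 7 then 1 else -1 := by
    intro t
    apply U_val hp hp4
    intro h
    have : b * (v g + v t) = 0 := by rw [ha] at h; linear_combination h
    have := (mul_eq_zero.1 this).resolve_left hb
    exact v_ne_neg hp4 g t (by linear_combination this)
  have h3 : (∏ t : G p, U (a + b * v t))⁻¹ = if p % 8 = 7 then 1 else -1 := by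
    simp only [h2, prod_const, card_univ, card_G hp4]
    split_ifs
    · simp
    · rw [(oddn hp4).neg_one_pow]; norm_num
  rw [h1, h3, mul_pow]
  have := IU hp4
  linear_combination (2 : ℂ) ^ ((p - 1) / 2) * (p : ℂ) ^ ((p - 3) / 4) * this

/-- The Cauchy determinant when `ab` is not a square. -/
lemma D_neg (hp : 3 < p) (hp4 : p % 4 = 3) (e : Fin ((p - 1) / 2) ≃ G p) {a b : ZMod p}
    (hb : b ≠ 0) (g : G p) (ha : a = -(b * v g)) :
    (2 * Complex.I) ^ ((p - 1) / 2) *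
      Matrix.det (Matrix.of fun i j => (1 + ψ (a * v (e i) + b * v (e j)))⁻¹) =
      (p : ℂ) ^ ((p - 3) / 4) * Complex.I := by
  classical
  rw [det_cauchy hp hp4]
  have hs : ((-1 : ℂ) ^ (p / 4)) * ((-1 : ℂ) ^ (p / 4)) = 1 := by
    rw [← mul_pow]; simp
  have h1 : V e (-a) * V e b = (-1) ^ (p / 4) * (p : ℂ) ^ ((p - 3) / 4) := by
    rw [ha, neg_neg, V_shift hp4, ← V_val hp4 e hb, V_neg hp hp4]
    linear_combination (- V e b * V e b) * hs
  have h2 : ∀ t : G p, t ≠ g → U (a + b * v t) = if p % 8 = 7 then 1 else -1 := by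
    intro t ht
    apply U_val hp hp4
    intro h
    have : b * (v t - v g) = 0 := by rw [ha] at h; linear_combination h
    have := (mul_eq_zero.1 this).resolve_left hb
    exact ht (v_inj (by linear_combination this))
  have h3 : ∏ t : G p, U (a + b * v t) = 2 ^ ((p - 1) / 2) := by
    rw [Fintype.prod_eq_mul_prod_compl g, show a + b * v g = 0 by rw [ha]; ring, U_zero hp4]
    rw [prod_congr rfl (g := fun _ => if p % 8 = 7 then (1 : ℂ) else -1)]
    · rw [prod_const, card_compl, card_G hp4, card_singleton]
      split_ifs
      · simp
      · rw [Even.neg_one_pow ⟨p / 4, by omega⟩, mul_one]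
    · intro t ht
      simp at ht
      exact h2 t ht
  rw [h1, h3, mul_pow]
  have h4 : Complex.I ^ ((p - 1) / 2) * (-1) ^ (p / 4) = Complex.I := by
    rw [show (p - 1) / 2 = 2 * (p / 4) + 1 by omega, pow_succ, pow_mul, Complex.I_sq]
    linear_combination Complex.I * hs
  have : (2 : ℂ) ^ ((p - 1) / 2) ≠ 0 := pow_ne_zero _ two_ne_zero
  rw [← div_eq_mul_inv, mul_div_assoc', div_eq_iff this]
  linear_combination (p : ℂ) ^ ((p - 3) / 4) * 2 ^ ((p - 1) / 2) * h4

lemma tan_eq (hp4 : p % 4 = 3) (c : ℤ) :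
    ((Real.tan (Real.pi * (c : ℝ) / p) : ℝ) : ℂ) =
      -Complex.I + 2 * Complex.I * (1 + ψ (c : ZMod p))⁻¹ := by
  have h := one_add_ψ_ne hp4 (c : ZMod p)
  have hψ : ψ (c : ZMod p) = Complex.exp (((Real.pi * (c : ℝ) / p : ℝ) : ℂ) * Complex.I) ^ 2 := by
    unfold ψ
    rw [ZMod.stdAddChar_coe, ← Complex.exp_nat_mul]
    congr 1
    push_cast
    ring
  rw [hψ] at h ⊢
  rw [Complex.ofReal_tan]
  generalize ((Real.pi * (c : ℝ) / p : ℝ) : ℂ) = θ at *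
  rw [Complex.tan_eq_sin_div_cos, Complex.sin, Complex.cos]
  rw [neg_mul, Complex.exp_neg]
  have h0 := Complex.exp_ne_zero (θ * Complex.I)
  generalize Complex.exp (θ * Complex.I) = z at *
  have h2 : z + z⁻¹ ≠ 0 := by
    intro hz
    apply h
    field_simp at hz
    linear_combination hz
  have h3 : z ^ 2 + 1 ≠ 0 := by rwa [add_comm]
  field_simp
  ring

/-- Determinants that are affine in `x`. -/
lemma affine {n : ℕ} (M : Matrix (Fin n) (Fin n) ℝ) (C : Matrix (Fin n) (Fin n) ℂ)
    (hM : ∀ i j, (M i j : ℂ) = -Complex.I + 2 * Complex.I * C i j) (γ : ℝ) (hγ : γ ≠ 0)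
    (hC : (2 * Complex.I) ^ n * C.det = γ * Complex.I) (x : ℝ) :
    Matrix.det (Matrix.of fun i j => x + M i j) = γ * x := by
  have hdet : ((2 * Complex.I) • C).det = γ * Complex.I := by
    rw [det_smul, Fintype.card_fin, hC]
  have hunit : IsUnit ((2 * Complex.I) • C).det := by
    rw [hdet]; simp [hγ]
  let R : Matrix Unit (Fin n) ℂ := replicateRow Unit (fun _ => (1 : ℂ))
  let L : Matrix (Fin n) Unit ℂ := replicateCol Unit (fun _ => (1 : ℂ))
  obtain ⟨κ, hκ⟩ : ∃ κ : ℂ, ∀ x : ℝ, ((Matrix.det (Matrix.of fun i j => x + M i j) : ℝ) : ℂ) =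
      γ * Complex.I * (1 + (x - Complex.I) * κ) := by
    refine ⟨(R * ((2 * Complex.I) • C)⁻¹ * L) () (), fun x => ?_⟩
    let L' : Matrix (Fin n) Unit ℂ := replicateCol Unit (fun _ => (x - Complex.I : ℂ))
    have h : ((2 * Complex.I) • C + L' * R).det =
        ((2 * Complex.I) • C).det * (1 + R * ((2 * Complex.I) • C)⁻¹ * L').det :=
      det_add_replicateCol_mul_replicateRow (ι := Unit) hunit
        (fun _ => (x - Complex.I : ℂ)) (fun _ => 1)
    have e1 : ((Matrix.det (Matrix.of fun i j => x + M i j) : ℝ) : ℂ) =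
      ((2 * Complex.I) • C + L' * R).det := by
      have := RingHom.map_det Complex.ofRealHom (Matrix.of fun i j => x + M i j)
      rw [Complex.ofRealHom_eq_coe] at this
      rw [this]
      congr 1
      ext i j
      simp [hM, Matrix.mul_apply, L', R]
      ring
    rw [e1, h, hdet]
    congr 1
    have : L' = (x - Complex.I : ℂ) • L := by
      ext i j; simp [L, L']
    rw [this, Matrix.mul_smul, det_unique]
    simp
  have h0 := congrArg Complex.im (hκ 0)
  have h1 := congrArg Complex.im (hκ 1)
  have hx := congrArg Complex.re (hκ x)
  simp at h0 h1 hx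
  have hi : κ.im = -1 := by
    have := h0.resolve_left hγ
    linarith
  have hr : κ.re = 0 := by
    have := h1.resolve_left hγ
    linarith
  rw [hx, hi, hr]
  ring

end

end TanDet

/-- For a prime `p > 3` with `p ≡ 3 (mod 4)`, integers `a, b` with `p ∤ ab`,
and every real `x`: `T_p^{(1)}(a,b,x) = −2^{(p−1)/2}·p^{(p−3)/4}·x` if `(ab/p) = 1`, and
`T_p^{(1)}(a,b,x) = p^{(p−3)/4}·x` if `(ab/p) = −1`. -/
theorem stmt13 (p : ℕ) [Fact p.Prime] (hp : 3 < p) (hp4 : p % 4 = 3) (a b : ℤ)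
    (hab : ¬ (p : ℤ) ∣ a * b) (x : ℝ) :
    (legendreSym p (a * b) = 1 →
      Matrix.det (Matrix.of fun j k : Fin ((p - 1) / 2) =>
        x + Real.tan (Real.pi *
          ((a * (((j : ℕ) : ℤ) + 1) ^ 2 + b * (((k : ℕ) : ℤ) + 1) ^ 2 : ℤ) : ℝ) / p)) =
      -(2 : ℝ) ^ ((p - 1) / 2) * (p : ℝ) ^ ((p - 3) / 4) * x) ∧
    (legendreSym p (a * b) = -1 →
      Matrix.det (Matrix.of fun j k : Fin ((p - 1) / 2) =>
        x + Real.tan (Real.pi *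
          ((a * (((j : ℕ) : ℤ) + 1) ^ 2 + b * (((k : ℕ) : ℤ) + 1) ^ 2 : ℤ) : ℝ) / p)) =
      (p : ℝ) ^ ((p - 3) / 4) * x) := by
  have hab0 : ((a * b : ℤ) : ZMod p) ≠ 0 := by
    rwa [Ne, ZMod.intCast_zmod_eq_zero_iff_dvd]
  have ha : (a : ZMod p) ≠ 0 := by
    intro h; apply hab0; simp [h]
  have hb : (b : ZMod p) ≠ 0 := by
    intro h; apply hab0; simp [h]
  have hp0 : (p : ℝ) ≠ 0 := by
    have : 0 < p := by omega
    positivity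
  obtain ⟨e, he⟩ := TanDet.exists_enum (p := p) hp4
  have hM : ∀ j k : Fin ((p - 1) / 2), ((Real.tan (Real.pi *
          ((a * (((j : ℕ) : ℤ) + 1) ^ 2 + b * (((k : ℕ) : ℤ) + 1) ^ 2 : ℤ) : ℝ) / p) : ℝ) : ℂ) =
      -Complex.I + 2 * Complex.I * (Matrix.of fun i j => (1 + TanDet.ψ ((a : ZMod p) * TanDet.v (e i) +
        (b : ZMod p) * TanDet.v (e j)))⁻¹) j k := by
    intro j k
    rw [TanDet.tan_eq hp4]
    simp [he]
  have hq : (a : ZMod p) = b * (a / b) := by field_simp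
  have hcase := TanDet.exists_v hp4 (div_ne_zero ha hb)
  constructor
  · intro hl
    rw [legendreSym.eq_one_iff p hab0] at hl
    rcases hcase with ⟨g, hg⟩ | ⟨g, hg⟩
    · refine TanDet.affine (Matrix.of fun j k : Fin ((p - 1) / 2) => Real.tan (Real.pi *
          ((a * (((j : ℕ) : ℤ) + 1) ^ 2 + b * (((k : ℕ) : ℤ) + 1) ^ 2 : ℤ) : ℝ) / p)) _ hM _
          (mul_ne_zero (neg_ne_zero.2 (by positivity)) (by positivity)) ?_ x
      rw [TanDet.D_pos hp hp4 e hb g (by rw [← hg]; exact hq)]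
      push_cast
      rfl
    · exfalso
      obtain ⟨y, hy⟩ := hl
      push_cast at hy
      obtain ⟨k, hk⟩ := TanDet.isSquare_exists (div_ne_zero ha hb) ⟨y / b, by
        field_simp; rw [sq, ← hy]⟩
      exact TanDet.v_ne_neg hp4 k g (hk ▸ hg)
  · intro hl
    rw [legendreSym.eq_neg_one_iff] at hl
    rcases hcase with ⟨g, hg⟩ | ⟨g, hg⟩
    · exfalso
      apply hl
      obtain ⟨y, hy⟩ := TanDet.isSquare_v g
      refine ⟨b * y, ?_⟩
      push_cast
      rw [hq, hg, hy]
      ring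
    · refine TanDet.affine (Matrix.of fun j k : Fin ((p - 1) / 2) => Real.tan (Real.pi *
          ((a * (((j : ℕ) : ℤ) + 1) ^ 2 + b * (((k : ℕ) : ℤ) + 1) ^ 2 : ℤ) : ℝ) / p)) _ hM _
          (by positivity) ?_ x
      rw [TanDet.D_neg hp hp4 e hb g (by rw [hq, hg]; ring)]
      push_cast
      rfl
end
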